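/- As an R-module, the affine walled Brauer-Clifford superalgebra BC^{aff}_{r,t} is spanned by its regular monomials, i.e. by the elements x^α d x̄^β ∏_{n ≥ 1} ω_{2n+1}^{a_{2n+1}} with (α, β) ∈ ℕ^r × ℕ^t, a_{2n+1} ∈ ℕ almost all zero, and d ∈ S. -/

import Mathlib

open Polynomial

noncomputable section

/-- Transposition `(a b)` (0-based indices) in the symmetric group on `Fin n`;
it is `1` if an index is out of range. -/
def sw (n a b : ℕ) : Equiv.Perm (Fin n) :=
  if h : a < n ∧ b < n then Equiv.swap ⟨a, h.1⟩ ⟨b, h.2⟩ else 1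

/-- The permutation word `s_{i,j}` of the paper (1-based indices):
`s_{i,j} = s_i s_{i+1,j}` for `i < j`, `s_{i,i} = 1`, `s_{i,j} = s_{i,j+1} s_j` for `i > j`. -/
def sIJ (n i j : ℕ) : Equiv.Perm (Fin n) :=
  if i < j then ((List.range' i (j - i)).map (fun k => sw n (k - 1) k)).prod
  else ((List.range' j (i - j)).reverse.map (fun k => sw n (k - 1) k)).prod

/-- The coefficients `a_{2n+1,j}` of the paper: `acoef ω n j = a_{2n+1,j}`, defined by the
recursion `a_{1,0} = -1`, `a_{2n+1,j+1} = a_{2n-1,j}` and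
`a_{2n+1,0} = ∑_{j=0}^{n-1} a_{2n-1,j} ω_{2j+1}`. -/
def acoef {A : Type} [Ring A] (ω : ℕ → A) : ℕ → ℕ → A
  | 0, _ => -1
  | n + 1, 0 => ∑ j ∈ Finset.range (n + 1), acoef ω n j * ω (2 * j + 1)
  | n + 1, j + 1 => acoef ω n j

/-- The parameters `ω̄_k` determined by the parameters `ω` as in Corollary 3.5:
`ω̄_{2n} = 0` and `ω̄_{2n+1} = ∑_{j=0}^{n} a_{2n+1,j} ω_{2j+1}`. -/
def obar {R : Type} [CommRing R] (ω : ℕ → R) (k : ℕ) : R :=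
  if k % 2 = 0 then 0
  else ∑ j ∈ Finset.range (k / 2 + 1), acoef ω (k / 2) j * ω (2 * j + 1)

/-- Data for the presentation of the walled Brauer–Clifford superalgebra `BC_{r,t}`
(Definition 2.1 together with relations (2.1)–(2.3)) on an `R`-algebra `A`.
The images of the two symmetric groups are recorded as monoid homomorphisms, so the
symmetric group relations among the `s_i` (resp. `s̄_j`) hold automatically. -/
structure WBC (R A : Type) [CommRing R] [Ring A] [Algebra R A] (r t : ℕ) : Type where
  σ : Equiv.Perm (Fin r) →* A
  σb : Equiv.Perm (Fin t) →* A
  c : Fin r → A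
  cb : Fin t → A
  e : A
  c_sq : ∀ i, c i * c i = -1
  c_anti : ∀ i j, i ≠ j → c i * c j = -(c j * c i)
  c_conj : ∀ w i, σ w * c i * σ (w⁻¹) = c (w i)
  cb_sq : ∀ i, cb i * cb i = 1
  cb_anti : ∀ i j, i ≠ j → cb i * cb j = -(cb j * cb i)
  cb_conj : ∀ w i, σb w * cb i * σb (w⁻¹) = cb (w i)
  comm_σσb : ∀ w v, σ w * σb v = σb v * σ w
  comm_σcb : ∀ w j, σ w * cb j = cb j * σ w
  comm_σbc : ∀ v i, σb v * c i = c i * σb v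
  anti_ccb : ∀ i j, c i * cb j = -(cb j * c i)
  e_c1 : ∀ (h1 : 0 < r) (h2 : 0 < t), e * c ⟨0, h1⟩ = e * cb ⟨0, h2⟩
  c1_e : ∀ (h1 : 0 < r) (h2 : 0 < t), c ⟨0, h1⟩ * e = cb ⟨0, h2⟩ * e
  e_sq : e * e = 0
  e_s_e : 1 < r → e * σ (sw r 0 1) * e = e
  e_sb_e : 1 < t → e * σb (sw t 0 1) * e = e
  s_e_comm : ∀ i : ℕ, 0 < i → i + 1 < r → σ (sw r i (i + 1)) * e = e * σ (sw r i (i + 1))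
  sb_e_comm : ∀ j : ℕ, 0 < j → j + 1 < t → σb (sw t j (j + 1)) * e = e * σb (sw t j (j + 1))
  braid1 : 1 < r → 1 < t →
    e * σ (sw r 0 1) * σb (sw t 0 1) * e * σ (sw r 0 1)
      = e * σ (sw r 0 1) * σb (sw t 0 1) * e * σb (sw t 0 1)
  braid2 : 1 < r → 1 < t →
    σ (sw r 0 1) * e * σ (sw r 0 1) * σb (sw t 0 1) * e
      = σb (sw t 0 1) * e * σ (sw r 0 1) * σb (sw t 0 1) * e
  c_e_comm : ∀ i : Fin r, (i : ℕ) ≠ 0 → c i * e = e * c i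
  cb_e_comm : ∀ j : Fin t, (j : ℕ) ≠ 0 → cb j * e = e * cb j
  e_c_e : ∀ h : 0 < r, e * c ⟨0, h⟩ * e = 0
  e_cb_e : ∀ h : 0 < t, e * cb ⟨0, h⟩ * e = 0

namespace WBC

variable {R A : Type} [CommRing R] [Ring A] [Algebra R A] {r t : ℕ}

/-- The transposition `(i,j) ∈ Σ_r` (1-based indices). -/
def tr (d : WBC R A r t) (i j : ℕ) : A := d.σ (sw r (i - 1) (j - 1))

/-- The transposition `(ī,j̄) ∈ Σ_t` (1-based indices). -/
def trb (d : WBC R A r t) (i j : ℕ) : A := d.σb (sw t (i - 1) (j - 1))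

/-- The generator `s_j = (j, j+1)` (1-based). -/
def s (d : WBC R A r t) (j : ℕ) : A := d.σ (sw r (j - 1) j)

/-- The generator `s̄_j` (1-based). -/
def sb (d : WBC R A r t) (j : ℕ) : A := d.σb (sw t (j - 1) j)

/-- The generator `c_i` (1-based). -/
def cn (d : WBC R A r t) (i : ℕ) : A := if h : i - 1 < r then d.c ⟨i - 1, h⟩ else 0

/-- The generator `c̄_i` (1-based). -/
def cbn (d : WBC R A r t) (i : ℕ) : A := if h : i - 1 < t then d.cb ⟨i - 1, h⟩ else 0

/-- `e_{i,j} = (1̄,j̄)(1,i) e_1 (1,i)(1̄,j̄)` (1-based). -/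
def E (d : WBC R A r t) (i j : ℕ) : A := d.trb 1 j * d.tr 1 i * d.e * d.tr 1 i * d.trb 1 j

/-- `ē_{i,j} = c_i e_{i,j} c_i`. -/
def Eb (d : WBC R A r t) (i j : ℕ) : A := d.cn i * d.E i j * d.cn i

/-- `L'_i = ∑_{j=1}^{i-1} (j,i)`. -/
def LL (d : WBC R A r t) (i : ℕ) : A := ∑ j ∈ Finset.Ico 1 i, d.tr j i

/-- The Jucys–Murphy element `L_i = L'_i + c_i L'_i c_i`. -/
def L (d : WBC R A r t) (i : ℕ) : A := d.LL i + d.cn i * d.LL i * d.cn i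

/-- `L̄'_i = ∑_{j=1}^{i-1} (j̄,ī)`. -/
def LLb (d : WBC R A r t) (i : ℕ) : A := ∑ j ∈ Finset.Ico 1 i, d.trb j i

/-- The Jucys–Murphy element `L̄_i = L̄'_i - c̄_i L̄'_i c̄_i`. -/
def Lb (d : WBC R A r t) (i : ℕ) : A := d.LLb i - d.cbn i * d.LLb i * d.cbn i

/-- `y_i = ∑_{j=1}^{i-1} (e_{i,j} + ē_{i,j}) - L_i`. -/
def y (d : WBC R A r t) (i : ℕ) : A := (∑ j ∈ Finset.Ico 1 i, (d.E i j + d.Eb i j)) - d.L i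

/-- `ȳ_i = ∑_{j=1}^{i-1} (e_{j,i} - ē_{j,i}) - L̄_i`. -/
def yb (d : WBC R A r t) (i : ℕ) : A := (∑ j ∈ Finset.Ico 1 i, (d.E j i - d.Eb j i)) - d.Lb i

/-- `c^α = c_1^{α_1} ⋯ c_r^{α_r}`. -/
def cpow (d : WBC R A r t) (α : Fin r → Fin 2) : A :=
  ((List.finRange r).map (fun i => d.c i ^ (α i : ℕ))).prod

/-- `c̄^β = c̄_1^{β_1} ⋯ c̄_t^{β_t}`. -/
def cbpow (d : WBC R A r t) (β : Fin t → Fin 2) : A :=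
  ((List.finRange t).map (fun j => d.cb j ^ (β j : ℕ))).prod

/-- `e^f = e_1 e_2 ⋯ e_f`. -/
def epow (d : WBC R A r t) (f : ℕ) : A :=
  ((List.range f).map (fun i => d.E (i + 1) (i + 1))).prod

/-- Generators of the subalgebra `BC_{m,m}`: the elements `e_1`, `s_1, …, s_{m-1}`,
`s̄_1, …, s̄_{m-1}`, `c_1` and `c̄_1` (interpreted as `∅` when `m = 0`). -/
def lowerGens (d : WBC R A r t) (m : ℕ) : Set A :=
  {x | (1 ≤ m ∧ x = d.e) ∨ (∃ j : ℕ, 1 ≤ j ∧ j + 1 ≤ m ∧ x = d.s j)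
    ∨ (∃ j : ℕ, 1 ≤ j ∧ j + 1 ≤ m ∧ x = d.sb j)
    ∨ (1 ≤ m ∧ x = d.cn 1) ∨ (1 ≤ m ∧ x = d.cbn 1)}

end WBC

/-- `φ` intertwines two sets of walled Brauer–Clifford data. -/
structure WBCHom {R A B : Type} [CommRing R] [Ring A] [Algebra R A] [Ring B] [Algebra R B]
    {r t : ℕ} (d : WBC R A r t) (d' : WBC R B r t) (φ : A →ₐ[R] B) : Prop where
  map_σ : ∀ w, φ (d.σ w) = d'.σ w
  map_σb : ∀ w, φ (d.σb w) = d'.σb w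
  map_c : ∀ i, φ (d.c i) = d'.c i
  map_cb : ∀ j, φ (d.cb j) = d'.cb j
  map_e : φ d.e = d'.e

/-- `A` (with the data `d`) *is* the walled Brauer–Clifford superalgebra `BC_{r,t}`:
it is initial among all algebras with such data. -/
def WBC.IsUniversal {R A : Type} [CommRing R] [Ring A] [Algebra R A] {r t : ℕ}
    (d : WBC R A r t) : Prop :=
  ∀ (B : Type) [Ring B] [Algebra R B], ∀ d' : WBC R B r t, ∃! φ : A →ₐ[R] B, WBCHom d d' φ

/-- An element of `D^f_{r,t}`: data `1 ≤ i_1 < ⋯ < i_f ≤ r` and `k ≤ j_k ≤ t`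
(all 1-based) describing `s_{f,i_f} s̄_{f,j_f} ⋯ s_{1,i_1} s̄_{1,j_1}`. -/
structure DElt (r t f : ℕ) : Type where
  a : Fin f → ℕ
  b : Fin f → ℕ
  ha_mono : StrictMono a
  ha_lb : ∀ k, 1 ≤ a k
  ha_ub : ∀ k, a k ≤ r
  hb_lb : ∀ k : Fin f, (k : ℕ) + 1 ≤ b k
  hb_ub : ∀ k, b k ≤ t

/-- The `Σ_r`-component `s_{f,i_f} ⋯ s_{1,i_1}` of the element of `D^f_{r,t}`. -/
def DElt.pr {r t f : ℕ} (x : DElt r t f) : Equiv.Perm (Fin r) :=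
  ((List.finRange f).reverse.map (fun (k : Fin f) => sIJ r ((k : ℕ) + 1) (x.a k))).prod

/-- The `Σ_t`-component `s̄_{f,j_f} ⋯ s̄_{1,j_1}` of the element of `D^f_{r,t}`. -/
def DElt.pt {r t f : ℕ} (x : DElt r t f) : Equiv.Perm (Fin t) :=
  ((List.finRange f).reverse.map (fun (k : Fin f) => sIJ t ((k : ℕ) + 1) (x.b k))).prod

/-- Index for the basis `{c^α d_1⁻¹ e^f w d_2 c̄^β}` of `BC_{r,t}`; the component
`w ∈ Σ_{r-f} × Σ_{t-f}` is a pair of permutations fixing `1, …, f` pointwise. -/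
structure BCIndex (r t : ℕ) : Type where
  α : Fin r → Fin 2
  β : Fin t → Fin 2
  f : ℕ
  hf : f ≤ min r t
  d1 : DElt r t f
  d2 : DElt r t f
  w : Equiv.Perm (Fin r)
  wb : Equiv.Perm (Fin t)
  hw : ∀ i : Fin r, (i : ℕ) < f → w i = i
  hwb : ∀ j : Fin t, (j : ℕ) < f → wb j = j

/-- The basis element `c^α d_1⁻¹ e^f w d_2 c̄^β` of Theorem 2.4. -/
def WBC.basElt {R A : Type} [CommRing R] [Ring A] [Algebra R A] {r t : ℕ}
    (d : WBC R A r t) (x : BCIndex r t) : A :=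
  d.cpow x.α * d.σ (x.d1.pr⁻¹) * d.σb (x.d1.pt⁻¹) * d.epow x.f *
    d.σ x.w * d.σb x.wb * d.σ x.d2.pr * d.σb x.d2.pt * d.cbpow x.β

/-- Data for the presentation of the affine walled Brauer–Clifford superalgebra
`BC^aff_{r,t}` (Definition 3.1) with distinguished parameter `ω_1 ∈ R`.
`om k` is `ω_k` (with `ω_1` the scalar `ω1` and `ω_{2k} = 0`), `omb k` is `ω̄_k`. -/
structure AWBC (R A : Type) [CommRing R] [Ring A] [Algebra R A] (r t : ℕ) (ω1 : R)
    extends WBC R A r t : Type where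
  x1 : A
  xb1 : A
  om : ℕ → A
  omb : ℕ → A
  om_one : om 1 = algebraMap R A ω1
  om_even : ∀ k, om (2 * k) = 0
  omb_zero : omb 0 = 0
  om_comm : ∀ k, (∀ w, om k * σ w = σ w * om k) ∧ (∀ w, om k * σb w = σb w * om k) ∧
    (∀ i, om k * c i = c i * om k) ∧ (∀ j, om k * cb j = cb j * om k) ∧
    om k * e = e * om k ∧ om k * x1 = x1 * om k ∧ om k * xb1 = xb1 * om k ∧
    (∀ l, om k * om l = om l * om k) ∧ (∀ l, om k * omb l = omb l * om k)
  omb_comm : ∀ k, (∀ w, omb k * σ w = σ w * omb k) ∧ (∀ w, omb k * σb w = σb w * omb k) ∧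
    (∀ i, omb k * c i = c i * omb k) ∧ (∀ j, omb k * cb j = cb j * omb k) ∧
    omb k * e = e * omb k ∧ omb k * x1 = x1 * omb k ∧ omb k * xb1 = xb1 * omb k ∧
    (∀ l, omb k * omb l = omb l * omb k)
  x_comm : ∀ h : 1 < r, x1 * (σ (sw r 0 1) * x1 * σ (sw r 0 1)
      - (1 - c ⟨0, by omega⟩ * c ⟨1, h⟩) * σ (sw r 0 1))
    = (σ (sw r 0 1) * x1 * σ (sw r 0 1)
      - (1 - c ⟨0, by omega⟩ * c ⟨1, h⟩) * σ (sw r 0 1)) * x1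
  x1_c1 : ∀ h : 0 < r, x1 * c ⟨0, h⟩ = -(c ⟨0, h⟩ * x1)
  x1_c : ∀ i : Fin r, (i : ℕ) ≠ 0 → x1 * c i = c i * x1
  s_x1 : ∀ i : ℕ, 0 < i → i + 1 < r → σ (sw r i (i + 1)) * x1 = x1 * σ (sw r i (i + 1))
  xb_comm : ∀ h : 1 < t, xb1 * (σb (sw t 0 1) * xb1 * σb (sw t 0 1)
      - (1 + cb ⟨0, by omega⟩ * cb ⟨1, h⟩) * σb (sw t 0 1))
    = (σb (sw t 0 1) * xb1 * σb (sw t 0 1)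
      - (1 + cb ⟨0, by omega⟩ * cb ⟨1, h⟩) * σb (sw t 0 1)) * xb1
  xb1_cb1 : ∀ h : 0 < t, xb1 * cb ⟨0, h⟩ = -(cb ⟨0, h⟩ * xb1)
  xb1_cb : ∀ j : Fin t, (j : ℕ) ≠ 0 → xb1 * cb j = cb j * xb1
  sb_xb1 : ∀ j : ℕ, 0 < j → j + 1 < t → σb (sw t j (j + 1)) * xb1 = xb1 * σb (sw t j (j + 1))
  e_xsum : e * (x1 + xb1) = 0
  xsum_e : (x1 + xb1) * e = 0
  e_sxs : 1 < r → e * (σ (sw r 0 1) * x1 * σ (sw r 0 1)) = (σ (sw r 0 1) * x1 * σ (sw r 0 1)) * e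
  x_mixed : ∀ h : 0 < r, x1 * (e + xb1 - c ⟨0, h⟩ * e * c ⟨0, h⟩)
      = (e - c ⟨0, h⟩ * e * c ⟨0, h⟩ + xb1) * x1
  e_sbxbsb : 1 < t →
    e * (σb (sw t 0 1) * xb1 * σb (sw t 0 1)) = (σb (sw t 0 1) * xb1 * σb (sw t 0 1)) * e
  e_xodd : ∀ k : ℕ, e * x1 ^ (2 * k + 1) * e = om (2 * k + 1) * e
  e_xeven : ∀ k : ℕ, 1 ≤ k → e * x1 ^ (2 * k) * e = 0
  e_xb : ∀ k : ℕ, 1 ≤ k → e * xb1 ^ k * e = omb k * e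
  x1_cb_comm : ∀ j, x1 * cb j = cb j * x1
  xb1_c_comm : ∀ i, xb1 * c i = c i * xb1
  x1_σb : ∀ w, σb w * x1 = x1 * σb w
  xb1_σ : ∀ w, σ w * xb1 = xb1 * σ w

namespace AWBC

variable {R A : Type} [CommRing R] [Ring A] [Algebra R A] {r t : ℕ} {ω1 : R}

/-- `x'_i = s_{i-1} ⋯ s_1 x_1 s_1 ⋯ s_{i-1}` (1-based). -/
def xp (d : AWBC R A r t ω1) (i : ℕ) : A :=
  ((List.range (i - 1)).reverse.map (fun k => d.toWBC.s (k + 1))).prod * d.x1 *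
    ((List.range (i - 1)).map (fun k => d.toWBC.s (k + 1))).prod

/-- `x̄'_j = s̄_{j-1} ⋯ s̄_1 x̄_1 s̄_1 ⋯ s̄_{j-1}` (1-based). -/
def xbp (d : AWBC R A r t ω1) (j : ℕ) : A :=
  ((List.range (j - 1)).reverse.map (fun k => d.toWBC.sb (k + 1))).prod * d.xb1 *
    ((List.range (j - 1)).map (fun k => d.toWBC.sb (k + 1))).prod

/-- `x_i = x'_i - L_i`. -/
def xv (d : AWBC R A r t ω1) (i : ℕ) : A := d.xp i - d.toWBC.L i

/-- `x̄_j = x̄'_j - L̄_j`. -/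
def xbv (d : AWBC R A r t ω1) (j : ℕ) : A := d.xbp j - d.toWBC.Lb j

/-- `x^α = x_1^{α_1} ⋯ x_r^{α_r}`. -/
def xpow (d : AWBC R A r t ω1) (α : Fin r → ℕ) : A :=
  ((List.finRange r).map (fun (i : Fin r) => d.xv ((i : ℕ) + 1) ^ α i)).prod

/-- `x̄^β = x̄_1^{β_1} ⋯ x̄_t^{β_t}`. -/
def xbpow (d : AWBC R A r t ω1) (β : Fin t → ℕ) : A :=
  ((List.finRange t).map (fun (j : Fin t) => d.xbv ((j : ℕ) + 1) ^ β j)).prod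

/-- `∏_{n ∈ ℤ^{>0}} ω_{2n+1}^{a_{2n+1}}`, where `g i` is the exponent of `ω_{2(i+1)+1}`. -/
def ompow (d : AWBC R A r t ω1) (g : ℕ →₀ ℕ) : A :=
  ((g.support.sort (· ≤ ·)).map (fun n => d.om (2 * n + 3) ^ g n)).prod

/-- `z_i = x'_i + y_i`. -/
def z (d : AWBC R A r t ω1) (i : ℕ) : A := d.xp i + d.toWBC.y i

/-- `z̄_j = x̄'_j + ȳ_j`. -/
def zb (d : AWBC R A r t ω1) (j : ℕ) : A := d.xbp j + d.toWBC.yb j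

/-- Generators of the subalgebra `BC_{2,m,m}`-type subalgebra:
`e_1, s_1, …, s_{m-1}, s̄_1, …, s̄_{m-1}, c_1, c̄_1, x_1, x̄_1`. -/
def lowerGensA (d : AWBC R A r t ω1) (m : ℕ) : Set A :=
  d.toWBC.lowerGens m ∪ {x | 1 ≤ m ∧ (x = d.x1 ∨ x = d.xb1)}

end AWBC

/-- `φ` intertwines two sets of affine walled Brauer–Clifford data. -/
structure AWBCHom {R A B : Type} [CommRing R] [Ring A] [Algebra R A] [Ring B] [Algebra R B]
    {r t : ℕ} {ω1 : R} (d : AWBC R A r t ω1) (d' : AWBC R B r t ω1) (φ : A →ₐ[R] B) : Prop where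
  map_σ : ∀ w, φ (d.σ w) = d'.σ w
  map_σb : ∀ w, φ (d.σb w) = d'.σb w
  map_c : ∀ i, φ (d.c i) = d'.c i
  map_cb : ∀ j, φ (d.cb j) = d'.cb j
  map_e : φ d.e = d'.e
  map_x1 : φ d.x1 = d'.x1
  map_xb1 : φ d.xb1 = d'.xb1
  map_om : ∀ k, φ (d.om k) = d'.om k
  map_omb : ∀ k, φ (d.omb k) = d'.omb k

/-- `A` (with the data `d`) is the affine walled Brauer–Clifford superalgebra
`BC^aff_{r,t}` of Definition 3.1. -/
def AWBC.IsUniversal {R A : Type} [CommRing R] [Ring A] [Algebra R A] {r t : ℕ} {ω1 : R}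
    (d : AWBC R A r t ω1) : Prop :=
  ∀ (B : Type) [Ring B] [Algebra R B], ∀ d' : AWBC R B r t ω1,
    ∃! φ : A →ₐ[R] B, AWBCHom d d' φ

/-- Assumption 3.6: the parameters `ω̄` are determined by the `ω`'s as in Corollary 3.5. -/
def AWBC.Ass36 {R A : Type} [CommRing R] [Ring A] [Algebra R A] {r t : ℕ} {ω1 : R}
    (d : AWBC R A r t ω1) : Prop :=
  (∀ n, d.omb (2 * n) = 0) ∧
  (∀ n, d.omb (2 * n + 1) = ∑ j ∈ Finset.range (n + 1), acoef d.om n j * d.om (2 * j + 1))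

/-- `A` (with the data `d`) is the affine walled Brauer–Clifford superalgebra
`BC^aff_{r,t}` subject to Assumption 3.6. -/
def AWBC.IsUniversal36 {R A : Type} [CommRing R] [Ring A] [Algebra R A] {r t : ℕ} {ω1 : R}
    (d : AWBC R A r t ω1) : Prop :=
  d.Ass36 ∧ ∀ (B : Type) [Ring B] [Algebra R B], ∀ d' : AWBC R B r t ω1,
    d'.Ass36 → ∃! φ : A →ₐ[R] B, AWBCHom d d' φ

/-- The parameters `ω_k`, `ω̄_k` are the scalars `ω k`, `obar ω k` (specialization defining
the algebra `B̃C_{r,t}` of Definition 3.13). -/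
def AWBC.IsSpec {R A : Type} [CommRing R] [Ring A] [Algebra R A] {r t : ℕ} {ω1 : R}
    (d : AWBC R A r t ω1) (ω : ℕ → R) : Prop :=
  (∀ k, d.om k = algebraMap R A (ω k)) ∧ (∀ k, 1 ≤ k → d.omb k = algebraMap R A (obar ω k))

/-- `A` (with the data `d`) is the algebra `B̃C_{r,t}` of Definition 3.13 with parameters
`ω_{2n+1} ∈ R`. -/
def AWBC.IsSpecUniversal {R A : Type} [CommRing R] [Ring A] [Algebra R A] {r t : ℕ} {ω1 : R}
    (d : AWBC R A r t ω1) (ω : ℕ → R) : Prop :=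
  d.IsSpec ω ∧ ∀ (B : Type) [Ring B] [Algebra R B], ∀ d' : AWBC R B r t ω1,
    d'.IsSpec ω → ∃! φ : A →ₐ[R] B, AWBCHom d d' φ

/-- The cyclotomic relations `f(x_1) = 0` and `g(x̄_1) = 0`. -/
def AWBC.IsCyc {R A : Type} [CommRing R] [Ring A] [Algebra R A] {r t : ℕ} {ω1 : R}
    (d : AWBC R A r t ω1) (f g : Polynomial R) : Prop :=
  Polynomial.aeval d.x1 f = 0 ∧ Polynomial.aeval d.xb1 g = 0

/-- `A` (with the data `d`) is the cyclotomic walled Brauer–Clifford superalgebra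
`BC_{ℓ,r,t}` of Definition 3.14 attached to `f`, `g` and the scalar parameters `ω`. -/
def AWBC.IsCycUniversal {R A : Type} [CommRing R] [Ring A] [Algebra R A] {r t : ℕ} {ω1 : R}
    (d : AWBC R A r t ω1) (ω : ℕ → R) (f g : Polynomial R) : Prop :=
  d.IsSpec ω ∧ d.IsCyc f g ∧ ∀ (B : Type) [Ring B] [Algebra R B], ∀ d' : AWBC R B r t ω1,
    d'.IsSpec ω → d'.IsCyc f g → ∃! φ : A →ₐ[R] B, AWBCHom d d' φ

/-- Index of a regular monomial `x^α d x̄^β ∏_{n≥1} ω_{2n+1}^{a_{2n+1}}` of `BC^aff_{r,t}`. -/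
structure ARIndex (r t : ℕ) : Type where
  α : Fin r → ℕ
  β : Fin t → ℕ
  dIdx : BCIndex r t
  g : ℕ →₀ ℕ

/-- The regular monomial `x^α d x̄^β ∏_{n≥1} ω_{2n+1}^{a_{2n+1}}` of Definition 3.11. -/
def AWBC.regElt {R A : Type} [CommRing R] [Ring A] [Algebra R A] {r t : ℕ} {ω1 : R}
    (d : AWBC R A r t ω1) (x : ARIndex r t) : A :=
  d.xpow x.α * d.toWBC.basElt x.dIdx * d.xbpow x.β * d.ompow x.g

/-- Index of a regular monomial `x^α d x̄^β` of `B̃C_{r,t}`. -/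
structure SIndex (r t : ℕ) : Type where
  α : Fin r → ℕ
  β : Fin t → ℕ
  dIdx : BCIndex r t

/-- The regular monomial `x^α d x̄^β` of `B̃C_{r,t}`. -/
def AWBC.sregElt {R A : Type} [CommRing R] [Ring A] [Algebra R A] {r t : ℕ} {ω1 : R}
    (d : AWBC R A r t ω1) (x : SIndex r t) : A :=
  d.xpow x.α * d.toWBC.basElt x.dIdx * d.xbpow x.β

/-- Index of a regular monomial `x^α d x̄^β` of the level `ℓ` algebra `BC_{ℓ,r,t}`,
with exponents in `{0, 1, …, ℓ-1}`. -/
structure CIndex (r t ℓ : ℕ) : Type where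
  α : Fin r → Fin ℓ
  β : Fin t → Fin ℓ
  dIdx : BCIndex r t

/-- The regular monomial `x^α d x̄^β` of `BC_{ℓ,r,t}`. -/
def AWBC.cregElt {R A : Type} [CommRing R] [Ring A] [Algebra R A] {r t ℓ : ℕ} {ω1 : R}
    (d : AWBC R A r t ω1) (x : CIndex r t ℓ) : A :=
  d.xpow (fun i => (x.α i : ℕ)) * d.toWBC.basElt x.dIdx * d.xbpow (fun j => (x.β j : ℕ))

/-- Admissibility (Definition 6.4): writing `f(x) = x^{k+2m} + ∑_{i=1}^{2m} a_i x^{k+2m-i}`,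
one has `ω_L = -(a_1 ω_{L-1} + ⋯ + a_{2m} ω_{L-2m})` for all `L ≥ k + 2m`. -/
def AdmissibleParam {R : Type} [CommRing R] (ω : ℕ → R) (f : Polynomial R) (k m : ℕ) : Prop :=
  ∀ L, k + 2 * m ≤ L →
    ω L = -∑ i ∈ Finset.Icc 1 (2 * m), f.coeff (k + 2 * m - i) * ω (L - i)

/-- The parameters `ω_0 = 0`, `ω_1 = -2m(2p-2m+1)`, `ω_i = p(p+1) ω_{i-2}` of (4.16). -/
def omSeq (m : ℕ) (p : ℂ) : ℕ → ℂ
  | 0 => 0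
  | 1 => -2 * (m : ℂ) * (2 * p - 2 * (m : ℂ) + 1)
  | n + 2 => p * (p + 1) * omSeq m p n

/-- Index of a monomial `d_1^{-1} c^α x'^β e^f x̄'^{β̄} c̄^{ᾱ} w d_2` of (4.20). -/
structure L2Index (r t : ℕ) : Type where
  α : Fin r → Fin 2
  βx : Fin r → Fin 2
  αb : Fin t → Fin 2
  βxb : Fin t → Fin 2
  f : ℕ
  hf : f ≤ min r t
  d1 : DElt r t f
  d2 : DElt r t f
  w : Equiv.Perm (Fin r)
  wb : Equiv.Perm (Fin t)
  hw : ∀ i : Fin r, (i : ℕ) < f → w i = i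
  hwb : ∀ j : Fin t, (j : ℕ) < f → wb j = j

/-- The monomial `d_1^{-1} c^α x'^β e^f x̄'^{β̄} c̄^{ᾱ} w d_2` of (4.20), where
`x'^β = x'_r{}^{β_r} ⋯ x'_1{}^{β_1}` and `x̄'^{β̄} = x̄'_t{}^{β̄_t} ⋯ x̄'_1{}^{β̄_1}`. -/
def AWBC.l2Elt {R A : Type} [CommRing R] [Ring A] [Algebra R A] {r t : ℕ} {ω1 : R}
    (d : AWBC R A r t ω1) (x : L2Index r t) : A :=
  d.toWBC.σ (x.d1.pr⁻¹) * d.toWBC.σb (x.d1.pt⁻¹) * d.toWBC.cpow x.α *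
    ((List.finRange r).reverse.map (fun (i : Fin r) => d.xp ((i : ℕ) + 1) ^ (x.βx i : ℕ))).prod *
    d.toWBC.epow x.f *
    ((List.finRange t).reverse.map (fun (j : Fin t) => d.xbp ((j : ℕ) + 1) ^ (x.βxb j : ℕ))).prod *
    d.toWBC.cbpow x.αb *
    d.toWBC.σ x.w * d.toWBC.σb x.wb * d.toWBC.σ x.d2.pr * d.toWBC.σb x.d2.pt

/-! ### Permutations -/

lemma sw_eq {n a b : ℕ} (ha : a < n) (hb : b < n) :
    sw n a b = Equiv.swap ⟨a, ha⟩ ⟨b, hb⟩ := by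
  simp [sw, ha, hb]

lemma swap_adj_induction {n f : ℕ} (p : Equiv.Perm (Fin n) → Prop)
    (h1 : p 1) (hmul : ∀ a b, p a → p b → p (a * b))
    (hs : ∀ i, f ≤ i → i + 1 < n → p (sw n i (i + 1))) :
    ∀ (m a : ℕ) (_ : f ≤ a) (h : a + m < n), p (Equiv.swap ⟨a, by omega⟩ ⟨a + m, h⟩) := by
  intro m
  induction m with
  | zero => intro a ha h; simpa [← Equiv.Perm.one_def] using h1
  | succ m ih =>
    intro a ha h
    rcases Nat.eq_zero_or_pos m with rfl | hm
    · have := hs a ha (by omega)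
      rwa [sw_eq (by omega) (by omega)] at this
    · have h2 := hs (a + m) (by omega) (by omega)
      have h3 := ih a ha (by omega)
      have := hmul _ _ (hmul _ _ h2 h3) h2
      rw [sw_eq (by omega) (by omega)] at this
      have key : Equiv.swap (⟨a, by omega⟩ : Fin n) ⟨a + (m + 1), h⟩
        = Equiv.swap ⟨a + m, by omega⟩ ⟨a + m + 1, by omega⟩ *
          Equiv.swap ⟨a, by omega⟩ ⟨a + m, by omega⟩ *
          Equiv.swap ⟨a + m, by omega⟩ ⟨a + m + 1, by omega⟩ := by
        have := Equiv.swap_apply_apply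
          (Equiv.swap (⟨a + m, by omega⟩ : Fin n) ⟨a + m + 1, by omega⟩)
          (⟨a, by omega⟩ : Fin n) ⟨a + m, by omega⟩
        rw [Equiv.swap_apply_left, Equiv.swap_apply_of_ne_of_ne, Equiv.swap_inv] at this
        · exact this
        · simp [Fin.ext_iff]; omega
        · simp [Fin.ext_iff]; omega
      rw [key]; exact this

lemma perm_fix_induction {n f : ℕ} (p : Equiv.Perm (Fin n) → Prop)
    (h1 : p 1) (hmul : ∀ a b, p a → p b → p (a * b))
    (hs : ∀ i, f ≤ i → i + 1 < n → p (sw n i (i + 1)))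
    (w : Equiv.Perm (Fin n)) (hw : ∀ i : Fin n, (i : ℕ) < f → w i = i) : p w := by
  classical
  have hsw : ∀ a b : Fin n, f ≤ (a : ℕ) → f ≤ (b : ℕ) → p (Equiv.swap a b) := by
    intro a b ha hb
    rcases le_total (a : ℕ) b with h | h
    · obtain ⟨m, hm⟩ := Nat.exists_eq_add_of_le h
      have := swap_adj_induction p h1 hmul hs m a ha (by omega)
      convert this using 2
      exact Fin.ext hm
    · obtain ⟨m, hm⟩ := Nat.exists_eq_add_of_le h
      have := swap_adj_induction p h1 hmul hs m b hb (by omega)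
      rw [Equiv.swap_comm]
      convert this using 2
      exact Fin.ext hm
  have hP : ∀ x : Fin n, f ≤ ((w x : Fin n) : ℕ) ↔ f ≤ (x : ℕ) := by
    intro x
    constructor
    · intro h; by_contra h'; rw [hw x (by omega)] at h; omega
    · intro h; by_contra h'
      have := hw (w x) (by omega)
      have := w.injective this
      rw [this] at h'; omega
  have key : ∀ q : Equiv.Perm {x : Fin n // f ≤ (x : ℕ)}, p (Equiv.Perm.ofSubtype q) := by
    intro q
    induction q using Equiv.Perm.swap_induction_on with
    | one => simpa using h1
    | swap_mul q x y hxy ih =>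
      rw [map_mul, Equiv.Perm.ofSubtype_swap_eq]
      exact hmul _ _ (hsw _ _ x.2 y.2) ih
  have := key (w.subtypePerm hP)
  rwa [Equiv.Perm.ofSubtype_subtypePerm] at this
  intro x hx
  by_contra h'
  exact hx (hw x (by omega))

/-- the cycle `s_{i+1} ⋯ s_{i+m}` -/
def cyc (n i m : ℕ) : Equiv.Perm (Fin n) :=
  ((List.range' (i + 1) m).map (fun k => sw n (k - 1) k)).prod

lemma cyc_succ (n i m : ℕ) : cyc n i (m + 1) = sw n i (i + 1) * cyc n (i + 1) m := by
  simp [cyc, List.range'_succ]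

lemma cyc_spec (n : ℕ) : ∀ (m i : ℕ) (h : i + m < n),
    cyc n i m ⟨i + m, h⟩ = ⟨i, by omega⟩ ∧
    (∀ y : Fin n, (y : ℕ) < i → cyc n i m y = y) ∧
    (∀ y : Fin n, i + m < (y : ℕ) → cyc n i m y = y) := by
  intro m
  induction m with
  | zero => intro i h; simp [cyc]
  | succ m ih =>
    intro i h
    obtain ⟨h1, h2, h3⟩ := ih (i + 1) (by omega)
    rw [cyc_succ, sw_eq (by omega) (by omega)]
    refine ⟨?_, ?_, ?_⟩
    · have e : (⟨i + (m + 1), h⟩ : Fin n) = ⟨i + 1 + m, by omega⟩ := Fin.ext (by simp; omega)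
      rw [Equiv.Perm.mul_apply, e, h1, Equiv.swap_apply_right]
    · intro y hy
      rw [Equiv.Perm.mul_apply, h2 y (by omega), Equiv.swap_apply_of_ne_of_ne] <;>
        (simp [Fin.ext_iff]; omega)
    · intro y hy
      rw [Equiv.Perm.mul_apply, h3 y (by omega), Equiv.swap_apply_of_ne_of_ne] <;>
        (simp [Fin.ext_iff]; omega)

lemma sIJ_eq_cyc (n i m : ℕ) : sIJ n (i + 1) (i + m + 1) = cyc n i m := by
  rcases Nat.eq_zero_or_pos m with rfl | hm
  · simp [sIJ, cyc]
  · have : i + 1 < i + m + 1 := by omega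
    have e : i + m + 1 - (i + 1) = m := by omega
    rw [sIJ, if_pos this, e, cyc]

/-- products of cycles -/
def PP (n : ℕ) (b : ℕ → ℕ) (f : ℕ) : Equiv.Perm (Fin n) :=
  ((List.range f).reverse.map (fun k => sIJ n (k + 1) (b k))).prod

lemma PP_succ (n : ℕ) (b : ℕ → ℕ) (f : ℕ) :
    PP n b (f + 1) = sIJ n (f + 1) (b f) * PP n b f := by
  simp [PP, List.range_succ]

lemma PP_congr (n : ℕ) (b b' : ℕ → ℕ) (f : ℕ) (h : ∀ k < f, b k = b' k) :
    PP n b f = PP n b' f := by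
  unfold PP
  congr 1
  apply List.map_congr_left
  intro k hk
  rw [h k (by simpa using hk)]

lemma PP_exists (n : ℕ) (v : Equiv.Perm (Fin n)) : ∀ (f : ℕ) (hf : f ≤ n), ∃ b : ℕ → ℕ,
    (∀ k < f, k + 1 ≤ b k ∧ b k ≤ n) ∧
    (∀ (k : ℕ) (hk : k < f), PP n b f (v⁻¹ ⟨k, by omega⟩) = ⟨k, by omega⟩) ∧
    ((∀ (k l : ℕ) (hkl : k < l) (hl : l < f), v⁻¹ ⟨k, by omega⟩ < v⁻¹ ⟨l, by omega⟩) →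
      (∀ (k : ℕ) (hk : k < f), b k = (v⁻¹ ⟨k, by omega⟩ : Fin n) + 1) ∧
      ∀ y : Fin n, (∀ (k : ℕ) (hk : k < f), v⁻¹ ⟨k, by omega⟩ < y) → PP n b f y = y) := by
  intro f
  induction f with
  | zero => intro hf; exact ⟨fun _ => 0, by simp, by simp, by simp [PP]⟩
  | succ f ih =>
    intro hf
    obtain ⟨b, hb1, hb2, hb3⟩ := ih (by omega)
    set m : Fin n := PP n b f (v⁻¹ ⟨f, by omega⟩) with hm
    have hfm : f ≤ (m : ℕ) := by
      by_contra h'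
      have h1 := hb2 m (by omega)
      have h2 : PP n b f (v⁻¹ m) = PP n b f (v⁻¹ ⟨f, by omega⟩) := by rw [← hm]; exact h1
      have h3 := v⁻¹.injective ((PP n b f).injective h2)
      rw [h3] at h'
      exact h' le_rfl
    obtain ⟨l, hl⟩ := Nat.exists_eq_add_of_le hfm
    have hln : f + l < n := by omega
    obtain ⟨c1, c2, c3⟩ := cyc_spec n l f hln
    have hmm : m = ⟨f + l, hln⟩ := Fin.ext hl
    refine ⟨fun k => if k = f then m + 1 else b k, ?_, ?_, ?_⟩
    · intro k hk
      by_cases h : k = f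
      · subst h; simp; omega
      · simp [h]; exact hb1 k (by omega)
    all_goals
      have hP : PP n (fun k => if k = f then (m : ℕ) + 1 else b k) (f + 1) =
          cyc n f l * PP n b f := by
        rw [PP_succ, PP_congr n _ b f (by intro k hk; simp; omega)]
        simp only [if_true]
        rw [hl, sIJ_eq_cyc]
      rw [hP]
    · intro k hk
      by_cases h : k = f
      · subst h; rw [Equiv.Perm.mul_apply, ← hm, hmm, c1]
      · rw [Equiv.Perm.mul_apply, hb2 k (by omega), c2]; simp; omega
    · intro hmono
      obtain ⟨d1, d2⟩ := hb3 (fun k l hkl hl => hmono k l hkl (by omega))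
      have hmv : m = v⁻¹ ⟨f, by omega⟩ := by
        rw [hm]; exact d2 _ (fun k hk => hmono k f hk (by omega))
      constructor
      · intro k hk
        by_cases h : k = f
        · subst h; simp [hmv]
        · simp [h]; exact d1 k (by omega)
      · intro y hy
        rw [Equiv.Perm.mul_apply, d2 y (fun k hk => hy k (by omega)), c3]
        have := hy f (by omega)
        rw [← hmv, Fin.lt_def] at this
        omega

lemma PP_finRange (n f : ℕ) (b : ℕ → ℕ) :
    ((List.finRange f).reverse.map (fun (k : Fin f) => sIJ n ((k : ℕ) + 1) (b k))).prod
      = PP n b f := by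
  unfold PP
  rw [← List.map_coe_finRange_eq_range, ← List.map_reverse, List.map_map]
  rfl

/-- extension of a permutation of `Fin f` to `Fin n` -/
def extP (f n : ℕ) (hf : f ≤ n) : Equiv.Perm (Fin f) →* Equiv.Perm (Fin n) :=
  Equiv.Perm.viaEmbeddingHom (Fin.castLEEmb hf)

lemma extP_apply {f n : ℕ} (hf : f ≤ n) (π : Equiv.Perm (Fin f)) (k : Fin f) :
    extP f n hf π (Fin.castLE hf k) = Fin.castLE hf (π k) :=
  Equiv.Perm.viaEmbedding_apply π (Fin.castLEEmb hf) k

lemma extP_swap {f n : ℕ} (hf : f ≤ n) (k l : Fin f) :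
    extP f n hf (Equiv.swap k l) = Equiv.swap (Fin.castLE hf k) (Fin.castLE hf l) := by
  ext y
  by_cases hy : (y : ℕ) < f
  · have : y = Fin.castLE hf ⟨y, hy⟩ := rfl
    rw [this, extP_apply]
    rw [← Fin.castLEEmb_apply, ← Fin.castLEEmb_apply, ← Fin.castLEEmb_apply,
      ← Fin.castLEEmb_apply, Function.Embedding.swap_apply]
  · have h1 : extP f n hf (Equiv.swap k l) y = y := by
      apply Equiv.Perm.viaEmbedding_apply_of_notMem
      rintro ⟨z, rfl⟩
      exact hy z.2
    rw [h1, Equiv.swap_apply_of_ne_of_ne] <;>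
    · intro h; apply hy; rw [h]; simp

lemma decomp (r t f : ℕ) (hfr : f ≤ r) (hft : f ≤ t) (u : Equiv.Perm (Fin r))
    (v : Equiv.Perm (Fin t)) : ∃ (D : DElt r t f) (π : Equiv.Perm (Fin f))
      (w : Equiv.Perm (Fin r)) (wb : Equiv.Perm (Fin t)),
      (∀ i : Fin r, (i : ℕ) < f → w i = i) ∧ (∀ i : Fin t, (i : ℕ) < f → wb i = i) ∧
      u = extP f r hfr π * w * D.pr ∧ v = extP f t hft π * wb * D.pt := by
  let g : Fin f → Fin r := fun k => u⁻¹ (Fin.castLE hfr k)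
  let π := Tuple.sort g
  have hmono : Monotone (g ∘ π) := Tuple.monotone_sort g
  have hinj : Function.Injective (g ∘ π) :=
    (u⁻¹.injective.comp (Fin.castLE_injective hfr)).comp π.injective
  have hsm : StrictMono (g ∘ π) := hmono.strictMono_of_injective hinj
  let u' := (extP f r hfr π)⁻¹ * u
  let v' := (extP f t hft π)⁻¹ * v
  have hu' : ∀ k (hk : k < f), u'⁻¹ ⟨k, by omega⟩ = g (π ⟨k, hk⟩) := by
    intro k hk
    have : (⟨k, by omega⟩ : Fin r) = Fin.castLE hfr ⟨k, hk⟩ := rfl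
    simp only [u', mul_inv_rev, inv_inv, Equiv.Perm.mul_apply, this, extP_apply]
    rfl
  obtain ⟨a, ha1, ha2, ha3⟩ := PP_exists r u' f hfr
  obtain ⟨b, hb1, hb2, -⟩ := PP_exists t v' f hft
  obtain ⟨ha4, -⟩ := ha3 (by
    intro k l hkl hl
    rw [hu' k (by omega), hu' l hl]
    exact hsm (by simpa using hkl))
  let D : DElt r t f :=
    { a := fun k => a k
      b := fun k => b k
      ha_mono := by
        intro k l hkl
        show a k < a l
        rw [ha4 k k.2, ha4 l l.2, hu' k k.2, hu' l l.2]
        have := hsm hkl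
        rw [Fin.lt_def] at this
        exact Nat.succ_lt_succ this
      ha_lb := fun k => by have := ha1 k k.2; show 1 ≤ a k; omega
      ha_ub := fun k => (ha1 k k.2).2
      hb_lb := fun k => (hb1 k k.2).1
      hb_ub := fun k => (hb1 k k.2).2 }
  have hpr : D.pr = PP r a f := PP_finRange r f a
  have hpt : D.pt = PP t b f := PP_finRange t f b
  refine ⟨D, π, u' * (PP r a f)⁻¹, v' * (PP t b f)⁻¹, ?_, ?_, ?_, ?_⟩
  · intro i hi
    have h' := ha2 i hi
    rw [Equiv.Perm.mul_apply, ← Equiv.Perm.eq_inv_iff_eq, Equiv.Perm.inv_eq_iff_eq]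
    exact h'.symm
  · intro i hi
    have h' := hb2 i hi
    rw [Equiv.Perm.mul_apply, ← Equiv.Perm.eq_inv_iff_eq, Equiv.Perm.inv_eq_iff_eq]
    exact h'.symm
  · rw [hpr]; simp only [u']; group
  · rw [hpt]; simp only [v']; group

/-! ### Facts about walled Brauer–Clifford data -/

lemma exists_perm_two {n : ℕ} (h : 1 < n) {p p' : Fin n} (hp : p ≠ p') :
    ∃ u : Equiv.Perm (Fin n), u ⟨0, by omega⟩ = p ∧ u ⟨1, h⟩ = p' := by
  refine ⟨Equiv.swap (Equiv.swap ⟨0, by omega⟩ p ⟨1, h⟩) p' * Equiv.swap ⟨0, by omega⟩ p, ?_, ?_⟩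
  · rw [Equiv.Perm.mul_apply, Equiv.swap_apply_left, Equiv.swap_apply_of_ne_of_ne _ hp]
    intro h'
    have h2 := congrArg (Equiv.swap (⟨0, by omega⟩ : Fin n) p) h'
    rw [Equiv.swap_apply_right, Equiv.swap_apply_self] at h2
    simp [Fin.ext_iff] at h2
  · rw [Equiv.Perm.mul_apply, Equiv.swap_apply_left]

lemma one_lt_of_ne {n : ℕ} {p p' : Fin n} (hp : p ≠ p') : 1 < n := by
  have : (p : ℕ) ≠ p' := fun h => hp (Fin.ext h)
  omega

lemma exists_perm_one {n : ℕ} (h : 0 < n) (p : Fin n) :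
    ∃ u : Equiv.Perm (Fin n), u ⟨0, h⟩ = p := ⟨Equiv.swap ⟨0, h⟩ p, by simp⟩

namespace WBC

variable {R A : Type} [CommRing R] [Ring A] [Algebra R A] {r t : ℕ}

/-- the product of the two symmetric groups -/
def tau (d : WBC R A r t) : Equiv.Perm (Fin r) × Equiv.Perm (Fin t) →* A where
  toFun g := d.σ g.1 * d.σb g.2
  map_one' := by simp
  map_mul' g h := by
    simp only [Prod.fst_mul, Prod.snd_mul, map_mul]
    rw [mul_assoc, mul_assoc, ← mul_assoc (d.σb g.2), ← d.comm_σσb]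
    simp only [mul_assoc]

lemma tau_mk (d : WBC R A r t) (u v) : d.tau (u, v) = d.σ u * d.σb v := rfl
lemma tau_left (d : WBC R A r t) (u) : d.tau (u, 1) = d.σ u := by simp [tau_mk]
lemma tau_right (d : WBC R A r t) (v) : d.tau (1, v) = d.σb v := by simp [tau_mk]

lemma tau_inv_mul (d : WBC R A r t) (g) : d.tau g⁻¹ * d.tau g = 1 := by
  rw [← map_mul]; simp
lemma tau_mul_inv (d : WBC R A r t) (g) : d.tau g * d.tau g⁻¹ = 1 := by
  rw [← map_mul]; simp

lemma tau_cancel (d : WBC R A r t) (g) {a b : A} (h : a * d.tau g = b * d.tau g) : a = b := by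
  have := congrArg (· * d.tau g⁻¹) h
  simpa only [mul_assoc, tau_mul_inv, mul_one] using this

lemma tau_c (d : WBC R A r t) (g) (i : Fin r) : d.tau g * d.c i = d.c (g.1 i) * d.tau g := by
  obtain ⟨u, v⟩ := g
  have h := d.c_conj u i
  have h' : d.σ u * d.c i = d.c (u i) * d.σ u := by
    rw [← h, mul_assoc _ (d.σ u⁻¹), ← map_mul]; simp
  rw [tau_mk, mul_assoc, d.comm_σbc, ← mul_assoc, h', mul_assoc]

lemma tau_cb (d : WBC R A r t) (g) (j : Fin t) : d.tau g * d.cb j = d.cb (g.2 j) * d.tau g := by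
  obtain ⟨u, v⟩ := g
  have h := d.cb_conj v j
  have h' : d.σb v * d.cb j = d.cb (v j) * d.σb v := by
    rw [← h, mul_assoc _ (d.σb v⁻¹), ← map_mul]; simp
  rw [tau_mk, mul_assoc, h', ← mul_assoc, d.comm_σcb, mul_assoc]

lemma tau_fix_e (d : WBC R A r t) (g : Equiv.Perm (Fin r) × Equiv.Perm (Fin t))
    (hr : 0 < r) (ht : 0 < t)
    (h1 : g.1 ⟨0, hr⟩ = ⟨0, hr⟩) (h2 : g.2 ⟨0, ht⟩ = ⟨0, ht⟩) :
    d.tau g * d.e = d.e * d.tau g := by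
  obtain ⟨u, v⟩ := g
  have hu : d.σ u * d.e = d.e * d.σ u := by
    refine perm_fix_induction (f := 1) (fun w => d.σ w * d.e = d.e * d.σ w) (by simp) ?_ ?_ u ?_
    · intro a b ha hb
      rw [map_mul, mul_assoc, hb, ← mul_assoc, ha, mul_assoc]
    · intro i hi hi2
      exact d.s_e_comm i hi hi2
    · intro i hi
      have : i = ⟨0, hr⟩ := Fin.ext (by simpa using hi)
      rw [this]; exact h1
  have hv : d.σb v * d.e = d.e * d.σb v := by
    refine perm_fix_induction (f := 1) (fun w => d.σb w * d.e = d.e * d.σb w) (by simp) ?_ ?_ v ?_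
    · intro a b ha hb
      rw [map_mul, mul_assoc, hb, ← mul_assoc, ha, mul_assoc]
    · intro i hi hi2
      exact d.sb_e_comm i hi hi2
    · intro i hi
      have : i = ⟨0, ht⟩ := Fin.ext (by simpa using hi)
      rw [this]; exact h2
  rw [tau_mk, mul_assoc, hv, ← mul_assoc, hu, mul_assoc]

/-- `e_{p,q}` -/
def ee (d : WBC R A r t) (hr : 0 < r) (ht : 0 < t) (p : Fin r) (q : Fin t) : A :=
  d.tau (Equiv.swap ⟨0, hr⟩ p, Equiv.swap ⟨0, ht⟩ q) * d.e *
    d.tau (Equiv.swap ⟨0, hr⟩ p, Equiv.swap ⟨0, ht⟩ q)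

variable (d : WBC R A r t) (hr : 0 < r) (ht : 0 < t)

lemma ee_zero : d.ee hr ht ⟨0, hr⟩ ⟨0, ht⟩ = d.e := by
  have h : (Equiv.swap (⟨0, hr⟩ : Fin r) ⟨0, hr⟩, Equiv.swap (⟨0, ht⟩ : Fin t) ⟨0, ht⟩) = 1 := by
    rw [Equiv.swap_self, Equiv.swap_self]; rfl
  rw [ee, h]; simp

lemma tau_ee (g : Equiv.Perm (Fin r) × Equiv.Perm (Fin t)) (p : Fin r) (q : Fin t) :
    d.tau g * d.ee hr ht p q = d.ee hr ht (g.1 p) (g.2 q) * d.tau g := by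
  obtain ⟨u, v⟩ := g
  set a : Equiv.Perm (Fin r) × Equiv.Perm (Fin t) :=
    (Equiv.swap ⟨0, hr⟩ p, Equiv.swap ⟨0, ht⟩ q) with ha
  set b : Equiv.Perm (Fin r) × Equiv.Perm (Fin t) :=
    (Equiv.swap ⟨0, hr⟩ (u p), Equiv.swap ⟨0, ht⟩ (v q)) with hb
  have haa : a * a = 1 := by simp [ha]
  have hbb : b * b = 1 := by simp [hb]
  have hc := d.tau_fix_e (b * (u, v) * a) hr ht (by simp [ha, hb]) (by simp [ha, hb])
  have e1 : (u, v) * a = b * (b * (u, v) * a) := by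
    rw [← mul_assoc, ← mul_assoc, hbb, one_mul]
  have e2 : b * (u, v) * a * a = b * (u, v) := by
    rw [mul_assoc, haa, mul_one]
  show d.tau (u, v) * (d.tau a * d.e * d.tau a) = d.tau b * d.e * d.tau b * d.tau (u, v)
  rw [← mul_assoc, ← mul_assoc, ← map_mul, e1, map_mul, mul_assoc (d.tau b), hc,
    ← mul_assoc, mul_assoc _ _ (d.tau a), ← map_mul, e2, map_mul, ← mul_assoc]

lemma ee_sq (p q) : d.ee hr ht p q * d.ee hr ht p q = 0 := by
  obtain ⟨u, hu⟩ := exists_perm_one hr p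
  obtain ⟨v, hv⟩ := exists_perm_one ht q
  apply d.tau_cancel (u, v)
  rw [zero_mul, ← hu, ← hv, mul_assoc, ← d.tau_ee hr ht (u, v), ← mul_assoc,
    ← d.tau_ee hr ht (u, v), ee_zero, mul_assoc, d.e_sq, mul_zero]

lemma ee_row (p : Fin r) {q q' : Fin t} (h : q ≠ q') :
    d.ee hr ht p q' * d.ee hr ht p q = d.tau (1, Equiv.swap q q') * d.ee hr ht p q := by
  have h1 := one_lt_of_ne h
  obtain ⟨u, hu⟩ := exists_perm_one hr p
  obtain ⟨v, hv, hv'⟩ := exists_perm_two h1 h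
  have base : d.ee hr ht ⟨0, hr⟩ ⟨1, h1⟩ * d.ee hr ht ⟨0, hr⟩ ⟨0, ht⟩ =
      d.tau (1, Equiv.swap ⟨0, ht⟩ ⟨1, h1⟩) * d.ee hr ht ⟨0, hr⟩ ⟨0, ht⟩ := by
    have := d.e_sb_e h1
    rw [sw_eq ht h1] at this
    rw [ee_zero, ee, Equiv.swap_self, ← Equiv.Perm.one_def, tau_right, mul_assoc, mul_assoc,
      ← mul_assoc d.e, this]
  have hs : (u, v) * (1, Equiv.swap ⟨0, ht⟩ ⟨1, h1⟩) = (1, Equiv.swap q q') * (u, v) := by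
    ext1
    · simp
    · show v * Equiv.swap _ _ = Equiv.swap _ _ * v
      rw [← hv, ← hv', Equiv.swap_apply_apply]; simp
  apply d.tau_cancel (u, v)
  have := congrArg (d.tau (u, v) * ·) base
  rw [← mul_assoc, tau_ee, mul_assoc, tau_ee, ← mul_assoc, ← mul_assoc, ← map_mul, hs, map_mul,
    mul_assoc _ (d.tau (u, v)), tau_ee, ← mul_assoc] at this
  simp only [hu, hv, hv'] at this
  exact this

lemma ee_col {p p' : Fin r} (q : Fin t) (h : p ≠ p') :
    d.ee hr ht p' q * d.ee hr ht p q = d.tau (Equiv.swap p p', 1) * d.ee hr ht p q := by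
  have h1 := one_lt_of_ne h
  obtain ⟨v, hv⟩ := exists_perm_one ht q
  obtain ⟨u, hu, hu'⟩ := exists_perm_two h1 h
  have base : d.ee hr ht ⟨1, h1⟩ ⟨0, ht⟩ * d.ee hr ht ⟨0, hr⟩ ⟨0, ht⟩ =
      d.tau (Equiv.swap ⟨0, hr⟩ ⟨1, h1⟩, 1) * d.ee hr ht ⟨0, hr⟩ ⟨0, ht⟩ := by
    have := d.e_s_e h1
    rw [sw_eq hr h1] at this
    rw [ee_zero, ee, Equiv.swap_self, ← Equiv.Perm.one_def, tau_left, mul_assoc, mul_assoc,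
      ← mul_assoc d.e, this]
  have hs : (u, v) * (Equiv.swap ⟨0, hr⟩ ⟨1, h1⟩, 1) = (Equiv.swap p p', 1) * (u, v) := by
    ext1
    · show u * Equiv.swap _ _ = Equiv.swap _ _ * u
      rw [← hu, ← hu', Equiv.swap_apply_apply]; simp
    · simp
  apply d.tau_cancel (u, v)
  have := congrArg (d.tau (u, v) * ·) base
  rw [← mul_assoc, tau_ee, mul_assoc, tau_ee, ← mul_assoc, ← mul_assoc, ← map_mul, hs, map_mul,
    mul_assoc _ (d.tau (u, v)), tau_ee, ← mul_assoc] at this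
  simp only [hu, hv, hu'] at this
  exact this

/-- base relations for two disjoint cups -/
lemma ee_base (h1 : 1 < r) (h2 : 1 < t) :
    d.ee hr ht ⟨0, hr⟩ ⟨0, ht⟩ * d.ee hr ht ⟨1, h1⟩ ⟨1, h2⟩ =
      d.e * d.tau (Equiv.swap ⟨0, hr⟩ ⟨1, h1⟩, Equiv.swap ⟨0, ht⟩ ⟨1, h2⟩) * d.e ∧
    d.ee hr ht ⟨1, h1⟩ ⟨1, h2⟩ * d.ee hr ht ⟨0, hr⟩ ⟨0, ht⟩ =
      d.e * d.tau (Equiv.swap ⟨0, hr⟩ ⟨1, h1⟩, Equiv.swap ⟨0, ht⟩ ⟨1, h2⟩) * d.e := by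
  have b1 := d.braid1 h1 h2
  have b2 := d.braid2 h1 h2
  rw [sw_eq hr h1, sw_eq ht h2] at b1 b2
  set s := d.σ (Equiv.swap ⟨0, hr⟩ ⟨1, h1⟩) with hs
  set sb := d.σb (Equiv.swap ⟨0, ht⟩ ⟨1, h2⟩) with hsb
  have hss : s * s = 1 := by rw [hs, ← map_mul]; simp
  have hbb : sb * sb = 1 := by rw [hsb, ← map_mul]; simp
  have hc : s * sb = sb * s := d.comm_σσb _ _
  rw [ee_zero, ee, tau_mk, ← hs, ← hsb]
  constructor
  · calc d.e * (s * sb * d.e * (s * sb)) = d.e * s * sb * d.e * s * sb := by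
          simp only [mul_assoc]
      _ = d.e * s * sb * d.e * sb * sb := by rw [b1]
      _ = _ := by rw [mul_assoc _ sb sb, hbb, mul_one]; simp only [mul_assoc]
  · calc s * sb * d.e * (s * sb) * d.e = s * (sb * d.e * s * sb * d.e) := by
          simp only [mul_assoc]
      _ = s * (s * d.e * s * sb * d.e) := by rw [b2]
      _ = (s * s) * (d.e * s * sb * d.e) := by simp only [mul_assoc]
      _ = _ := by rw [hss, one_mul]; simp only [mul_assoc]

lemma ee_comm {p p' : Fin r} {q q' : Fin t} (hp : p ≠ p') (hq : q ≠ q') :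
    d.ee hr ht p q * d.ee hr ht p' q' = d.ee hr ht p' q' * d.ee hr ht p q := by
  have h1 := one_lt_of_ne hp
  have h2 := one_lt_of_ne hq
  obtain ⟨u, hu, hu'⟩ := exists_perm_two h1 hp
  obtain ⟨v, hv, hv'⟩ := exists_perm_two h2 hq
  obtain ⟨b1, b2⟩ := d.ee_base hr ht h1 h2
  have base := b1.trans b2.symm
  apply d.tau_cancel (u, v)
  have := congrArg (d.tau (u, v) * ·) base
  rw [← mul_assoc, tau_ee, mul_assoc, tau_ee, ← mul_assoc, ← mul_assoc, tau_ee, mul_assoc _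
    (d.tau (u, v)), tau_ee, ← mul_assoc] at this
  simp only [hu, hv, hu', hv'] at this
  exact this

lemma ee_swap_left {p p' : Fin r} {q q' : Fin t} (hp : p ≠ p') (hq : q ≠ q') :
    d.tau (Equiv.swap p p', Equiv.swap q q') * (d.ee hr ht p q * d.ee hr ht p' q') =
      d.ee hr ht p q * d.ee hr ht p' q' := by
  have h1 := one_lt_of_ne hp
  have h2 := one_lt_of_ne hq
  obtain ⟨u, hu, hu'⟩ := exists_perm_two h1 hp
  obtain ⟨v, hv, hv'⟩ := exists_perm_two h2 hq
  obtain ⟨b1, b2⟩ := d.ee_base hr ht h1 h2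
  have base : d.tau (Equiv.swap ⟨0, hr⟩ ⟨1, h1⟩, Equiv.swap ⟨0, ht⟩ ⟨1, h2⟩) *
      (d.ee hr ht ⟨0, hr⟩ ⟨0, ht⟩ * d.ee hr ht ⟨1, h1⟩ ⟨1, h2⟩) =
      d.ee hr ht ⟨0, hr⟩ ⟨0, ht⟩ * d.ee hr ht ⟨1, h1⟩ ⟨1, h2⟩ := by
    rw [b1]
    refine Eq.trans ?_ b2
    rw [ee_zero, ee]
    simp only [mul_assoc]
  have hs : (u, v) * (Equiv.swap ⟨0, hr⟩ ⟨1, h1⟩, Equiv.swap ⟨0, ht⟩ ⟨1, h2⟩) =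
      (Equiv.swap p p', Equiv.swap q q') * (u, v) := by
    ext1
    · show u * Equiv.swap _ _ = Equiv.swap _ _ * u
      rw [← hu, ← hu', Equiv.swap_apply_apply]; simp
    · show v * Equiv.swap _ _ = Equiv.swap _ _ * v
      rw [← hv, ← hv', Equiv.swap_apply_apply]; simp
  have hE : d.tau (u, v) * (d.ee hr ht ⟨0, hr⟩ ⟨0, ht⟩ * d.ee hr ht ⟨1, h1⟩ ⟨1, h2⟩) =
      d.ee hr ht p q * d.ee hr ht p' q' * d.tau (u, v) := by
    rw [← mul_assoc, tau_ee, mul_assoc, tau_ee, ← mul_assoc]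
    simp only [hu, hv, hu', hv']
  apply d.tau_cancel (u, v)
  have := congrArg (d.tau (u, v) * ·) base
  rw [← mul_assoc, ← map_mul, hs, map_mul, mul_assoc, hE, ← mul_assoc] at this
  exact this

lemma ee_swap_right {p p' : Fin r} {q q' : Fin t} (hp : p ≠ p') (hq : q ≠ q') :
    (d.ee hr ht p q * d.ee hr ht p' q') * d.tau (Equiv.swap p p', Equiv.swap q q') =
      d.ee hr ht p q * d.ee hr ht p' q' := by
  have h := d.ee_swap_left hr ht hp hq
  rw [← mul_assoc, tau_ee, mul_assoc, tau_ee, ← mul_assoc] at h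
  simp only [Equiv.swap_apply_left, Equiv.swap_apply_right] at h
  rwa [d.ee_comm hr ht hp.symm hq.symm] at h

lemma cb_ee (p q) : d.cb q * d.ee hr ht p q = d.c p * d.ee hr ht p q := by
  obtain ⟨u, hu⟩ := exists_perm_one hr p
  obtain ⟨v, hv⟩ := exists_perm_one ht q
  apply d.tau_cancel (u, v)
  rw [← hu, ← hv, mul_assoc, mul_assoc, ← d.tau_ee hr ht (u, v), ← mul_assoc, ← mul_assoc,
    ← d.tau_c (u, v), ← d.tau_cb (u, v), ee_zero, mul_assoc, mul_assoc, d.c1_e hr ht]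

lemma c_ee {i p : Fin r} (h : i ≠ p) (q) : d.c i * d.ee hr ht p q = d.ee hr ht p q * d.c i := by
  have h1 := one_lt_of_ne h
  obtain ⟨u, hu, hu'⟩ := exists_perm_two h1 h.symm
  obtain ⟨v, hv⟩ := exists_perm_one ht q
  apply d.tau_cancel (u, v)
  rw [← hu, ← hv, ← hu', mul_assoc, mul_assoc, ← d.tau_ee hr ht (u, v), ← mul_assoc,
    ← d.tau_c (u, v), ← mul_assoc, ← d.tau_ee hr ht (u, v), ee_zero, mul_assoc, mul_assoc,
    d.c_e_comm _ (by simp)]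

lemma cb_cee (p) {j q : Fin t} (h : j ≠ q) :
    d.cb j * d.ee hr ht p q = d.ee hr ht p q * d.cb j := by
  obtain ⟨u, hu⟩ := exists_perm_one hr p
  have h1 := one_lt_of_ne h
  obtain ⟨v, hv, hv'⟩ := exists_perm_two h1 h.symm
  apply d.tau_cancel (u, v)
  rw [← hu, ← hv, ← hv', mul_assoc, mul_assoc, ← d.tau_ee hr ht (u, v), ← mul_assoc,
    ← d.tau_cb (u, v), ← mul_assoc, ← d.tau_ee hr ht (u, v), ee_zero, mul_assoc, mul_assoc,
    d.cb_e_comm _ (by simp)]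

end WBC

namespace WBC

variable {R A : Type} [CommRing R] [Ring A] [Algebra R A] {r t : ℕ}
variable (d : WBC R A r t) (hr : 0 < r) (ht : 0 < t)

lemma E_eq (i : ℕ) (h1 : i < r) (h2 : i < t) :
    d.E (i + 1) (i + 1) = d.ee hr ht ⟨i, h1⟩ ⟨i, h2⟩ := by
  simp only [E, tr, trb, Nat.add_sub_cancel, Nat.sub_self]
  rw [sw_eq hr h1, sw_eq ht h2, ee, tau_mk, ← d.comm_σσb]
  simp only [mul_assoc]

lemma epow_zero : d.epow 0 = 1 := by simp [epow]

lemma epow_succ (f : ℕ) (h1 : f < r) (h2 : f < t) :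
    d.epow (f + 1) = d.epow f * d.ee hr ht ⟨f, h1⟩ ⟨f, h2⟩ := by
  rw [← d.E_eq hr ht]
  simp [epow, List.range_succ]

lemma epow_comm (z : A) (f : ℕ) (h1 : f ≤ r) (h2 : f ≤ t)
    (h : ∀ (k : ℕ) (hk : k < f), z * d.ee hr ht ⟨k, by omega⟩ ⟨k, by omega⟩ =
      d.ee hr ht ⟨k, by omega⟩ ⟨k, by omega⟩ * z) : z * d.epow f = d.epow f * z := by
  induction f with
  | zero => simp [epow_zero]
  | succ f ih =>
    rw [d.epow_succ hr ht f (by omega) (by omega), ← mul_assoc,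
      ih (by omega) (by omega) (fun k hk => h k (by omega)), mul_assoc, h f (by omega), mul_assoc]

lemma tau_epow (g : Equiv.Perm (Fin r) × Equiv.Perm (Fin t)) (f : ℕ) (h1 : f ≤ r) (h2 : f ≤ t)
    (hg : ∀ i : Fin r, (i : ℕ) < f → g.1 i = i) (hg' : ∀ i : Fin t, (i : ℕ) < f → g.2 i = i) :
    d.tau g * d.epow f = d.epow f * d.tau g := by
  rcases Nat.eq_zero_or_pos f with rfl | hf
  · simp [epow_zero]
  apply d.epow_comm (by omega) (by omega) _ _ h1 h2
  intro k hk
  rw [tau_ee, hg _ (by simpa using hk), hg' _ (by simpa using hk)]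

lemma epow_left (f : ℕ) (h1 : f ≤ r) (h2 : f ≤ t) (k : ℕ) (hk : k < f) :
    ∃ y, d.epow f = d.ee hr ht ⟨k, by omega⟩ ⟨k, by omega⟩ * y := by
  induction f with
  | zero => omega
  | succ f ih =>
    rcases Nat.lt_or_ge k f with h | h
    · obtain ⟨y, hy⟩ := ih (by omega) (by omega) h
      exact ⟨y * d.ee hr ht ⟨f, by omega⟩ ⟨f, by omega⟩, by
        rw [d.epow_succ hr ht f (by omega) (by omega), hy, mul_assoc]⟩
    · have : k = f := by omega
      subst this
      refine ⟨d.epow k, ?_⟩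
      rw [d.epow_succ hr ht k (by omega) (by omega)]
      symm
      apply d.epow_comm hr ht _ _ (by omega) (by omega)
      intro l hl
      apply d.ee_comm <;> (simp [Fin.ext_iff]; omega)

lemma epow_right (f : ℕ) (h1 : f ≤ r) (h2 : f ≤ t) (k : ℕ) (hk : k < f) :
    ∃ y, d.epow f = y * d.ee hr ht ⟨k, by omega⟩ ⟨k, by omega⟩ := by
  induction f with
  | zero => omega
  | succ f ih =>
    rcases Nat.lt_or_ge k f with h | h
    · obtain ⟨y, hy⟩ := ih (by omega) (by omega) h
      refine ⟨y * d.ee hr ht ⟨f, by omega⟩ ⟨f, by omega⟩, ?_⟩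
      rw [d.epow_succ hr ht f (by omega) (by omega), hy, mul_assoc, mul_assoc, d.ee_comm hr ht] <;>
        (simp [Fin.ext_iff]; omega)
    · have : k = f := by omega
      subst this
      exact ⟨d.epow k, d.epow_succ hr ht k (by omega) (by omega)⟩

lemma epow_two (f : ℕ) (h1 : f ≤ r) (h2 : f ≤ t) (k l : ℕ) (hk : k < l) (hl : l < f) :
    (∃ y, d.epow f = d.ee hr ht ⟨k, by omega⟩ ⟨k, by omega⟩ *
      d.ee hr ht ⟨l, by omega⟩ ⟨l, by omega⟩ * y) ∧
    (∃ y, d.epow f = y * (d.ee hr ht ⟨k, by omega⟩ ⟨k, by omega⟩ *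
      d.ee hr ht ⟨l, by omega⟩ ⟨l, by omega⟩)) := by
  induction f with
  | zero => omega
  | succ f ih =>
    have hs := d.epow_succ hr ht f (by omega) (by omega)
    rcases Nat.lt_or_ge l f with h | h
    · obtain ⟨⟨y, hy⟩, ⟨y', hy'⟩⟩ := ih (by omega) (by omega) h
      refine ⟨⟨y * d.ee hr ht ⟨f, by omega⟩ ⟨f, by omega⟩, ?_⟩,
        ⟨y' * d.ee hr ht ⟨f, by omega⟩ ⟨f, by omega⟩, ?_⟩⟩
      · rw [hs, hy, mul_assoc]
      · rw [hs, hy', mul_assoc, mul_assoc, mul_assoc]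
        rw [d.ee_comm hr ht (p := ⟨l, by omega⟩) (p' := ⟨f, by omega⟩) (q := ⟨l, by omega⟩)
          (q' := ⟨f, by omega⟩) (by simp [Fin.ext_iff]; omega) (by simp [Fin.ext_iff]; omega)]
        rw [← mul_assoc (d.ee hr ht ⟨k, by omega⟩ ⟨k, by omega⟩)]
        rw [d.ee_comm hr ht (p := ⟨k, by omega⟩) (p' := ⟨f, by omega⟩) (q := ⟨k, by omega⟩)
          (q' := ⟨f, by omega⟩) (by simp [Fin.ext_iff]; omega) (by simp [Fin.ext_iff]; omega)]
        simp only [mul_assoc]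
    · have : l = f := by omega
      subst this
      constructor
      · obtain ⟨y, hy⟩ := d.epow_left hr ht l (by omega) (by omega) k hk
        refine ⟨y, ?_⟩
        have hc : d.ee hr ht ⟨l, by omega⟩ ⟨l, by omega⟩ * d.epow l =
            d.epow l * d.ee hr ht ⟨l, by omega⟩ ⟨l, by omega⟩ := by
          apply d.epow_comm hr ht _ _ (by omega) (by omega)
          intro m hm
          apply d.ee_comm <;> (simp [Fin.ext_iff]; omega)
        rw [hs, ← hc, hy, ← mul_assoc, d.ee_comm hr ht] <;> (simp [Fin.ext_iff]; omega)
      · obtain ⟨y, hy⟩ := d.epow_right hr ht l (by omega) (by omega) k hk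
        exact ⟨y, by rw [hs, hy, mul_assoc]⟩

lemma ext_epow (f : ℕ) (h1 : f ≤ r) (h2 : f ≤ t) (π : Equiv.Perm (Fin f)) :
    d.tau (extP f r h1 π, extP f t h2 π) * d.epow f = d.epow f ∧
    d.epow f * d.tau (extP f r h1 π, extP f t h2 π) = d.epow f := by
  rcases Nat.eq_zero_or_pos f with rfl | hf
  · have : π = 1 := Subsingleton.elim _ _
    subst this
    rw [map_one, map_one, show ((1, 1) : Equiv.Perm (Fin r) × Equiv.Perm (Fin t)) = 1 from rfl,
      map_one]
    simp
  have hr : 0 < r := by omega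
  have ht : 0 < t := by omega
  induction π using Equiv.Perm.swap_induction_on with
  | one =>
    rw [map_one, map_one, show ((1, 1) : Equiv.Perm (Fin r) × Equiv.Perm (Fin t)) = 1 from rfl,
      map_one]
    simp
  | swap_mul π x y hxy ih =>
    have hs : ∀ x y : Fin f, x < y →
        d.tau (extP f r h1 (Equiv.swap x y), extP f t h2 (Equiv.swap x y)) * d.epow f = d.epow f ∧
        d.epow f * d.tau (extP f r h1 (Equiv.swap x y), extP f t h2 (Equiv.swap x y))
          = d.epow f := by
      intro x y hxy
      rw [extP_swap, extP_swap]
      have hne1 : Fin.castLE h1 x ≠ Fin.castLE h1 y := by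
        simp [Fin.ext_iff]; have := Fin.lt_def.1 hxy; omega
      have hne2 : Fin.castLE h2 x ≠ Fin.castLE h2 y := by
        simp [Fin.ext_iff]; have := Fin.lt_def.1 hxy; omega
      obtain ⟨⟨z, hz⟩, ⟨z', hz'⟩⟩ := d.epow_two hr ht f h1 h2 x y hxy y.2
      constructor
      · rw [hz, ← mul_assoc]
        congr 1
        exact d.ee_swap_left hr ht hne1 hne2
      · rw [hz', mul_assoc]
        congr 1
        exact d.ee_swap_right hr ht hne1 hne2
    have hs' : d.tau (extP f r h1 (Equiv.swap x y), extP f t h2 (Equiv.swap x y)) * d.epow f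
          = d.epow f ∧
        d.epow f * d.tau (extP f r h1 (Equiv.swap x y), extP f t h2 (Equiv.swap x y))
          = d.epow f := by
      rcases lt_or_gt_of_ne hxy with h | h
      · exact hs x y h
      · rw [Equiv.swap_comm]; exact hs y x h
    rw [map_mul, map_mul, ← Prod.mk_mul_mk, map_mul]
    constructor
    · rw [mul_assoc, ih.1, hs'.1]
    · rw [← mul_assoc, hs'.2, ih.2]

/-- span of the diagram elements -/
def HH (d : WBC R A r t) : Submodule R A :=
  Submodule.span R {x | ∃ g f h, f ≤ min r t ∧ x = d.tau g * d.epow f * d.tau h}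

lemma mem_HH (g f h) (hf : f ≤ min r t) : d.tau g * d.epow f * d.tau h ∈ d.HH :=
  Submodule.subset_span ⟨g, f, h, hf, rfl⟩


lemma e_mem_HH (hr : 0 < r) (ht : 0 < t) (g f h) (hf : f ≤ min r t) : d.e * (d.tau g * d.epow f * d.tau h) ∈ d.HH := by
  have hfr : f ≤ r := by omega
  have hft : f ≤ t := by omega
  set p := g.1⁻¹ ⟨0, hr⟩ with hp
  set q := g.2⁻¹ ⟨0, ht⟩ with hq
  have h1 : d.e * d.tau g = d.tau g * d.ee hr ht p q := by
    rw [tau_ee, hp, hq]; simp [ee_zero]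
  rw [← mul_assoc, ← mul_assoc, h1, mul_assoc (d.tau g)]
  by_cases hp1 : (p : ℕ) < f
  · obtain ⟨y, hy⟩ := d.epow_left hr ht f hfr hft p hp1
    by_cases hq1 : q = ⟨p, by omega⟩
    · rw [hy, ← hq1, ← mul_assoc (d.ee hr ht p q), d.ee_sq]
      simp
    · have : d.ee hr ht p q * d.epow f = d.tau (1, Equiv.swap ⟨p, by omega⟩ q) * d.epow f := by
        rw [hy, ← mul_assoc, ← mul_assoc]
        congr 1
        exact d.ee_row hr ht p (Ne.symm hq1)
      rw [this, ← mul_assoc, ← map_mul]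
      exact d.mem_HH _ _ _ hf
  · by_cases hq1 : (q : ℕ) < f
    · obtain ⟨y, hy⟩ := d.epow_left hr ht f hfr hft q hq1
      have hne : (⟨q, by omega⟩ : Fin r) ≠ p := by
        intro h; rw [← h] at hp1; exact hp1 hq1
      have : d.ee hr ht p q * d.epow f = d.tau (Equiv.swap ⟨q, by omega⟩ p, 1) * d.epow f := by
        rw [hy, ← mul_assoc, ← mul_assoc]
        congr 1
        exact d.ee_col hr ht q hne
      rw [this, ← mul_assoc, ← map_mul]
      exact d.mem_HH _ _ _ hf
    · have hfr' : f < r := by omega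
      have hft' : f < t := by omega
      set k : Equiv.Perm (Fin r) × Equiv.Perm (Fin t) :=
        (Equiv.swap ⟨f, hfr'⟩ p, Equiv.swap ⟨f, hft'⟩ q) with hk
      have hkk : k * k = 1 := by simp [hk]
      have hc := d.tau_epow k f hfr hft (by
          intro i hi
          apply Equiv.swap_apply_of_ne_of_ne
          · intro h; simp [h] at hi
          · intro h; rw [h] at hi; exact hp1 hi) (by
          intro i hi
          apply Equiv.swap_apply_of_ne_of_ne
          · intro h; simp [h] at hi
          · intro h; rw [h] at hi; exact hq1 hi)
      have h2 : d.tau k * d.ee hr ht ⟨f, hfr'⟩ ⟨f, hft'⟩ = d.ee hr ht p q * d.tau k := by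
        rw [tau_ee]; simp [hk]
      have hcm : d.ee hr ht ⟨f, hfr'⟩ ⟨f, hft'⟩ * d.epow f =
          d.epow f * d.ee hr ht ⟨f, hfr'⟩ ⟨f, hft'⟩ := by
        apply d.epow_comm hr ht _ _ (by omega) (by omega)
        intro m hm
        apply d.ee_comm <;> (simp [Fin.ext_iff]; omega)
      have h3 : d.ee hr ht p q * d.epow f = d.tau k * d.epow (f + 1) * d.tau k := by
        rw [d.epow_succ hr ht f hfr' hft', ← hcm, ← mul_assoc, h2, mul_assoc _ (d.epow f), ← hc,
          mul_assoc, ← mul_assoc (d.tau k), ← map_mul, hkk, map_one, one_mul]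
      have : d.tau g * (d.ee hr ht p q * d.epow f) * d.tau h =
          d.tau (g * k) * d.epow (f + 1) * d.tau (k * h) := by
        rw [h3, map_mul, map_mul]; simp only [mul_assoc]
      rw [this]
      exact d.mem_HH _ _ _ (by omega)

lemma HH_basis (g f h) (hf : f ≤ min r t) : ∃ (d1 d2 : DElt r t f) (w : Equiv.Perm (Fin r))
    (wb : Equiv.Perm (Fin t)), (∀ i : Fin r, (i : ℕ) < f → w i = i) ∧
    (∀ i : Fin t, (i : ℕ) < f → wb i = i) ∧
    d.tau g * d.epow f * d.tau h = d.σ (d1.pr⁻¹) * d.σb (d1.pt⁻¹) * d.epow f *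
    d.σ w * d.σb wb * d.σ d2.pr * d.σb d2.pt := by
  have hfr : f ≤ r := by omega
  have hft : f ≤ t := by omega
  obtain ⟨u, v⟩ := g
  obtain ⟨u', v'⟩ := h
  obtain ⟨D1, π1, w1, wb1, hw1, hwb1, hu, hv⟩ := decomp r t f hfr hft u⁻¹ v⁻¹
  obtain ⟨D2, π2, w2, wb2, hw2, hwb2, hu', hv'⟩ := decomp r t f hfr hft u' v'
  have hfix1 : ∀ i : Fin r, (i : ℕ) < f → w1⁻¹ i = i := fun i hi => by
    rw [Equiv.Perm.inv_eq_iff_eq, hw1 i hi]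
  have hfix1' : ∀ i : Fin t, (i : ℕ) < f → wb1⁻¹ i = i := fun i hi => by
    rw [Equiv.Perm.inv_eq_iff_eq, hwb1 i hi]
  refine ⟨D1, D2, w1⁻¹ * w2, wb1⁻¹ * wb2, ?_, ?_, ?_⟩
  · intro i hi; rw [Equiv.Perm.mul_apply, hw2 i hi, hfix1 i hi]
  · intro i hi; rw [Equiv.Perm.mul_apply, hwb2 i hi, hfix1' i hi]
  have hg : (u, v) = (D1.pr⁻¹, D1.pt⁻¹) * (w1⁻¹, wb1⁻¹) *
      (extP f r hfr π1⁻¹, extP f t hft π1⁻¹) := by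
    rw [eq_comm, ← inv_inj]
    simp only [mul_inv_rev, Prod.inv_mk, map_inv, inv_inv, Prod.mk_mul_mk, hu, hv, mul_assoc]
  have hh : (u', v') = (extP f r hfr π2, extP f t hft π2) * (w2, wb2) * (D2.pr, D2.pt) := by
    simp only [Prod.mk_mul_mk, hu', hv']
  have hc := d.tau_epow (w1⁻¹, wb1⁻¹) f hfr hft hfix1 hfix1'
  have e1 := (d.ext_epow f hfr hft π1⁻¹).1
  have e2 := (d.ext_epow f hfr hft π2).2
  rw [hg, hh]
  simp only [map_mul d.tau]
  calc _ = d.tau (D1.pr⁻¹, D1.pt⁻¹) * (d.tau (w1⁻¹, wb1⁻¹) *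
        ((d.tau (extP f r hfr π1⁻¹, extP f t hft π1⁻¹) * d.epow f) *
          d.tau (extP f r hfr π2, extP f t hft π2))) * d.tau (w2, wb2) * d.tau (D2.pr, D2.pt) := by
        simp only [mul_assoc]
    _ = d.tau (D1.pr⁻¹, D1.pt⁻¹) * d.epow f * (d.tau (w1⁻¹, wb1⁻¹) * d.tau (w2, wb2)) *
          d.tau (D2.pr, D2.pt) := by
        rw [e1, e2, hc]; simp only [mul_assoc]
    _ = _ := by
        rw [← map_mul, Prod.mk_mul_mk]
        simp only [tau_mk, mul_assoc]

end WBC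

section generic

variable {R A : Type} [CommRing R] [Ring A] [Algebra R A]

lemma adjoin_le_left (s : Set A) (M : Submodule R A) (h1 : (1 : A) ∈ M)
    (h : ∀ g ∈ s, ∀ m ∈ M, g * m ∈ M) : Subalgebra.toSubmodule (Algebra.adjoin R s) ≤ M := by
  have key : ∀ a ∈ Algebra.adjoin R s, ∀ m ∈ M, a * m ∈ M := by
    intro a ha
    induction ha using Algebra.adjoin_induction with
    | mem x hx => exact h x hx
    | algebraMap c => intro m hm; rw [← Algebra.smul_def]; exact M.smul_mem c hm
    | add x y _ _ hx hy => intro m hm; rw [add_mul]; exact M.add_mem (hx m hm) (hy m hm)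
    | mul x y _ _ hx hy => intro m hm; rw [mul_assoc]; exact hx _ (hy m hm)
  intro a ha
  have := key a ha 1 h1
  rwa [mul_one] at this

lemma adjoin_le_right (s : Set A) (M : Submodule R A) (h1 : (1 : A) ∈ M)
    (h : ∀ g ∈ s, ∀ m ∈ M, m * g ∈ M) : Subalgebra.toSubmodule (Algebra.adjoin R s) ≤ M := by
  have key : ∀ a ∈ Algebra.adjoin R s, ∀ m ∈ M, m * a ∈ M := by
    intro a ha
    induction ha using Algebra.adjoin_induction with
    | mem x hx => exact h x hx
    | algebraMap c =>
      intro m hm; rw [← Algebra.commutes, ← Algebra.smul_def]; exact M.smul_mem c hm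
    | add x y _ _ hx hy => intro m hm; rw [mul_add]; exact M.add_mem (hx m hm) (hy m hm)
    | mul x y _ _ hx hy => intro m hm; rw [← mul_assoc]; exact hy _ (hx m hm)
  intro a ha
  have := key a ha 1 h1
  rwa [one_mul] at this

lemma adjoin_move (s : Set A) (z : A)
    (h : ∀ g ∈ s, ∃ u ∈ Algebra.adjoin R s, z * g = u * z) :
    ∀ g ∈ Algebra.adjoin R s, ∃ u ∈ Algebra.adjoin R s, z * g = u * z := by
  intro a ha
  induction ha using Algebra.adjoin_induction with
  | mem x hx => exact h x hx
  | algebraMap c => exact ⟨_, Subalgebra.algebraMap_mem _ c, (Algebra.commutes c z).symm⟩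
  | add x y _ _ hx hy =>
    obtain ⟨u, hu, e1⟩ := hx
    obtain ⟨v, hv, e2⟩ := hy
    exact ⟨u + v, add_mem hu hv, by rw [mul_add, e1, e2, add_mul]⟩
  | mul x y _ _ hx hy =>
    obtain ⟨u, hu, e1⟩ := hx
    obtain ⟨v, hv, e2⟩ := hy
    exact ⟨u * v, mul_mem hu hv, by rw [← mul_assoc, e1, mul_assoc, e2, mul_assoc]⟩

lemma span_induction_mul {s : Set A} {M : Submodule R A} {a b : A}
    (h : ∀ x ∈ s, a * x * b ∈ M) : ∀ x ∈ Submodule.span R s, a * x * b ∈ M := by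
  intro x hx
  induction hx using Submodule.span_induction with
  | mem x hx => exact h x hx
  | zero => simp
  | add x y _ _ hx hy => rw [mul_add, add_mul]; exact M.add_mem hx hy
  | smul c x _ hx => rw [mul_smul_comm, smul_mul_assoc]; exact M.smul_mem c hx

lemma span_mul_left {s : Set A} {M : Submodule R A} {a : A}
    (h : ∀ x ∈ s, a * x ∈ M) : ∀ x ∈ Submodule.span R s, a * x ∈ M := by
  intro x hx
  have := span_induction_mul (R := R) (s := s) (M := M) (a := a) (b := 1)
    (fun x hx => by rw [mul_one]; exact h x hx) x hx
  rwa [mul_one] at this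

/-- ordered product of submodules -/
lemma list_prod_closed {ι : Type} (T : ι → Submodule R A) (y : ι → A)
    (h1 : ∀ k, ∀ m ∈ T k, y k * m ∈ T k)
    (h2 : ∀ i k, i ≠ k → ∀ m ∈ T k, ∃ m' ∈ T k, y i * m = m' * y i) (l : List ι) (i : ι)
    (hi : i ∈ l) : ∀ m ∈ (l.map T).prod, y i * m ∈ (l.map T).prod := by
  induction l with
  | nil => simp at hi
  | cons k l ih =>
    intro m hm
    rw [List.map_cons, List.prod_cons] at hm ⊢
    refine Submodule.mul_induction_on hm (fun a ha b hb => ?_) (fun a b ha hb => ?_)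
    · by_cases hik : i = k
      · subst hik
        rw [← mul_assoc]
        exact Submodule.mul_mem_mul (h1 _ _ ha) hb
      · obtain ⟨a', ha', e⟩ := h2 i k hik a ha
        rw [← mul_assoc, e, mul_assoc]
        exact Submodule.mul_mem_mul ha' (ih (by simpa [hik] using hi) b hb)
    · rw [mul_add]; exact Submodule.add_mem _ ha hb

lemma list_prod_one {ι : Type} (T : ι → Submodule R A) (h : ∀ k, (1 : A) ∈ T k) (l : List ι) :
    (1 : A) ∈ (l.map T).prod := by
  induction l with
  | nil => simpa using (Submodule.one_le (P := (1 : Submodule R A))).mp le_rfl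
  | cons k l ih =>
    rw [List.map_cons, List.prod_cons]
    simpa using Submodule.mul_mem_mul (h k) ih

lemma list_prod_span {ι E : Type} [DecidableEq ι] [Inhabited E] (y : ι → E → A) (l : List ι)
    (hl : l.Nodup) :
    (l.map (fun k => Submodule.span R (Set.range (y k)))).prod ≤
      Submodule.span R (Set.range (fun α : ι → E => (l.map (fun k => y k (α k))).prod)) := by
  induction l with
  | nil =>
    simp only [List.map_nil, List.prod_nil]
    rw [Submodule.one_le]
    exact Submodule.subset_span ⟨fun _ => default, rfl⟩
  | cons k l ih =>
    rw [List.map_cons, List.prod_cons]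
    refine (mul_le_mul_right (ih hl.of_cons) _).trans ?_
    rw [Submodule.span_mul_span]
    refine Submodule.span_mono ?_
    rintro _ ⟨_, ⟨a, rfl⟩, _, ⟨α, rfl⟩, rfl⟩
    refine ⟨Function.update α k a, ?_⟩
    simp only [List.map_cons, List.prod_cons, Function.update_self]
    congr 2
    apply List.map_congr_left
    intro j hj
    rw [Function.update_of_ne]
    rintro rfl
    exact (List.nodup_cons.mp hl).1 hj

/-- ordered monomials in skew commuting families -/
lemma skew_pow {z y : A} {ε : A} (hε : ε = 1 ∨ ε = -1) (h : z * y = ε * y * z) (a : ℕ) :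
    z * y ^ a = ε ^ a * y ^ a * z := by
  induction a with
  | zero => simp
  | succ a ih =>
    rw [pow_succ y, ← mul_assoc, ih, mul_assoc, h]
    rcases hε with rfl | rfl
    · simp [pow_succ, mul_assoc]
    · simp [pow_succ, mul_assoc]

lemma eps_pow {ε : A} (hε : ε = 1 ∨ ε = -1) (a : ℕ) : ε ^ a = 1 ∨ ε ^ a = -1 := by
  rcases hε with rfl | rfl
  · left; simp
  · exact neg_one_pow_eq_or A a

lemma skew_span {z : A} {E : Type} (y : E → A)
    (h : ∀ a, ∃ ε : A, (ε = 1 ∨ ε = -1) ∧ z * y a = ε * y a * z) :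
    ∀ m ∈ Submodule.span R (Set.range y), ∃ m' ∈ Submodule.span R (Set.range y),
      z * m = m' * z := by
  intro m hm
  induction hm using Submodule.span_induction with
  | mem x hx =>
    obtain ⟨a, rfl⟩ := hx
    obtain ⟨ε, hε, e⟩ := h a
    refine ⟨ε * y a, ?_, e⟩
    have := Submodule.subset_span (R := R) (Set.mem_range_self (f := y) a)
    rcases hε with rfl | rfl
    · simpa using this
    · simpa using this
  | zero => exact ⟨0, zero_mem _, by simp⟩
  | add x y _ _ hx hy =>
    obtain ⟨u, hu, e1⟩ := hx
    obtain ⟨v, hv, e2⟩ := hy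
    exact ⟨u + v, add_mem hu hv, by rw [mul_add, e1, e2, add_mul]⟩
  | smul c x _ hx =>
    obtain ⟨u, hu, e1⟩ := hx
    exact ⟨c • u, Submodule.smul_mem _ c hu, by rw [mul_smul_comm, e1, smul_mul_assoc]⟩

lemma adjoin_le_ordered {n : ℕ} (y : Fin n → A)
    (hy : ∀ i j, i ≠ j → ∃ ε : A, (ε = 1 ∨ ε = -1) ∧ y i * y j = ε * y j * y i) :
    Subalgebra.toSubmodule (Algebra.adjoin R (Set.range y)) ≤
      Submodule.span R (Set.range (fun α : Fin n → ℕ =>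
        ((List.finRange n).map (fun k => y k ^ α k)).prod)) := by
  refine le_trans ?_ (list_prod_span (R := R) (fun k a => y k ^ a) _ (List.nodup_finRange n))
  apply adjoin_le_left
  · exact list_prod_one _ (fun k => Submodule.subset_span (Set.mem_range.mpr ⟨0, by simp⟩)) _
  · rintro _ ⟨i, rfl⟩
    refine list_prod_closed _ y ?_ ?_ _ i (List.mem_finRange i)
    · intro k
      apply span_mul_left
      rintro _ ⟨a, rfl⟩
      exact Submodule.subset_span ⟨a + 1, by simp [pow_succ']⟩
    · intro i k hik
      apply skew_span
      intro a
      obtain ⟨ε, hε, e⟩ := hy i k hik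
      exact ⟨ε ^ a, eps_pow hε a, skew_pow hε e a⟩

lemma adjoin_le_ordered2 {n : ℕ} (y : Fin n → A)
    (hy : ∀ i j, i ≠ j → ∃ ε : A, (ε = 1 ∨ ε = -1) ∧ y i * y j = ε * y j * y i)
    (hsq : ∀ i, y i * y i = 1 ∨ y i * y i = -1) :
    Subalgebra.toSubmodule (Algebra.adjoin R (Set.range y)) ≤
      Submodule.span R (Set.range (fun α : Fin n → Fin 2 =>
        ((List.finRange n).map (fun k => y k ^ (α k : ℕ))).prod)) := by
  refine le_trans ?_ (list_prod_span (R := R) (fun k (a : Fin 2) => y k ^ (a : ℕ)) _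
    (List.nodup_finRange n))
  apply adjoin_le_left
  · exact list_prod_one _ (fun k => Submodule.subset_span (Set.mem_range.mpr ⟨0, by simp⟩)) _
  · rintro _ ⟨i, rfl⟩
    refine list_prod_closed _ y ?_ ?_ _ i (List.mem_finRange i)
    · intro k
      apply span_mul_left
      rintro _ ⟨a, rfl⟩
      have h1 : (1 : A) ∈ Submodule.span R (Set.range fun a : Fin 2 => y k ^ (a : ℕ)) :=
        Submodule.subset_span ⟨0, by simp⟩
      fin_cases a
      · exact Submodule.subset_span ⟨1, by simp⟩
      · rcases hsq k with h | h
        · simpa [h] using h1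
        · simpa [h] using h1
    · intro i k hik
      apply skew_span
      intro a
      obtain ⟨ε, hε, e⟩ := hy i k hik
      exact ⟨ε ^ (a : ℕ), eps_pow hε a, skew_pow hε e a⟩

lemma adjoin_union_le {s s' : Set A} 
    (h : ∀ z ∈ s', ∀ g ∈ s, ∃ ε : A, (ε = 1 ∨ ε = -1) ∧ z * g = ε * g * z) :
    Subalgebra.toSubmodule (Algebra.adjoin R (s ∪ s')) ≤
      Subalgebra.toSubmodule (Algebra.adjoin R s) * Subalgebra.toSubmodule (Algebra.adjoin R s') := by
  apply adjoin_le_left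
  · have h1 := Submodule.mul_mem_mul (M := Subalgebra.toSubmodule (Algebra.adjoin R s))
      (N := Subalgebra.toSubmodule (Algebra.adjoin R s'))
      (one_mem (Algebra.adjoin R s)) (one_mem (Algebra.adjoin R s'))
    simpa using h1
  · rintro g hg m hm
    refine Submodule.mul_induction_on hm (fun a ha b hb => ?_) (fun a b ha hb => ?_)
    · rcases hg with hg | hg
      · rw [← mul_assoc]
        exact Submodule.mul_mem_mul ((Algebra.adjoin R s).mul_mem (Algebra.subset_adjoin hg) ha) hb
      · obtain ⟨u, hu, e⟩ := adjoin_move (R := R) s g (by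
          intro k hk
          obtain ⟨ε, hε, e⟩ := h g hg k hk
          refine ⟨ε * k, ?_, e⟩
          have := Algebra.subset_adjoin (R := R) hk
          rcases hε with rfl | rfl
          · simpa using this
          · simpa using this) a ha
        rw [← mul_assoc, e, mul_assoc]
        exact Submodule.mul_mem_mul hu ((Algebra.adjoin R s').mul_mem (Algebra.subset_adjoin hg) hb)
    · rw [mul_add]; exact Submodule.add_mem _ ha hb

end generic

/-- The exact relations of the associated graded algebra. -/
structure GD {R A : Type} [CommRing R] [Ring A] [Algebra R A] {r t : ℕ} (d : WBC R A r t)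
    (hr : 0 < r) (ht : 0 < t) (x : Fin r → A) (xb : Fin t → A) : Prop where
  xx : ∀ i j, x i * x j = x j * x i
  bb : ∀ i j, xb i * xb j = xb j * xb i
  xxb : ∀ i j, x i * xb j = xb j * x i
  tx : ∀ g i, d.tau g * x i = x (g.1 i) * d.tau g
  txb : ∀ g j, d.tau g * xb j = xb (g.2 j) * d.tau g
  cx : ∀ i, d.c i * x i = -(x i * d.c i)
  cx' : ∀ i j, i ≠ j → d.c i * x j = x j * d.c i
  cbxb : ∀ i, d.cb i * xb i = -(xb i * d.cb i)
  cbxb' : ∀ i j, i ≠ j → d.cb i * xb j = xb j * d.cb i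
  cbx : ∀ i j, d.cb i * x j = x j * d.cb i
  cxb : ∀ i j, d.c i * xb j = xb j * d.c i
  ex : ∀ i, i ≠ ⟨0, hr⟩ → d.e * x i = x i * d.e
  exb : ∀ j, j ≠ ⟨0, ht⟩ → d.e * xb j = xb j * d.e
  ex0 : d.e * x ⟨0, hr⟩ = -(d.e * xb ⟨0, ht⟩)
  x0e : xb ⟨0, ht⟩ * d.e = -(x ⟨0, hr⟩ * d.e)
  exe : ∀ a, d.e * x ⟨0, hr⟩ ^ (a + 1) * d.e = 0
  two : ∀ a : A, a + a = 0 → a = 0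

namespace WBC

variable {R A : Type} [CommRing R] [Ring A] [Algebra R A] {r t : ℕ}
variable (d : WBC R A r t) (hr : 0 < r) (ht : 0 < t)

lemma y_ee {y : Fin r → A} {yb : Fin t → A} {s : A}
    (hs : s = 1 ∨ s = -1)
    (ty : ∀ g i, d.tau g * y i = y (g.1 i) * d.tau g)
    (tyb : ∀ g j, d.tau g * yb j = yb (g.2 j) * d.tau g)
    (h0 : yb ⟨0, ht⟩ * d.e = s * (y ⟨0, hr⟩ * d.e)) (p q) :
    yb q * d.ee hr ht p q = s * (y p * d.ee hr ht p q) := by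
  obtain ⟨u, hu⟩ := exists_perm_one hr p
  obtain ⟨v, hv⟩ := exists_perm_one ht q
  apply d.tau_cancel (u, v)
  have e1 := d.tau_ee hr ht (u, v) ⟨0, hr⟩ ⟨0, ht⟩
  simp only [hu, hv, ee_zero] at e1
  have e2 := ty (u, v) ⟨0, hr⟩
  have e3 := tyb (u, v) ⟨0, ht⟩
  simp only [hu, hv] at e2 e3
  have hst : s * d.tau (u, v) = d.tau (u, v) * s := by rcases hs with rfl | rfl <;> simp
  calc yb q * d.ee hr ht p q * d.tau (u, v) = d.tau (u, v) * (yb ⟨0, ht⟩ * d.e) := by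
        rw [mul_assoc, ← e1, ← mul_assoc, ← e3, mul_assoc]
    _ = s * (d.tau (u, v) * (y ⟨0, hr⟩ * d.e)) := by rw [h0, ← mul_assoc, ← hst, mul_assoc]
    _ = s * (y p * d.ee hr ht p q) * d.tau (u, v) := by
        rw [mul_assoc s, mul_assoc (y p), ← e1, ← mul_assoc (y p), ← e2, mul_assoc]

lemma yb_ee {yb : Fin t → A}
    (tyb : ∀ g j, d.tau g * yb j = yb (g.2 j) * d.tau g)
    (h0 : ∀ j, j ≠ ⟨0, ht⟩ → d.e * yb j = yb j * d.e) (p) {j q : Fin t} (h : j ≠ q) :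
    yb j * d.ee hr ht p q = d.ee hr ht p q * yb j := by
  obtain ⟨u, hu⟩ := exists_perm_one hr p
  have h1 := one_lt_of_ne h
  obtain ⟨v, hv, hv'⟩ := exists_perm_two h1 h.symm
  apply d.tau_cancel (u, v)
  have e1 := d.tau_ee hr ht (u, v) ⟨0, hr⟩ ⟨0, ht⟩
  simp only [hu, hv, ee_zero] at e1
  have e3 := tyb (u, v) ⟨1, h1⟩
  simp only [hv'] at e3
  rw [mul_assoc, ← e1, ← mul_assoc, ← e3, mul_assoc, ← h0 _ (by simp), ← mul_assoc, e1, mul_assoc,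
    e3, mul_assoc]

lemma push {y : Fin r → A} {yb : Fin t → A} {s : A}
    (hs : s = 1 ∨ s = -1)
    (ty : ∀ g i, d.tau g * y i = y (g.1 i) * d.tau g)
    (tyb : ∀ g j, d.tau g * yb j = yb (g.2 j) * d.tau g)
    (h0 : yb ⟨0, ht⟩ * d.e = s * (y ⟨0, hr⟩ * d.e))
    (h0' : ∀ j, j ≠ ⟨0, ht⟩ → d.e * yb j = yb j * d.e) (j g f h) (hf : f ≤ min r t) :
    (∃ (hq : (g.2⁻¹ j : Fin t).val < f), yb j * (d.tau g * d.epow f * d.tau h) =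
      s * (y (g.1 ⟨(g.2⁻¹ j : Fin t).val, by omega⟩) * (d.tau g * d.epow f * d.tau h))) ∨
    ∃ k, yb j * (d.tau g * d.epow f * d.tau h) = d.tau g * d.epow f * d.tau h * yb k := by
  set q := g.2⁻¹ j with hq
  have hj : g.2 q = j := by simp [hq]
  have e1 : yb j * d.tau g = d.tau g * yb q := by rw [tyb, hj]
  by_cases hqf : (q : ℕ) < f
  · left
    refine ⟨hqf, ?_⟩
    obtain ⟨z, hz⟩ := d.epow_left hr ht f (by omega) (by omega) q hqf
    set p : Fin r := ⟨q, by omega⟩ with hp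
    have hst : s * d.tau g = d.tau g * s := by rcases hs with rfl | rfl <;> simp
    have e2 : yb q * d.epow f = s * (y p * d.epow f) := by
      rw [hz, ← mul_assoc, ← mul_assoc (y p), ← mul_assoc s]
      congr 1
      exact d.y_ee hr ht hs ty tyb h0 p q
    calc yb j * (d.tau g * d.epow f * d.tau h) = d.tau g * (yb q * d.epow f) * d.tau h := by
          rw [← mul_assoc, ← mul_assoc, e1, mul_assoc (d.tau g)]
      _ = s * (d.tau g * y p * d.epow f) * d.tau h := by
          rw [e2, ← mul_assoc, ← hst]; simp only [mul_assoc]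
      _ = _ := by rw [ty]; simp only [mul_assoc]
  · right
    refine ⟨h.2⁻¹ q, ?_⟩
    have e2 : yb q * d.epow f = d.epow f * yb q := by
      apply d.epow_comm hr ht _ f (by omega) (by omega)
      intro k hk
      apply d.yb_ee hr ht tyb h0'
      intro hh
      apply hqf
      rw [hh]
      exact hk
    have e3 : d.tau h * yb (h.2⁻¹ q) = yb q * d.tau h := by rw [tyb]; simp
    calc yb j * (d.tau g * d.epow f * d.tau h) = yb j * d.tau g * d.epow f * d.tau h := by
          simp only [mul_assoc]
      _ = d.tau g * (yb q * d.epow f) * d.tau h := by rw [e1]; simp only [mul_assoc]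
      _ = d.tau g * d.epow f * (yb q * d.tau h) := by rw [e2]; simp only [mul_assoc]
      _ = _ := by rw [← e3]; simp only [mul_assoc]

end WBC

namespace GD

variable {R A : Type} [CommRing R] [Ring A] [Algebra R A] {r t : ℕ} {d : WBC R A r t}
    {hr : 0 < r} {ht : 0 < t} {x : Fin r → A} {xb : Fin t → A}

/-- conjugation passes to powers -/
lemma conj_pow {T a b : A} (h : T * a = b * T) (n : ℕ) : T * a ^ n = b ^ n * T :=
  SemiconjBy.pow_right (show SemiconjBy T a b from h) n

lemma ty (G : GD d hr ht x xb) (a ε : ℕ) (g i) :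
    d.tau g * (x i ^ a * d.c i ^ ε) = (x (g.1 i) ^ a * d.c (g.1 i) ^ ε) * d.tau g := by
  rw [← mul_assoc, conj_pow (G.tx g i), mul_assoc, conj_pow (d.tau_c g i), mul_assoc]

lemma tyb (G : GD d hr ht x xb) (a ε : ℕ) (g j) : d.tau g * (d.cb j ^ ε * xb j ^ a) =
    (d.cb (g.2 j) ^ ε * xb (g.2 j) ^ a) * d.tau g := by
  rw [← mul_assoc, conj_pow (d.tau_cb g j), mul_assoc, conj_pow (G.txb g j), mul_assoc]

lemma sgn_comm {s : A} (hs : s = 1 ∨ s = -1) (a : A) : s * a = a * s := by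
  rcases hs with rfl | rfl <;> simp

lemma sgn_mul {s u : A} (hs : s = 1 ∨ s = -1) (hu : u = 1 ∨ u = -1) : s * u = 1 ∨ s * u = -1 := by
  rcases hs with rfl | rfl <;> rcases hu with rfl | rfl <;> simp

lemma pow_e {u v e η κ : A} (hη : η = 1 ∨ η = -1) (hκ : κ = 1 ∨ κ = -1)
    (h : v * e = η * (u * e)) (huv : v * u = κ * u * v) (n : ℕ) :
    ∃ s : A, (s = 1 ∨ s = -1) ∧ v ^ n * e = s * (u ^ n * e) := by
  induction n with
  | zero => exact ⟨1, Or.inl rfl, by simp⟩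
  | succ n ih =>
    obtain ⟨s, hs, ih⟩ := ih
    have hc := skew_pow hκ huv n
    have hk := eps_pow hκ n
    refine ⟨s * κ ^ n * η, sgn_mul (sgn_mul hs hk) hη, ?_⟩
    calc v ^ (n + 1) * e = v * (v ^ n * e) := by rw [pow_succ', mul_assoc]
      _ = s * (v * u ^ n * e) := by rw [ih, ← mul_assoc, ← sgn_comm hs]; simp only [mul_assoc]
      _ = s * κ ^ n * (u ^ n * (v * e)) := by rw [hc]; simp only [mul_assoc]
      _ = s * κ ^ n * (η * u ^ n * (u * e)) := by rw [h, sgn_comm hη (u ^ n), mul_assoc (u ^ n)]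
      _ = _ := by rw [pow_succ]; simp only [mul_assoc]

lemma e_pow {u v e η κ : A} (hη : η = 1 ∨ η = -1) (hκ : κ = 1 ∨ κ = -1)
    (h : e * u = η * (e * v)) (huv : v * u = κ * u * v) (n : ℕ) :
    ∃ s : A, (s = 1 ∨ s = -1) ∧ e * u ^ n = s * (e * v ^ n) := by
  induction n with
  | zero => exact ⟨1, Or.inl rfl, by simp⟩
  | succ n ih =>
    obtain ⟨s, hs, ih⟩ := ih
    have hvn : v ^ n * u = κ ^ n * u * v ^ n := by
      clear ih
      induction n with
      | zero => simp
      | succ n ih =>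
        rw [pow_succ, mul_assoc, huv, sgn_comm hκ u, ← mul_assoc, ← mul_assoc, ih,
          mul_assoc _ _ κ, ← sgn_comm hκ, mul_assoc _ (κ * v ^ n), mul_assoc κ,
          mul_assoc _ u, ← mul_assoc u, ← sgn_comm hκ u, pow_succ]
        simp only [mul_assoc]
    have hk := eps_pow hκ n
    refine ⟨s * κ ^ n * η, sgn_mul (sgn_mul hs hk) hη, ?_⟩
    calc e * u ^ (n + 1) = (e * u ^ n) * u := by rw [pow_succ, mul_assoc]
      _ = s * (e * (v ^ n * u)) := by rw [ih]; simp only [mul_assoc]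
      _ = s * κ ^ n * (e * u * v ^ n) := by
          rw [hvn, ← mul_assoc e, ← mul_assoc e, ← sgn_comm hk]; simp only [mul_assoc]
      _ = _ := by rw [h, pow_succ']; simp only [mul_assoc]

lemma y0 (G : GD d hr ht x xb) (a ε : ℕ) : ∃ s : A, (s = 1 ∨ s = -1) ∧
    (d.cb ⟨0, ht⟩ ^ ε * xb ⟨0, ht⟩ ^ a) * d.e = s * ((x ⟨0, hr⟩ ^ a * d.c ⟨0, hr⟩ ^ ε) * d.e) := by
  obtain ⟨s, hs, e1⟩ := pow_e (u := x ⟨0, hr⟩) (v := xb ⟨0, ht⟩) (e := d.e) (η := -1) (κ := 1)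
    (Or.inr rfl) (Or.inl rfl) (by rw [G.x0e]; simp) (by rw [one_mul, G.xxb]) a
  obtain ⟨s', hs', e2⟩ := pow_e (u := d.c ⟨0, hr⟩) (v := d.cb ⟨0, ht⟩) (e := d.e) (η := 1) (κ := -1)
    (Or.inl rfl) (Or.inr rfl) (by rw [one_mul, d.c1_e]) (by
      rw [neg_one_mul, neg_mul, d.anti_ccb, neg_neg]) ε
  have hc : d.cb ⟨0, ht⟩ ^ ε * x ⟨0, hr⟩ ^ a = x ⟨0, hr⟩ ^ a * d.cb ⟨0, ht⟩ ^ ε :=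
    ((show Commute (d.cb ⟨0, ht⟩) (x ⟨0, hr⟩) from G.cbx _ _).pow_pow ε a).eq
  refine ⟨s * s', sgn_mul hs hs', ?_⟩
  calc _ = d.cb ⟨0, ht⟩ ^ ε * (xb ⟨0, ht⟩ ^ a * d.e) := by rw [mul_assoc]
    _ = s * ((d.cb ⟨0, ht⟩ ^ ε * x ⟨0, hr⟩ ^ a) * d.e) := by
        rw [e1, ← mul_assoc, ← sgn_comm hs]; simp only [mul_assoc]
    _ = s * (x ⟨0, hr⟩ ^ a * (d.cb ⟨0, ht⟩ ^ ε * d.e)) := by rw [hc, mul_assoc]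
    _ = _ := by rw [e2, ← mul_assoc (x _ ^ a), ← sgn_comm hs']; simp only [mul_assoc]

lemma e0 (G : GD d hr ht x xb) (a ε : ℕ) : ∃ s : A, (s = 1 ∨ s = -1) ∧
    d.e * (x ⟨0, hr⟩ ^ a * d.c ⟨0, hr⟩ ^ ε) = s * (d.e * (d.cb ⟨0, ht⟩ ^ ε * xb ⟨0, ht⟩ ^ a)) := by
  obtain ⟨s, hs, e1⟩ := e_pow (u := x ⟨0, hr⟩) (v := xb ⟨0, ht⟩) (e := d.e) (η := -1) (κ := 1)
    (Or.inr rfl) (Or.inl rfl) (by rw [G.ex0]; simp) (by rw [one_mul, G.xxb]) a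
  obtain ⟨s', hs', e2⟩ := e_pow (u := d.c ⟨0, hr⟩) (v := d.cb ⟨0, ht⟩) (e := d.e) (η := 1) (κ := -1)
    (Or.inl rfl) (Or.inr rfl) (by rw [one_mul, d.e_c1]) (by
      rw [neg_one_mul, neg_mul, d.anti_ccb, neg_neg]) ε
  have hc : d.c ⟨0, hr⟩ ^ ε * xb ⟨0, ht⟩ ^ a = xb ⟨0, ht⟩ ^ a * d.c ⟨0, hr⟩ ^ ε :=
    ((show Commute (d.c ⟨0, hr⟩) (xb ⟨0, ht⟩) from G.cxb _ _).pow_pow ε a).eq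
  refine ⟨s * s', sgn_mul hs hs', ?_⟩
  calc _ = d.e * x ⟨0, hr⟩ ^ a * d.c ⟨0, hr⟩ ^ ε := by rw [mul_assoc]
    _ = s * (d.e * (d.c ⟨0, hr⟩ ^ ε * xb ⟨0, ht⟩ ^ a)) := by
        rw [e1, hc]; simp only [mul_assoc]
    _ = s * ((d.e * d.c ⟨0, hr⟩ ^ ε) * xb ⟨0, ht⟩ ^ a) := by rw [mul_assoc d.e]
    _ = _ := by rw [e2]; simp only [mul_assoc]

lemma c_pow_red {c : A} {η : A} (h : c * c = η) (hη : η = 1 ∨ η = -1) (ε : ℕ) :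
    ∃ s : A, (s = 1 ∨ s = -1) ∧ (c ^ ε = s ∨ c ^ ε = s * c) := by
  induction ε with
  | zero => exact ⟨1, Or.inl rfl, Or.inl (by simp)⟩
  | succ ε ih =>
    obtain ⟨s, hs, h' | h'⟩ := ih
    · exact ⟨s, hs, Or.inr (by rw [pow_succ, h'])⟩
    · refine ⟨s * η, sgn_mul hs hη, Or.inl (by rw [pow_succ, h', mul_assoc, h])⟩

lemma exce (G : GD d hr ht x xb) (a : ℕ) :
    d.e * (x ⟨0, hr⟩ ^ a * d.c ⟨0, hr⟩) * d.e = 0 := by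
  cases a with
  | zero => simpa using d.e_c_e hr
  | succ a =>
    apply G.two
    set X := x ⟨0, hr⟩
    set Y := xb ⟨0, ht⟩
    set c := d.c ⟨0, hr⟩
    have hcX : c * X = -(X * c) := G.cx _
    have hcY : c * Y = Y * c := G.cxb _ _
    have hXY : Commute Y (X ^ a) := (show Commute Y X from (G.xxb _ _).symm).pow_right a
    have e1 : d.e * (X ^ (a + 1) * c) * d.e = -(d.e * X ^ a * c * Y * d.e) := by
      have h0 : d.e * X = -(d.e * Y) := G.ex0
      rw [pow_succ', ← mul_assoc, ← mul_assoc, h0, mul_assoc _ c Y, hcY]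
      simp only [neg_mul, mul_assoc]
      rw [← mul_assoc Y, hXY.eq]
      simp only [mul_assoc]
    have e2 : d.e * (X ^ (a + 1) * c) * d.e = (d.e * X ^ a * c * Y * d.e) := by
      rw [mul_assoc _ Y, G.x0e, pow_succ, mul_neg, ← mul_assoc _ X, mul_assoc _ c X, hcX]
      simp only [mul_neg, neg_mul, mul_assoc, neg_neg]
    nth_rewrite 1 [e1]
    rw [e2]
    simp

lemma exce' (G : GD d hr ht x xb) (a ε : ℕ) :
    d.e * (x ⟨0, hr⟩ ^ a * d.c ⟨0, hr⟩ ^ ε) * d.e = 0 := by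
  obtain ⟨s, hs, h | h⟩ := c_pow_red (d.c_sq ⟨0, hr⟩) (Or.inr rfl) ε
  · have h0 : d.e * x ⟨0, hr⟩ ^ a * d.e = 0 := by
      cases a with
      | zero => simpa using d.e_sq
      | succ a => exact G.exe a
    rw [h, ← mul_assoc, ← sgn_comm hs, mul_assoc, h0, mul_zero]
  · have h0 := G.exce a
    rw [h, ← mul_assoc (x _ ^ a), ← sgn_comm hs, mul_assoc s, ← mul_assoc d.e, ← sgn_comm hs,
      mul_assoc s, mul_assoc s, h0, mul_zero]

end GD

namespace WBC

variable {R A : Type} [CommRing R] [Ring A] [Algebra R A] {r t : ℕ}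

def PP (d : WBC R A r t) (x : Fin r → A) : Subalgebra R A :=
  Algebra.adjoin R (Set.range x ∪ Set.range d.c)

def QQ (d : WBC R A r t) (xb : Fin t → A) : Subalgebra R A :=
  Algebra.adjoin R (Set.range d.cb ∪ Set.range xb)

def NN (d : WBC R A r t) (x : Fin r → A) (xb : Fin t → A) (Ω : Subalgebra R A) : Submodule R A :=
  Submodule.span R {m | ∃ p ∈ d.PP x, ∃ z ∈ d.HH, ∃ q ∈ d.QQ xb, ∃ w ∈ Ω, m = p * z * q * w}

variable {d : WBC R A r t} {x : Fin r → A} {xb : Fin t → A} {Ω : Subalgebra R A}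

lemma x_PP (i) : x i ∈ d.PP x := Algebra.subset_adjoin (Or.inl ⟨i, rfl⟩)
lemma c_PP (i) : d.c i ∈ d.PP x := Algebra.subset_adjoin (Or.inr ⟨i, rfl⟩)
lemma cb_QQ (i) : d.cb i ∈ d.QQ xb := Algebra.subset_adjoin (Or.inl ⟨i, rfl⟩)
lemma xb_QQ (i) : xb i ∈ d.QQ xb := Algebra.subset_adjoin (Or.inr ⟨i, rfl⟩)

lemma sgn_mem {s : A} (hs : s = 1 ∨ s = -1) (S : Subalgebra R A) : s ∈ S := by
  rcases hs with rfl | rfl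
  · exact one_mem S
  · exact neg_mem (one_mem S)

lemma mem_NN {p z q w : A} (hp : p ∈ d.PP x) (hz : z ∈ d.HH) (hq : q ∈ d.QQ xb) (hw : w ∈ Ω) :
    p * z * q * w ∈ d.NN x xb Ω :=
  Submodule.subset_span ⟨p, hp, z, hz, q, hq, w, hw, rfl⟩

lemma NN_closed (y : A)
    (h : ∀ p ∈ d.PP x, ∀ g f k, f ≤ min r t → ∀ q ∈ d.QQ xb, ∀ w ∈ Ω,
      y * p * (d.tau g * d.epow f * d.tau k) * (q * w) ∈ d.NN x xb Ω) :
    ∀ m ∈ d.NN x xb Ω, y * m ∈ d.NN x xb Ω := by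
  apply span_mul_left
  rintro _ ⟨p, hp, z, hz, q, hq, w, hw, rfl⟩
  have : y * (p * z * q * w) = (y * p) * z * (q * w) := by simp only [mul_assoc]
  rw [this]
  refine span_induction_mul ?_ z hz
  rintro _ ⟨g, f, k, hf, rfl⟩
  exact h p hp g f k hf q hq w hw

lemma NN_PP (y : A) (hy : y ∈ d.PP x) : ∀ m ∈ d.NN x xb Ω, y * m ∈ d.NN x xb Ω := by
  apply NN_closed
  intro p hp g f k hf q hq w hw
  rw [← mul_assoc]
  exact mem_NN (mul_mem hy hp) (d.mem_HH g f k hf) hq hw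

end WBC

namespace GD

open WBC

variable {R A : Type} [CommRing R] [Ring A] [Algebra R A] {r t : ℕ} {d : WBC R A r t}
    {hr : 0 < r} {ht : 0 < t} {x : Fin r → A} {xb : Fin t → A} {Ω : Subalgebra R A}

lemma NN_tau (G : GD d hr ht x xb) (u) : ∀ m ∈ d.NN x xb Ω, d.tau u * m ∈ d.NN x xb Ω := by
  apply NN_closed
  intro p hp g f k hf q hq w hw
  obtain ⟨p', hp', e⟩ := adjoin_move (R := R) (Set.range x ∪ Set.range d.c) (d.tau u) (by
    rintro _ (⟨i, rfl⟩ | ⟨i, rfl⟩)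
    · exact ⟨_, x_PP (d := d) (u.1 i), G.tx u i⟩
    · exact ⟨_, c_PP (d := d) (u.1 i), d.tau_c u i⟩) p hp
  have := mem_NN (Ω := Ω) hp' (d.mem_HH (u * g) f k hf) hq hw
  rw [e]
  simpa only [map_mul, mul_assoc] using this

lemma NN_omega (hΩ : ∀ w ∈ Ω, ∀ a, w * a = a * w) (u) (hu : u ∈ Ω) :
    ∀ m ∈ d.NN x xb Ω, u * m ∈ d.NN x xb Ω := by
  apply NN_closed
  intro p hp g f k hf q hq w hw
  have := mem_NN hp (d.mem_HH g f k hf) hq (mul_mem hw hu)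
  have e : u * p * (d.tau g * d.epow f * d.tau k) * (q * w) =
      p * (d.tau g * d.epow f * d.tau k) * q * (w * u) := by
    rw [mul_assoc u, mul_assoc u, hΩ u hu]
    simp only [mul_assoc]
  rwa [e]

lemma NN_yb {y : Fin r → A} {yb : Fin t → A} {s : A}
    (hs : s = 1 ∨ s = -1) (hr : 0 < r) (ht : 0 < t)
    (ty : ∀ g i, d.tau g * y i = y (g.1 i) * d.tau g)
    (tyb : ∀ g j, d.tau g * yb j = yb (g.2 j) * d.tau g)
    (h0 : yb ⟨0, ht⟩ * d.e = s * (y ⟨0, hr⟩ * d.e))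
    (h0' : ∀ j, j ≠ ⟨0, ht⟩ → d.e * yb j = yb j * d.e)
    (hy : ∀ i, y i ∈ d.PP x) (hyb : ∀ j, yb j ∈ d.QQ xb) (j)
    (hm : ∀ p ∈ d.PP x, ∃ u ∈ d.PP x, yb j * p = u * yb j) :
    ∀ m ∈ d.NN x xb Ω, yb j * m ∈ d.NN x xb Ω := by
  apply NN_closed
  intro p hp g f k hf q hq w hw
  obtain ⟨u, hu, e⟩ := hm p hp
  rw [e, mul_assoc u]
  rcases d.push hr ht hs ty tyb h0 h0' j g f k hf with ⟨hlt, e1⟩ | ⟨l, e1⟩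
  · rw [e1]
    have := mem_NN (mul_mem (mul_mem hu (sgn_mem (R := R) hs _)) (hy (g.1 ⟨(g.2⁻¹ j : Fin t).val, by omega⟩)))
      (d.mem_HH g f k hf) hq hw
    simpa only [mul_assoc] using this
  · rw [e1]
    have := mem_NN hu (d.mem_HH g f k hf) (mul_mem (hyb l) hq) hw
    simpa only [mul_assoc] using this

lemma NN_cb (G : GD d hr ht x xb) (j) : ∀ m ∈ d.NN x xb Ω, d.cb j * m ∈ d.NN x xb Ω := by
  apply NN_yb (s := 1) (Or.inl rfl) hr ht d.tau_c d.tau_cb (by rw [one_mul, d.c1_e])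
    (fun j hj => (d.cb_e_comm j (fun h => hj (Fin.ext h))).symm) c_PP cb_QQ
  apply adjoin_move
  rintro _ (⟨i, rfl⟩ | ⟨i, rfl⟩)
  · exact ⟨_, x_PP (d := d) i, G.cbx _ _⟩
  · exact ⟨_, neg_mem (c_PP (d := d) i), by rw [neg_mul, d.anti_ccb, neg_neg]⟩

lemma NN_xb (G : GD d hr ht x xb) (j) : ∀ m ∈ d.NN x xb Ω, xb j * m ∈ d.NN x xb Ω := by
  apply NN_yb (s := -1) (Or.inr rfl) hr ht G.tx G.txb (by rw [neg_one_mul, G.x0e])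
    G.exb x_PP xb_QQ
  apply adjoin_move
  rintro _ (⟨i, rfl⟩ | ⟨i, rfl⟩)
  · exact ⟨_, x_PP (d := d) i, (G.xxb _ _).symm⟩
  · exact ⟨_, c_PP (d := d) i, (G.cxb _ _).symm⟩

lemma PP_split (G : GD d hr ht x xb) : Subalgebra.toSubmodule (d.PP x) ≤
    Submodule.span R {m | ∃ p ∈ d.PP x, d.e * p = p * d.e ∧ ∃ a ε : ℕ,
      m = p * (x ⟨0, hr⟩ ^ a * d.c ⟨0, hr⟩ ^ ε)} := by
  apply adjoin_le_right
  · exact Submodule.subset_span ⟨1, one_mem _, by simp, 0, 0, by simp⟩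
  · intro y hy m hm
    have h := span_induction_mul (R := R) (a := 1) (b := y) (M := Submodule.span R
      {m | ∃ p ∈ d.PP x, d.e * p = p * d.e ∧ ∃ a ε : ℕ,
      m = p * (x ⟨0, hr⟩ ^ a * d.c ⟨0, hr⟩ ^ ε)}) ?_ m hm
    · rwa [one_mul] at h
    rintro _ ⟨p, hp, hpe, a, ε, rfl⟩
    rw [one_mul]
    rcases hy with ⟨i, rfl⟩ | ⟨i, rfl⟩
    · by_cases hi : i = ⟨0, hr⟩
      · subst hi
        have hc : x ⟨0, hr⟩ * d.c ⟨0, hr⟩ = (-1) * d.c ⟨0, hr⟩ * x ⟨0, hr⟩ := by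
          rw [neg_one_mul, neg_mul, G.cx, neg_neg]
        have h := skew_pow (Or.inr rfl) hc ε
        have hs := eps_pow (A := A) (ε := -1) (Or.inr rfl) ε
        set s := (-1 : A) ^ ε
        have hss : s * s = 1 := by rcases hs with h | h <;> simp [h]
        refine Submodule.subset_span ⟨p * s, mul_mem hp (sgn_mem hs _), ?_, a + 1, ε, ?_⟩
        · rw [← mul_assoc, hpe, mul_assoc, mul_assoc, sgn_comm hs]
        · have : d.c ⟨0, hr⟩ ^ ε * x ⟨0, hr⟩ = s * (x ⟨0, hr⟩ * d.c ⟨0, hr⟩ ^ ε) := by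
            rw [h, ← mul_assoc, ← mul_assoc, hss, one_mul]
          calc p * (x ⟨0, hr⟩ ^ a * d.c ⟨0, hr⟩ ^ ε) * x ⟨0, hr⟩
              = p * (x ⟨0, hr⟩ ^ a * (d.c ⟨0, hr⟩ ^ ε * x ⟨0, hr⟩)) := by simp only [mul_assoc]
            _ = p * ((x ⟨0, hr⟩ ^ a * s) * (x ⟨0, hr⟩ * d.c ⟨0, hr⟩ ^ ε)) := by
                rw [this]; simp only [mul_assoc]
            _ = _ := by rw [← sgn_comm hs, pow_succ]; simp only [mul_assoc]
      · refine Submodule.subset_span ⟨p * x i, mul_mem hp (x_PP i), ?_, a, ε, ?_⟩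
        · rw [← mul_assoc, hpe, mul_assoc, G.ex i hi, mul_assoc]
        · have h1 : Commute (d.c ⟨0, hr⟩) (x i) := G.cx' _ _ (Ne.symm hi)
          have h2 : Commute (x ⟨0, hr⟩) (x i) := G.xx _ _
          have h3 := ((h2.pow_left a).mul_left (h1.pow_left ε)).eq
          rw [mul_assoc, h3, mul_assoc]
    · by_cases hi : i = ⟨0, hr⟩
      · subst hi
        refine Submodule.subset_span ⟨p, hp, hpe, a, ε + 1, ?_⟩
        rw [pow_succ]
        simp only [mul_assoc]
      · have hc : d.c i * d.c ⟨0, hr⟩ = (-1) * d.c ⟨0, hr⟩ * d.c i := by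
          rw [neg_one_mul, neg_mul, d.c_anti _ _ hi]
        have h := skew_pow (Or.inr rfl) hc ε
        have hs := eps_pow (A := A) (ε := -1) (Or.inr rfl) ε
        set s := (-1 : A) ^ ε
        have hss : s * s = 1 := by rcases hs with h | h <;> simp [h]
        refine Submodule.subset_span ⟨p * s * d.c i,
          mul_mem (mul_mem hp (sgn_mem hs _)) (c_PP i), ?_, a, ε, ?_⟩
        · have hci := d.c_e_comm i (fun h => hi (Fin.ext h))
          rw [mul_assoc _ _ d.e, hci, ← mul_assoc, ← mul_assoc, hpe, mul_assoc p d.e, ← sgn_comm hs]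
          simp only [mul_assoc]
        · have : d.c ⟨0, hr⟩ ^ ε * d.c i = s * (d.c i * d.c ⟨0, hr⟩ ^ ε) := by
            rw [h, ← mul_assoc, ← mul_assoc, hss, one_mul]
          have hx : d.c i * x ⟨0, hr⟩ ^ a = x ⟨0, hr⟩ ^ a * d.c i :=
            ((show Commute (d.c i) (x ⟨0, hr⟩) from G.cx' _ _ hi).pow_right a).eq
          calc p * (x ⟨0, hr⟩ ^ a * d.c ⟨0, hr⟩ ^ ε) * d.c i
              = p * (x ⟨0, hr⟩ ^ a * (d.c ⟨0, hr⟩ ^ ε * d.c i)) := by simp only [mul_assoc]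
            _ = p * ((x ⟨0, hr⟩ ^ a * s) * (d.c i * d.c ⟨0, hr⟩ ^ ε)) := by
                rw [this]; simp only [mul_assoc]
            _ = p * s * ((x ⟨0, hr⟩ ^ a * d.c i) * d.c ⟨0, hr⟩ ^ ε) := by
                rw [← sgn_comm hs]; simp only [mul_assoc]
            _ = _ := by rw [← hx]; simp only [mul_assoc]

lemma y_commute_e (G : GD d hr ht x xb) (i : Fin r) (hi : i ≠ ⟨0, hr⟩) (a ε : ℕ) :
    d.e * (x i ^ a * d.c i ^ ε) = (x i ^ a * d.c i ^ ε) * d.e := by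
  have h1 : Commute d.e (x i) := G.ex i hi
  have h2 : Commute d.e (d.c i) := (d.c_e_comm i (fun h => hi (Fin.ext h))).symm
  exact ((h1.pow_right a).mul_right (h2.pow_right ε)).eq

lemma yb_commute_e (G : GD d hr ht x xb) (i : Fin t) (hi : i ≠ ⟨0, ht⟩) (a ε : ℕ) :
    d.e * (d.cb i ^ ε * xb i ^ a) = (d.cb i ^ ε * xb i ^ a) * d.e := by
  have h1 : Commute d.e (xb i) := G.exb i hi
  have h2 : Commute d.e (d.cb i) := (d.cb_e_comm i (fun h => hi (Fin.ext h))).symm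
  exact ((h2.pow_right ε).mul_right (h1.pow_right a)).eq

lemma e_y_z (G : GD d hr ht x xb) (a ε : ℕ) (g f k) (hf : f ≤ min r t) :
    ∃ u ∈ d.PP x, ∃ z ∈ d.HH, ∃ v ∈ d.QQ xb,
      d.e * (x ⟨0, hr⟩ ^ a * d.c ⟨0, hr⟩ ^ ε) * (d.tau g * d.epow f * d.tau k) = u * z * v := by
  obtain ⟨s, hs, h1⟩ := G.y0 a ε
  obtain ⟨s', hs', h2⟩ := G.e0 a ε
  have hez := d.e_mem_HH hr ht g f k hf
  rcases d.push hr ht (y := fun i => x i ^ a * d.c i ^ ε) (yb := fun i => d.cb i ^ ε * xb i ^ a)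
    hs (G.ty a ε) (G.tyb a ε) h1 (fun j hj => G.yb_commute_e j hj a ε) ⟨0, ht⟩ g f k hf with
    ⟨hlt, e1⟩ | ⟨l, e1⟩
  · set q := g.2⁻¹ ⟨0, ht⟩ with hq
    have hq0 : g.2 q = ⟨0, ht⟩ := by simp [hq]
    set p : Fin r := ⟨q, by omega⟩ with hp
    by_cases hpq : g.1 p = ⟨0, hr⟩
    · obtain ⟨w, hw⟩ := d.epow_left hr ht f (by omega) (by omega) q hlt
      refine ⟨0, zero_mem _, 0, zero_mem _, 0, zero_mem _, ?_⟩
      have e3 := d.tau_ee hr ht g p q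
      rw [hpq, hq0, d.ee_zero] at e3
      have e4 : d.epow f = d.ee hr ht p q * w := hw
      rw [e4, ← mul_assoc (d.tau g), e3]
      simp only [← mul_assoc]
      have e5 := G.exce' a ε
      simp only [← mul_assoc] at e5
      rw [e5]
      simp
    · refine ⟨s' * s * (x (g.1 p) ^ a * d.c (g.1 p) ^ ε),
        mul_mem (sgn_mem (sgn_mul hs' hs) _)
          (mul_mem (pow_mem (x_PP _) _) (pow_mem (c_PP _) _)), _, hez, 1, one_mem _, ?_⟩
      rw [mul_one, h2, mul_assoc, mul_assoc, e1, ← mul_assoc d.e s, ← sgn_comm hs,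
        mul_assoc s d.e, ← mul_assoc d.e _ (_ * _), G.y_commute_e _ hpq]
      simp only [mul_assoc]
  · refine ⟨s', sgn_mem hs' _, _, hez, d.cb l ^ ε * xb l ^ a,
      mul_mem (pow_mem (cb_QQ _) _) (pow_mem (xb_QQ _) _), ?_⟩
    rw [h2, mul_assoc, mul_assoc, e1]
    simp only [mul_assoc]

lemma NN_e (G : GD d hr ht x xb) : ∀ m ∈ d.NN x xb Ω, d.e * m ∈ d.NN x xb Ω := by
  apply NN_closed
  intro p hp g f k hf q hq w hw
  rw [mul_assoc _ _ (q * w)]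
  refine span_induction_mul ?_ p (G.PP_split hp)
  rintro _ ⟨p', hp', hpe, a, ε, rfl⟩
  obtain ⟨u, hu, z, hz, v, hv, e⟩ := G.e_y_z a ε g f k hf
  have h := mem_NN (mul_mem hp' hu) hz (mul_mem hv hq) hw
  have : d.e * (p' * (x ⟨0, hr⟩ ^ a * d.c ⟨0, hr⟩ ^ ε)) *
      ((d.tau g * d.epow f * d.tau k) * (q * w)) = p' * u * z * (v * q) * w := by
    calc _ = p' * (d.e * (x ⟨0, hr⟩ ^ a * d.c ⟨0, hr⟩ ^ ε) * (d.tau g * d.epow f * d.tau k)) *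
          (q * w) := by
          rw [← mul_assoc d.e p', hpe]; simp only [mul_assoc]
      _ = _ := by rw [e]; simp only [mul_assoc]
  rwa [this]

/-- generators of the graded algebra -/
def gens (d : WBC R A r t) (x : Fin r → A) (xb : Fin t → A) (Ω : Subalgebra R A) : Set A :=
  {y | (∃ g, y = d.tau g) ∨ (∃ i, y = d.c i) ∨ (∃ i, y = d.cb i) ∨ y = d.e ∨
    (∃ i, y = x i) ∨ (∃ i, y = xb i) ∨ y ∈ Ω}

lemma NN_top (G : GD d hr ht x xb) (hΩ : ∀ w ∈ Ω, ∀ a, w * a = a * w)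
    (hgen : Algebra.adjoin R (gens d x xb Ω) = ⊤) : d.NN x xb Ω = ⊤ := by
  rw [eq_top_iff, ← Algebra.top_toSubmodule, ← hgen]
  apply adjoin_le_left
  · have h0 : (1 : A) ∈ d.HH := by
      have := d.mem_HH 1 0 1 (Nat.zero_le _)
      simpa [d.epow_zero] using this
    simpa using mem_NN (one_mem (d.PP x)) h0 (one_mem (d.QQ xb)) (one_mem Ω)
  · rintro y (⟨g, rfl⟩ | ⟨i, rfl⟩ | ⟨i, rfl⟩ | rfl | ⟨i, rfl⟩ | ⟨i, rfl⟩ | hy)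
    · exact G.NN_tau g
    · exact NN_PP _ (c_PP i)
    · exact G.NN_cb i
    · exact G.NN_e
    · exact NN_PP _ (x_PP i)
    · exact G.NN_xb i
    · exact NN_omega hΩ y hy

lemma PP_le (G : GD d hr ht x xb) : Subalgebra.toSubmodule (d.PP x) ≤
    Submodule.span R (Set.range fun α : Fin r → ℕ =>
        ((List.finRange r).map (fun k => x k ^ α k)).prod) *
      Submodule.span R (Set.range d.cpow) := by
  refine (adjoin_union_le ?_).trans (mul_le_mul' (adjoin_le_ordered x ?_)
    (adjoin_le_ordered2 d.c ?_ ?_))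
  · rintro _ ⟨i, rfl⟩ _ ⟨j, rfl⟩
    by_cases h : i = j
    · subst h
      exact ⟨-1, Or.inr rfl, by rw [G.cx]; simp⟩
    · exact ⟨1, Or.inl rfl, by rw [G.cx' _ _ h]; simp⟩
  · intro i j _
    exact ⟨1, Or.inl rfl, by rw [G.xx]; simp⟩
  · intro i j h
    exact ⟨-1, Or.inr rfl, by rw [d.c_anti _ _ h]; simp⟩
  · intro i
    exact Or.inr (d.c_sq i)

lemma QQ_le (G : GD d hr ht x xb) : Subalgebra.toSubmodule (d.QQ xb) ≤
      Submodule.span R (Set.range d.cbpow) *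
    Submodule.span R (Set.range fun α : Fin t → ℕ =>
        ((List.finRange t).map (fun k => xb k ^ α k)).prod) := by
  refine (adjoin_union_le ?_).trans (mul_le_mul' 
    (adjoin_le_ordered2 d.cb ?_ ?_) (adjoin_le_ordered xb ?_))
  · rintro _ ⟨i, rfl⟩ _ ⟨j, rfl⟩
    by_cases h : i = j
    · subst h
      exact ⟨-1, Or.inr rfl, by rw [neg_one_mul, neg_mul, G.cbxb, neg_neg]⟩
    · exact ⟨1, Or.inl rfl, by rw [← G.cbxb' _ _ (Ne.symm h)]; simp⟩
  · intro i j h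
    exact ⟨-1, Or.inr rfl, by rw [d.cb_anti _ _ h]; simp⟩
  · intro i
    exact Or.inl (d.cb_sq i)
  · intro i j _
    exact ⟨1, Or.inl rfl, by rw [G.bb]; simp⟩

/-- standard monomials in the graded algebra -/
lemma main_span (G : GD d hr ht x xb) (hΩ : ∀ w ∈ Ω, ∀ a, w * a = a * w)
    (hgen : Algebra.adjoin R (gens d x xb Ω) = ⊤) :
    Submodule.span R {m | ∃ (α : Fin r → ℕ) (i : BCIndex r t) (β : Fin t → ℕ), ∃ w ∈ Ω,
      m = ((List.finRange r).map (fun k => x k ^ α k)).prod * d.basElt i *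
        ((List.finRange t).map (fun k => xb k ^ β k)).prod * w} = ⊤ := by
  rw [eq_top_iff, ← G.NN_top hΩ hgen]
  apply Submodule.span_le.mpr
  rintro _ ⟨p, hp, z, hz, q, hq, w, hw, rfl⟩
  have hp := G.PP_le hp
  have hq := G.QQ_le hq
  have hwm : w ∈ Submodule.span R (Ω : Set A) := Submodule.subset_span hw
  have := Submodule.mul_mem_mul (Submodule.mul_mem_mul (Submodule.mul_mem_mul hp hz) hq) hwm
  simp only [HH, Submodule.span_mul_span] at this
  refine Submodule.span_mono ?_ this
  rintro _ ⟨_, ⟨_, ⟨_, ⟨_, ⟨α, rfl⟩, _, ⟨γ, rfl⟩, rfl⟩, _, ⟨g, f, k, hf, rfl⟩, rfl⟩, _,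
    ⟨_, ⟨δ, rfl⟩, _, ⟨β, rfl⟩, rfl⟩, rfl⟩, w, hw, rfl⟩
  obtain ⟨d1, d2, u, v, hu, hv, e⟩ := d.HH_basis g f k hf
  refine ⟨α, ⟨γ, δ, f, hf, d1, d2, u, v, hu, hv⟩, β, w, hw, ?_⟩
  simp only [e, WBC.basElt, mul_assoc]

end GD

/-- A ring filtration by submodules. -/
structure Filt (R A : Type) [CommRing R] [Ring A] [Algebra R A] where
  F : ℕ → Submodule R A
  mono : ∀ n, F n ≤ F (n + 1)
  one : (1 : A) ∈ F 0
  mul : ∀ {i j a b}, a ∈ F i → b ∈ F j → a * b ∈ F (i + j)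

namespace Filt

variable {R A : Type} [CommRing R] [Ring A] [Algebra R A] (T : Filt R A)

/-- The Rees algebra of the filtration. -/
def Re : Subalgebra R A[X] where
  carrier := {p | ∀ n, p.coeff n ∈ T.F n}
  mul_mem' := by
    intro p q hp hq n
    rw [Polynomial.coeff_mul]
    refine Submodule.sum_mem _ ?_
    intro x hx
    rw [Finset.HasAntidiagonal.mem_antidiagonal] at hx
    rw [← hx]
    exact T.mul (hp _) (hq _)
  add_mem' := by
    intro p q hp hq n
    rw [Polynomial.coeff_add]
    exact Submodule.add_mem _ (hp n) (hq n)
  algebraMap_mem' := by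
    intro c n
    rw [Polynomial.algebraMap_apply, Polynomial.coeff_C]
    split_ifs with h
    · subst h
      rw [Algebra.algebraMap_eq_smul_one]
      exact Submodule.smul_mem _ _ T.one
    · exact zero_mem _

/-- The two-sided ideal generated by the Rees parameter. -/
def II : Ideal T.Re where
  carrier := {p | p.1.coeff 0 = 0 ∧ ∀ n, p.1.coeff (n + 1) ∈ T.F n}
  add_mem' := by
    rintro p q ⟨h1, h2⟩ ⟨h3, h4⟩
    refine ⟨by simp [h1, h3], fun n => ?_⟩
    simpa using Submodule.add_mem _ (h2 n) (h4 n)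
  zero_mem' := by simp
  smul_mem' := by
    rintro p q ⟨h1, h2⟩
    refine ⟨by simp [Polynomial.mul_coeff_zero, h1], fun n => ?_⟩
    simp only [smul_eq_mul, MulMemClass.coe_mul]
    rw [Polynomial.coeff_mul]
    refine Submodule.sum_mem _ ?_
    rintro ⟨i, j⟩ hx
    rw [Finset.HasAntidiagonal.mem_antidiagonal] at hx
    simp only at hx ⊢
    cases j with
    | zero => rw [h1, mul_zero]; exact zero_mem _
    | succ j =>
      have := T.mul (p.2 i) (h2 j)
      have e : i + j = n := by omega
      rwa [e] at this

instance : T.II.IsTwoSided where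
  mul_mem_of_left := by
    rintro p q ⟨h1, h2⟩
    refine ⟨by simp [Polynomial.mul_coeff_zero, h1], fun n => ?_⟩
    simp only [MulMemClass.coe_mul]
    rw [Polynomial.coeff_mul]
    refine Submodule.sum_mem _ ?_
    rintro ⟨i, j⟩ hx
    rw [Finset.HasAntidiagonal.mem_antidiagonal] at hx
    simp only at hx ⊢
    cases i with
    | zero => rw [h1, zero_mul]; exact zero_mem _
    | succ i =>
      have := T.mul (h2 i) (q.2 j)
      have e : i + j = n := by omega
      rwa [e] at this

/-- The associated graded algebra. -/
abbrev Gr : Type := T.Re ⧸ T.II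

lemma mon_mem {k : ℕ} {a : A} (h : a ∈ T.F k) : monomial k a ∈ T.Re := by
  intro n
  rw [Polynomial.coeff_monomial]
  split_ifs with h'
  · subst h'; exact h
  · exact zero_mem _

open Classical in
/-- The class in degree `k`. -/
def cl (k : ℕ) (a : A) : T.Gr :=
  if h : a ∈ T.F k then Ideal.Quotient.mk T.II ⟨monomial k a, T.mon_mem h⟩ else 0

lemma cl_eq {k : ℕ} {a : A} (h : a ∈ T.F k) :
    T.cl k a = Ideal.Quotient.mk T.II ⟨monomial k a, T.mon_mem h⟩ := dif_pos h

lemma cl_add {k : ℕ} {a b : A} (ha : a ∈ T.F k) (hb : b ∈ T.F k) :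
    T.cl k (a + b) = T.cl k a + T.cl k b := by
  rw [T.cl_eq ha, T.cl_eq hb, T.cl_eq (Submodule.add_mem _ ha hb), ← map_add]
  congr 1
  ext1
  simp

lemma cl_smul {k : ℕ} {a : A} (c : R) (ha : a ∈ T.F k) :
    T.cl k (c • a) = c • T.cl k a := by
  rw [T.cl_eq ha, T.cl_eq (Submodule.smul_mem _ c ha)]
  change _ = Ideal.Quotient.mk T.II (c • _)
  congr 1
  ext1
  exact (Polynomial.smul_monomial c k a).symm

lemma cl_neg {k : ℕ} {a : A} (ha : a ∈ T.F k) : T.cl k (-a) = - T.cl k a := by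
  have := T.cl_smul (-1) ha
  simpa using this

lemma cl_zero (k : ℕ) : T.cl k 0 = 0 := by
  have := T.cl_smul 0 (zero_mem (T.F k))
  simpa using this

lemma cl_mul {i j : ℕ} {a b : A} (ha : a ∈ T.F i) (hb : b ∈ T.F j) :
    T.cl i a * T.cl j b = T.cl (i + j) (a * b) := by
  rw [T.cl_eq ha, T.cl_eq hb, T.cl_eq (T.mul ha hb), ← map_mul]
  congr 1
  ext1
  simp [Polynomial.monomial_mul_monomial]

lemma cl_one : T.cl 0 1 = 1 := by
  rw [T.cl_eq T.one, ← map_one (Ideal.Quotient.mk T.II)]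
  congr 1

lemma cl_lower {k : ℕ} {a : A} (ha : a ∈ T.F k) : T.cl (k + 1) a = 0 := by
  rw [T.cl_eq (T.mono k ha), Ideal.Quotient.eq_zero_iff_mem]
  refine ⟨by simp [Polynomial.coeff_monomial], fun n => ?_⟩
  simp only [Polynomial.coeff_monomial]
  split_ifs with h
  · have : k = n := by omega
    subst this; exact ha
  · exact zero_mem _

lemma cl_alg (c : R) : T.cl 0 (algebraMap R A c) = algebraMap R T.Gr c := by
  rw [Algebra.algebraMap_eq_smul_one, T.cl_smul _ T.one, cl_one, Algebra.algebraMap_eq_smul_one]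

lemma cl_pow {i : ℕ} {a : A} (ha : a ∈ T.F i) (n : ℕ) :
    T.cl i a ^ n = T.cl (i * n) (a ^ n) ∧ a ^ n ∈ T.F (i * n) := by
  induction n with
  | zero => simpa [cl_one] using T.one
  | succ n ih =>
    have h := T.mul ih.2 ha
    rw [← pow_succ] at h
    refine ⟨?_, h⟩
    rw [pow_succ, ih.1, T.cl_mul ih.2 ha, pow_succ]
    rfl

/-- `g` is the class of `a` in some degree -/
def Hm (g : T.Gr) (a : A) : Prop := ∃ k, a ∈ T.F k ∧ g = T.cl k a

variable {T}

lemma Hm.mul {g h : T.Gr} {a b : A} (h1 : T.Hm g a) (h2 : T.Hm h b) : T.Hm (g * h) (a * b) := by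
  obtain ⟨i, ha, rfl⟩ := h1
  obtain ⟨j, hb, rfl⟩ := h2
  exact ⟨i + j, T.mul ha hb, T.cl_mul ha hb⟩

lemma Hm.one : T.Hm 1 1 := ⟨0, T.one, T.cl_one.symm⟩

lemma Hm.pow {g : T.Gr} {a : A} (h1 : T.Hm g a) (n : ℕ) : T.Hm (g ^ n) (a ^ n) := by
  induction n with
  | zero => simpa using Hm.one
  | succ n ih => rw [pow_succ, pow_succ]; exact ih.mul h1

lemma Hm.listProd {ι : Type} (l : List ι) (g : ι → T.Gr) (a : ι → A)
    (h : ∀ i ∈ l, T.Hm (g i) (a i)) : T.Hm (l.map g).prod (l.map a).prod := by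
  induction l with
  | nil => simpa using Hm.one
  | cons k l ih =>
    simp only [List.map_cons, List.prod_cons]
    exact (h k (by simp)).mul (ih (fun i hi => h i (by simp [hi])))

variable (T)

/-- Lifting spanning sets from the graded algebra. -/
lemma lift_span (S : Set A)
    (h : Submodule.span R {g | ∃ a ∈ S, T.Hm g a} = ⊤) (n : ℕ) :
    T.F n ≤ Submodule.span R S := by
  have key : ∀ g : T.Gr, ∃ p : T.Re, Ideal.Quotient.mk T.II p = g ∧
      ∀ n, p.1.coeff n ∈ Submodule.span R S := by
    intro g
    have hg : g ∈ Submodule.span R {g | ∃ a ∈ S, T.Hm g a} := by rw [h]; trivial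
    induction hg using Submodule.span_induction with
    | mem g hg =>
      obtain ⟨a, ha, k, hk, rfl⟩ := hg
      refine ⟨_, (T.cl_eq hk).symm, fun n => ?_⟩
      simp only [Polynomial.coeff_monomial]
      split_ifs
      · exact Submodule.subset_span ha
      · exact zero_mem _
    | zero => exact ⟨0, map_zero _, fun n => by simp⟩
    | add x y _ _ hx hy =>
      obtain ⟨p, rfl, hp⟩ := hx
      obtain ⟨q, rfl, hq⟩ := hy
      refine ⟨p + q, map_add _ _ _, fun n => ?_⟩
      simpa using Submodule.add_mem _ (hp n) (hq n)
    | smul c x _ hx =>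
      obtain ⟨p, rfl, hp⟩ := hx
      refine ⟨c • p, rfl, fun n => ?_⟩
      simpa using Submodule.smul_mem _ c (hp n)
  have step : ∀ n, ∀ a ∈ T.F n, ∃ s ∈ Submodule.span R S,
      (n = 0 ∧ a = s) ∨ ∃ m, n = m + 1 ∧ a - s ∈ T.F m := by
    intro n a ha
    obtain ⟨p, hp, hpS⟩ := key (T.cl n a)
    rw [T.cl_eq ha, eq_comm, Ideal.Quotient.eq] at hp
    obtain ⟨h1, h2⟩ := hp
    refine ⟨p.1.coeff n, hpS n, ?_⟩
    cases n with
    | zero =>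
      left
      refine ⟨rfl, ?_⟩
      simpa [sub_eq_zero] using h1
    | succ m =>
      right
      refine ⟨m, rfl, ?_⟩
      simpa using h2 m
  induction n with
  | zero =>
    intro a ha
    obtain ⟨s, hs, ⟨_, rfl⟩ | ⟨m, hm, _⟩⟩ := step 0 a ha
    · exact hs
    · omega
  | succ n ih =>
    intro a ha
    obtain ⟨s, hs, ⟨h0, _⟩ | ⟨m, hm, h'⟩⟩ := step (n + 1) a ha
    · omega
    · have : m = n := by omega
      subst this
      have := Submodule.add_mem _ (ih h') hs
      rwa [sub_add_cancel] at this

lemma adjoin_cl (S : Subalgebra R T.Gr) (h : ∀ n, ∀ a ∈ T.F n, T.cl n a ∈ S) : S = ⊤ := by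
  rw [eq_top_iff]
  rintro g -
  obtain ⟨p, rfl⟩ := Ideal.Quotient.mk_surjective g
  have e : p = ∑ n ∈ p.1.support, ⟨monomial n (p.1.coeff n), T.mon_mem (p.2 n)⟩ := by
    ext1
    rw [AddSubmonoidClass.coe_finsetSum]
    exact p.1.as_sum_support
  rw [e, map_sum]
  refine Subalgebra.sum_mem _ ?_
  intro n _
  rw [← T.cl_eq (p.2 n)]
  exact h n _ (p.2 n)

end Filt

section word

variable {R A : Type} [CommRing R] [Ring A] [Algebra R A]

/-- The filtration with `B` in degree `0` and `u`, `v` in degree `1`. -/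
def wF (B : Subalgebra R A) (u v : A) (n : ℕ) : Submodule R A :=
  Subalgebra.toSubmodule B * (Submodule.span R {1, u, v} * Subalgebra.toSubmodule B) ^ n

lemma BB (B : Subalgebra R A) : Subalgebra.toSubmodule B * Subalgebra.toSubmodule B =
    Subalgebra.toSubmodule B := by
  exact Subalgebra.isIdempotentElem_toSubmodule B

lemma wF_B (B : Subalgebra R A) (u v : A) (n : ℕ) :
    wF B u v n * Subalgebra.toSubmodule B = wF B u v n := by
  cases n with
  | zero => simp [wF, BB]
  | succ n => rw [wF, pow_succ, mul_assoc, mul_assoc, mul_assoc, BB]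

lemma wF_zero (B : Subalgebra R A) (u v : A) : wF B u v 0 = Subalgebra.toSubmodule B := by
  simp [wF]

lemma wF_succ (B : Subalgebra R A) (u v : A) (n : ℕ) : wF B u v (n + 1) =
    wF B u v n * (Submodule.span R {1, u, v} * Subalgebra.toSubmodule B) := by
  rw [wF, wF, pow_succ, mul_assoc]

lemma wF_add (B : Subalgebra R A) (u v : A) (i j : ℕ) :
    wF B u v i * wF B u v j = wF B u v (i + j) := by
  rw [wF, wF, wF, pow_add, ← mul_assoc, ← mul_assoc]
  congr 1
  exact wF_B B u v i

lemma B_one (B : Subalgebra R A) : (1 : A) ∈ Subalgebra.toSubmodule B := one_mem B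

/-- The word filtration. -/
def wFilt (B : Subalgebra R A) (u v : A) : Filt R A where
  F := wF B u v
  mono := by
    intro n a ha
    rw [wF_succ]
    have h1 : (1 : A) ∈ Submodule.span R {1, u, v} * Subalgebra.toSubmodule B := by
      have := Submodule.mul_mem_mul (M := Submodule.span R {1, u, v})
        (N := Subalgebra.toSubmodule B) (m := 1) (Submodule.subset_span (by simp)) (B_one B)
      rwa [one_mul] at this
    simpa using Submodule.mul_mem_mul ha h1
  one := by rw [wF_zero]; exact one_mem B
  mul := by
    intro i j a b ha hb
    rw [← wF_add]
    exact Submodule.mul_mem_mul ha hb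

variable (B : Subalgebra R A) (u v : A)

lemma w_zero {a : A} : a ∈ (wFilt B u v).F 0 ↔ a ∈ B := by
  change a ∈ wF B u v 0 ↔ _
  rw [wF_zero]; rfl

lemma w_gen {y : A} (hy : y ∈ ({1, u, v} : Set A)) : y ∈ (wFilt B u v).F 1 := by
  change y ∈ wF B u v 1
  rw [wF_succ, wF_zero]
  have := Submodule.mul_mem_mul (B_one B)
    (Submodule.mul_mem_mul (Submodule.subset_span (R := R) hy)
    (B_one B))
  simpa using this

lemma w_top (h : Algebra.adjoin R ((B : Set A) ∪ {u, v}) = ⊤) (a : A) :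
    ∃ n, a ∈ (wFilt B u v).F n := by
  have mono : ∀ n m, n ≤ m → (wFilt B u v).F n ≤ (wFilt B u v).F m :=
    fun n m hnm => monotone_nat_of_le_succ (wFilt B u v).mono hnm
  have ha : a ∈ Algebra.adjoin R ((B : Set A) ∪ {u, v}) := by rw [h]; trivial
  induction ha using Algebra.adjoin_induction with
  | mem x hx =>
    rcases hx with hx | hx
    · exact ⟨0, (w_zero B u v).mpr hx⟩
    · exact ⟨1, w_gen B u v (Or.inr hx)⟩
  | algebraMap c => exact ⟨0, (w_zero B u v).mpr (B.algebraMap_mem c)⟩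
  | add x y _ _ hx hy =>
    obtain ⟨n, hx⟩ := hx
    obtain ⟨m, hy⟩ := hy
    exact ⟨max n m, Submodule.add_mem _ (mono _ _ (le_max_left _ _) hx)
      (mono _ _ (le_max_right _ _) hy)⟩
  | mul x y _ _ hx hy =>
    obtain ⟨n, hx⟩ := hx
    obtain ⟨m, hy⟩ := hy
    exact ⟨n + m, (wFilt B u v).mul hx hy⟩

lemma w_adjoin_aux (T : Filt R A) (hF : T.F = wF B u v) (S : Subalgebra R T.Gr)
    (h0 : ∀ b ∈ B, T.cl 0 b ∈ S)
    (hu : T.cl 1 u ∈ S) (hv : T.cl 1 v ∈ S) : S = ⊤ := by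
  have hz : ∀ a, a ∈ T.F 0 ↔ a ∈ B := by
    intro a; rw [hF, wF_zero]; rfl
  have hg : ∀ y ∈ ({1, u, v} : Set A), y ∈ T.F 1 := by
    intro y hy
    rw [hF]; exact w_gen B u v hy
  apply T.adjoin_cl
  intro n
  induction n with
  | zero =>
    intro a ha
    exact h0 a ((hz a).mp ha)
  | succ n ih =>
    intro a ha
    have hT : ∀ y ∈ Submodule.span R ({1, u, v} : Set A), y ∈ T.F 1 ∧ T.cl 1 y ∈ S := by
      intro y hy
      induction hy using Submodule.span_induction with
      | mem y hy =>
        refine ⟨hg y hy, ?_⟩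
        rcases hy with rfl | rfl | rfl
        · rw [T.cl_lower T.one]; exact S.zero_mem
        · exact hu
        · exact hv
      | zero => exact ⟨Submodule.zero_mem _, by rw [Filt.cl_zero]; exact S.zero_mem⟩
      | add x y _ _ hx hy =>
        exact ⟨Submodule.add_mem _ hx.1 hy.1,
          by rw [Filt.cl_add _ hx.1 hy.1]; exact S.add_mem hx.2 hy.2⟩
      | smul c x _ hx =>
        exact ⟨Submodule.smul_mem _ c hx.1, by rw [Filt.cl_smul _ c hx.1]; exact S.smul_mem hx.2 c⟩
    have hTB : ∀ y ∈ Submodule.span R ({1, u, v} : Set A) * Subalgebra.toSubmodule B,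
        y ∈ T.F 1 ∧ T.cl 1 y ∈ S := by
      intro y hy
      refine Submodule.mul_induction_on hy (fun a ha b hb => ?_) (fun x y hx hy => ?_)
      · have hb0 := (hz b).mpr hb
        have h1 := hT a ha
        refine ⟨T.mul h1.1 hb0, ?_⟩
        have := T.cl_mul h1.1 hb0
        rw [Nat.add_zero] at this
        rw [← this]
        exact S.mul_mem h1.2 (h0 b hb)
      · exact ⟨Submodule.add_mem _ hx.1 hy.1,
          by rw [Filt.cl_add _ hx.1 hy.1]; exact S.add_mem hx.2 hy.2⟩
    have ha' : a ∈ wF B u v (n + 1) := by rw [← hF]; exact ha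
    rw [wF_succ, ← hF] at ha'
    have : a ∈ T.F (n + 1) ∧ T.cl (n + 1) a ∈ S := by
      refine Submodule.mul_induction_on ha' (fun a ha b hb => ?_) (fun x y hx hy => ?_)
      · have h1 := hTB b hb
        refine ⟨T.mul ha h1.1, ?_⟩
        rw [← T.cl_mul ha h1.1]
        exact S.mul_mem (ih a ha) h1.2
      · exact ⟨Submodule.add_mem _ hx.1 hy.1,
          by rw [Filt.cl_add _ hx.1 hy.1]; exact S.add_mem hx.2 hy.2⟩
    exact this.2

lemma w_adjoin (S : Subalgebra R (wFilt B u v).Gr) (h0 : ∀ b ∈ B, (wFilt B u v).cl 0 b ∈ S)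
    (hu : (wFilt B u v).cl 1 u ∈ S) (hv : (wFilt B u v).cl 1 v ∈ S) : S = ⊤ :=
  w_adjoin_aux B u v _ rfl S h0 hu hv

/-- The degree zero part as an algebra homomorphism. -/
def w0 : B →ₐ[R] (wFilt B u v).Gr where
  toFun b := (wFilt B u v).cl 0 b.1
  map_one' := (wFilt B u v).cl_one
  map_mul' a b := ((wFilt B u v).cl_mul ((w_zero B u v).mpr a.2) ((w_zero B u v).mpr b.2)).symm
  map_zero' := (wFilt B u v).cl_zero 0
  map_add' a b := (wFilt B u v).cl_add ((w_zero B u v).mpr a.2) ((w_zero B u v).mpr b.2)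
  commutes' c := (wFilt B u v).cl_alg c

end word

/-- Restriction of walled Brauer–Clifford data to a subalgebra. -/
def WBC.restrict {R A : Type} [CommRing R] [Ring A] [Algebra R A] {r t : ℕ} (d : WBC R A r t)
    (S : Subalgebra R A) (hσ : ∀ w, d.σ w ∈ S) (hσb : ∀ w, d.σb w ∈ S)
    (hc : ∀ i, d.c i ∈ S) (hcb : ∀ i, d.cb i ∈ S) (he : d.e ∈ S) : WBC R S r t where
  σ := { toFun := fun w => ⟨d.σ w, hσ w⟩
         map_one' := Subtype.ext (map_one d.σ)
         map_mul' := fun a b => Subtype.ext (map_mul d.σ a b) }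
  σb := { toFun := fun w => ⟨d.σb w, hσb w⟩
          map_one' := Subtype.ext (map_one d.σb)
          map_mul' := fun a b => Subtype.ext (map_mul d.σb a b) }
  c := fun i => ⟨d.c i, hc i⟩
  cb := fun i => ⟨d.cb i, hcb i⟩
  e := ⟨d.e, he⟩
  c_sq i := Subtype.ext (d.c_sq i)
  c_anti i j h := Subtype.ext (d.c_anti i j h)
  c_conj i j := Subtype.ext (d.c_conj i j)
  cb_sq i := Subtype.ext (d.cb_sq i)
  cb_anti i j h := Subtype.ext (d.cb_anti i j h)
  cb_conj i j := Subtype.ext (d.cb_conj i j)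
  comm_σσb i j := Subtype.ext (d.comm_σσb i j)
  comm_σcb i j := Subtype.ext (d.comm_σcb i j)
  comm_σbc i j := Subtype.ext (d.comm_σbc i j)
  anti_ccb i j := Subtype.ext (d.anti_ccb i j)
  e_c1 i j := Subtype.ext (d.e_c1 i j)
  c1_e i j := Subtype.ext (d.c1_e i j)
  e_sq := Subtype.ext d.e_sq
  e_s_e h := Subtype.ext (d.e_s_e h)
  e_sb_e h := Subtype.ext (d.e_sb_e h)
  s_e_comm i h h' := Subtype.ext (d.s_e_comm i h h')
  sb_e_comm i h h' := Subtype.ext (d.sb_e_comm i h h')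
  braid1 h h' := Subtype.ext (d.braid1 h h')
  braid2 h h' := Subtype.ext (d.braid2 h h')
  c_e_comm i h := Subtype.ext (d.c_e_comm i h)
  cb_e_comm i h := Subtype.ext (d.cb_e_comm i h)
  e_c_e h := Subtype.ext (d.e_c_e h)
  e_cb_e h := Subtype.ext (d.e_cb_e h)

lemma map_eq1 {R A B : Type} [CommRing R] [Ring A] [Algebra R A] [Ring B] [Algebra R B]
    (φ : A →ₐ[R] B) {a b : A} (h : a = b) : φ a = φ b := by rw [h]

/-- Push forward of walled Brauer–Clifford data along an algebra homomorphism. -/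
def WBC.map {R A B : Type} [CommRing R] [Ring A] [Algebra R A] [Ring B] [Algebra R B]
    {r t : ℕ} (d : WBC R A r t) (φ : A →ₐ[R] B) : WBC R B r t where
  σ := (φ : A →* B).comp d.σ
  σb := (φ : A →* B).comp d.σb
  c := fun i => φ (d.c i)
  cb := fun i => φ (d.cb i)
  e := φ d.e
  c_sq i := by simpa only [map_mul, map_neg, map_one, map_zero] using map_eq1 φ (d.c_sq i)
  c_anti i j h := by
    simpa only [map_mul, map_neg, map_one, map_zero] using map_eq1 φ (d.c_anti i j h)
  c_conj i j := by
    have := map_eq1 φ (d.c_conj i j)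
    rw [map_mul, map_mul] at this; exact this
  cb_sq i := by simpa only [map_mul, map_neg, map_one, map_zero] using map_eq1 φ (d.cb_sq i)
  cb_anti i j h := by
    simpa only [map_mul, map_neg, map_one, map_zero] using map_eq1 φ (d.cb_anti i j h)
  cb_conj i j := by
    have := map_eq1 φ (d.cb_conj i j)
    rw [map_mul, map_mul] at this; exact this
  comm_σσb i j := by
    have := map_eq1 φ (d.comm_σσb i j)
    rw [map_mul, map_mul] at this; exact this
  comm_σcb i j := by
    have := map_eq1 φ (d.comm_σcb i j)
    rw [map_mul, map_mul] at this; exact this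
  comm_σbc i j := by
    have := map_eq1 φ (d.comm_σbc i j)
    rw [map_mul, map_mul] at this; exact this
  anti_ccb i j := by
    simpa only [map_mul, map_neg, map_one, map_zero] using map_eq1 φ (d.anti_ccb i j)
  e_c1 i j := by simpa only [map_mul, map_neg, map_one, map_zero] using map_eq1 φ (d.e_c1 i j)
  c1_e i j := by simpa only [map_mul, map_neg, map_one, map_zero] using map_eq1 φ (d.c1_e i j)
  e_sq := by simpa only [map_mul, map_neg, map_one, map_zero] using map_eq1 φ d.e_sq
  e_s_e h := by
    have := map_eq1 φ (d.e_s_e h)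
    rw [map_mul, map_mul] at this; exact this
  e_sb_e h := by
    have := map_eq1 φ (d.e_sb_e h)
    rw [map_mul, map_mul] at this; exact this
  s_e_comm i h h' := by
    have := map_eq1 φ (d.s_e_comm i h h')
    rw [map_mul, map_mul] at this; exact this
  sb_e_comm i h h' := by
    have := map_eq1 φ (d.sb_e_comm i h h')
    rw [map_mul, map_mul] at this; exact this
  braid1 h h' := by
    have := map_eq1 φ (d.braid1 h h')
    simp only [map_mul φ] at this; exact this
  braid2 h h' := by
    have := map_eq1 φ (d.braid2 h h')
    simp only [map_mul φ] at this; exact this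
  c_e_comm i h := by
    simpa only [map_mul, map_neg, map_one, map_zero] using map_eq1 φ (d.c_e_comm i h)
  cb_e_comm i h := by
    simpa only [map_mul, map_neg, map_one, map_zero] using map_eq1 φ (d.cb_e_comm i h)
  e_c_e h := by simpa only [map_mul, map_neg, map_one, map_zero] using map_eq1 φ (d.e_c_e h)
  e_cb_e h := by simpa only [map_mul, map_neg, map_one, map_zero] using map_eq1 φ (d.e_cb_e h)

section mapB
variable {R A B : Type} [CommRing R] [Ring A] [Algebra R A] [Ring B] [Algebra R B]
    {r t : ℕ} (d : WBC R A r t) (d' : WBC R B r t) (φ : A →ₐ[R] B) (h : WBCHom d d' φ)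

lemma map_basElt (h : WBCHom d d' φ) (i : BCIndex r t) : φ (d.basElt i) = d'.basElt i := by
  have hE : ∀ i j, φ (d.E i j) = d'.E i j := by
    intro i j
    simp only [WBC.E, map_mul φ, WBC.tr, WBC.trb, h.map_σ, h.map_σb, h.map_e]
  simp only [WBC.basElt, map_mul φ, WBC.cpow, WBC.cbpow, WBC.epow, h.map_σ, h.map_σb,
    map_list_prod, List.map_map, Function.comp_def, map_pow, h.map_c, h.map_cb, hE]

end mapB

/-- Restriction of affine walled Brauer–Clifford data to a subalgebra. -/
def AWBC.restrict {R A : Type} [CommRing R] [Ring A] [Algebra R A] {r t : ℕ} {ω1 : R}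
    (d : AWBC R A r t ω1)
    (S : Subalgebra R A) (hσ : ∀ w, d.σ w ∈ S) (hσb : ∀ w, d.σb w ∈ S)
    (hc : ∀ i, d.c i ∈ S) (hcb : ∀ i, d.cb i ∈ S) (he : d.e ∈ S) (hx : d.x1 ∈ S)
    (hxb : d.xb1 ∈ S) (ho : ∀ k, d.om k ∈ S) (hob : ∀ k, d.omb k ∈ S) : AWBC R S r t ω1 where
  toWBC := d.toWBC.restrict S hσ hσb hc hcb he
  x1 := ⟨d.x1, hx⟩
  xb1 := ⟨d.xb1, hxb⟩
  om k := ⟨d.om k, ho k⟩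
  omb k := ⟨d.omb k, hob k⟩
  om_one := Subtype.ext d.om_one
  om_even k := Subtype.ext (d.om_even k)
  omb_zero := Subtype.ext d.omb_zero
  om_comm k := by
    obtain ⟨h1, h2, h3, h4, h5, h6, h7, h8, h9⟩ := d.om_comm k
    exact ⟨fun _ => Subtype.ext (h1 _), fun _ => Subtype.ext (h2 _), fun _ => Subtype.ext (h3 _),
      fun _ => Subtype.ext (h4 _), Subtype.ext h5, Subtype.ext h6, Subtype.ext h7,
      fun _ => Subtype.ext (h8 _), fun _ => Subtype.ext (h9 _)⟩
  omb_comm k := by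
    obtain ⟨h1, h2, h3, h4, h5, h6, h7, h8⟩ := d.omb_comm k
    exact ⟨fun _ => Subtype.ext (h1 _), fun _ => Subtype.ext (h2 _), fun _ => Subtype.ext (h3 _),
      fun _ => Subtype.ext (h4 _), Subtype.ext h5, Subtype.ext h6, Subtype.ext h7,
      fun _ => Subtype.ext (h8 _)⟩
  x_comm h := Subtype.ext (d.x_comm h)
  x1_c1 h := Subtype.ext (d.x1_c1 h)
  x1_c i h := Subtype.ext (d.x1_c i h)
  s_x1 i h h' := Subtype.ext (d.s_x1 i h h')
  xb_comm h := Subtype.ext (d.xb_comm h)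
  xb1_cb1 h := Subtype.ext (d.xb1_cb1 h)
  xb1_cb i h := Subtype.ext (d.xb1_cb i h)
  sb_xb1 i h h' := Subtype.ext (d.sb_xb1 i h h')
  e_xsum := Subtype.ext d.e_xsum
  xsum_e := Subtype.ext d.xsum_e
  e_sxs h := Subtype.ext (d.e_sxs h)
  x_mixed h := Subtype.ext (d.x_mixed h)
  e_sbxbsb h := Subtype.ext (d.e_sbxbsb h)
  e_xodd k := Subtype.ext (d.e_xodd k)
  e_xeven k h := Subtype.ext (d.e_xeven k h)
  e_xb k h := Subtype.ext (d.e_xb k h)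
  x1_cb_comm j := Subtype.ext (d.x1_cb_comm j)
  xb1_c_comm j := Subtype.ext (d.xb1_c_comm j)
  x1_σb j := Subtype.ext (d.x1_σb j)
  xb1_σ j := Subtype.ext (d.xb1_σ j)

lemma acoef_mem {R A : Type} [CommRing R] [Ring A] [Algebra R A] (S : Subalgebra R A)
    (ω : ℕ → A) (h : ∀ k, ω k ∈ S) : ∀ n j, acoef ω n j ∈ S := by
  intro n
  induction n with
  | zero => intro j; rw [acoef]; exact S.neg_mem S.one_mem
  | succ n ih =>
    intro j
    cases j with
    | zero => rw [acoef]; exact S.sum_mem fun j _ => S.mul_mem (ih j) (h _)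
    | succ j => rw [acoef]; exact ih j

lemma acoef_val {R A : Type} [CommRing R] [Ring A] [Algebra R A] (S : Subalgebra R A)
    (ω : ℕ → S) : ∀ n j, ((acoef ω n j : S) : A) = acoef (fun k => (ω k : A)) n j := by
  intro n
  induction n with
  | zero => intro j; rw [acoef, acoef]; rfl
  | succ n ih =>
    intro j
    cases j with
    | zero =>
      rw [acoef, acoef, AddSubmonoidClass.coe_finset_sum]
      exact Finset.sum_congr rfl fun j _ => by rw [← ih j]; rfl
    | succ j => rw [acoef, acoef]; exact ih j

namespace AWBC
variable {R A : Type} [CommRing R] [Ring A] [Algebra R A] {r t : ℕ} {ω1 : R}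
    (d : AWBC R A r t ω1)

/-- Generators of the degree zero part. -/
def bg : Set A := {y | (∃ w, y = d.σ w) ∨ (∃ w, y = d.σb w) ∨ (∃ i, y = d.c i) ∨
  (∃ i, y = d.cb i) ∨ y = d.e ∨ ∃ k, y = d.om k}

/-- The subalgebra of degree zero. -/
def B0 : Subalgebra R A := Algebra.adjoin R d.bg

lemma σ_mem (w) : d.σ w ∈ d.B0 := Algebra.subset_adjoin (Or.inl ⟨w, rfl⟩)
lemma σb_mem (w) : d.σb w ∈ d.B0 := Algebra.subset_adjoin (Or.inr (Or.inl ⟨w, rfl⟩))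
lemma c_mem (w) : d.c w ∈ d.B0 := Algebra.subset_adjoin (Or.inr (Or.inr (Or.inl ⟨w, rfl⟩)))
lemma cb_mem (w) : d.cb w ∈ d.B0 :=
  Algebra.subset_adjoin (Or.inr (Or.inr (Or.inr (Or.inl ⟨w, rfl⟩))))
lemma e_mem : d.e ∈ d.B0 :=
  Algebra.subset_adjoin (Or.inr (Or.inr (Or.inr (Or.inr (Or.inl rfl)))))
lemma om_mem (k) : d.om k ∈ d.B0 :=
  Algebra.subset_adjoin (Or.inr (Or.inr (Or.inr (Or.inr (Or.inr ⟨k, rfl⟩)))))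

lemma gen_top (hu : d.IsUniversal36) :
    Algebra.adjoin R ((d.B0 : Set A) ∪ {d.x1, d.xb1}) = ⊤ := by
  set S := Algebra.adjoin R ((d.B0 : Set A) ∪ {d.x1, d.xb1}) with hS
  have hB : ∀ b ∈ d.B0, b ∈ S := fun b hb => Algebra.subset_adjoin (Or.inl hb)
  have hx : d.x1 ∈ S := Algebra.subset_adjoin (Or.inr (by simp))
  have hxb : d.xb1 ∈ S := Algebra.subset_adjoin (Or.inr (by simp))
  have ho : ∀ k, d.om k ∈ S := fun k => hB _ (d.om_mem k)
  have hob : ∀ k, d.omb k ∈ S := by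
    intro k
    rcases Nat.even_or_odd' k with ⟨n, rfl | rfl⟩
    · rw [hu.1.1]; exact S.zero_mem
    · rw [hu.1.2]
      exact S.sum_mem fun j _ => S.mul_mem (acoef_mem S _ ho _ _) (ho _)
  let d' := d.restrict S (fun w => hB _ (d.σ_mem w)) (fun w => hB _ (d.σb_mem w))
    (fun w => hB _ (d.c_mem w)) (fun w => hB _ (d.cb_mem w)) (hB _ d.e_mem) hx hxb ho hob
  have hA : d'.Ass36 := by
    refine ⟨fun n => Subtype.ext (hu.1.1 n), fun n => Subtype.ext ?_⟩
    rw [AddSubmonoidClass.coe_finset_sum]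
    refine (hu.1.2 n).trans (Finset.sum_congr rfl fun j _ => ?_)
    have := acoef_val S d'.om n j
    change _ = ((acoef d'.om n j : S) : A) * d.om (2 * j + 1)
    rw [this]; rfl
  obtain ⟨φ, hφ, -⟩ := hu.2 S d' hA
  obtain ⟨ψ, hψ, huniq⟩ := hu.2 A d hu.1
  have h1 : S.val.comp φ = ψ := huniq _
    { map_σ := fun w => congrArg S.val (hφ.map_σ w)
      map_σb := fun w => congrArg S.val (hφ.map_σb w)
      map_c := fun w => congrArg S.val (hφ.map_c w)
      map_cb := fun w => congrArg S.val (hφ.map_cb w)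
      map_e := congrArg S.val hφ.map_e
      map_x1 := congrArg S.val hφ.map_x1
      map_xb1 := congrArg S.val hφ.map_xb1
      map_om := fun w => congrArg S.val (hφ.map_om w)
      map_omb := fun w => congrArg S.val (hφ.map_omb w) }
  have h2 : AlgHom.id R A = ψ := huniq _
    ⟨fun _ => rfl, fun _ => rfl, fun _ => rfl, fun _ => rfl, rfl, rfl, rfl, fun _ => rfl,
      fun _ => rfl⟩
  rw [eq_top_iff]
  intro a _
  have : S.val (φ a) = a := by
    have := congrArg (fun f : A →ₐ[R] A => f a) (h1.trans h2.symm)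
    exact this
  rw [← this]
  exact (φ a).2

end AWBC

namespace WBC

variable {R A : Type} [CommRing R] [Ring A] [Algebra R A] {r t : ℕ}
variable (d : WBC R A r t)

lemma tau_conj_comm (g) {a b a' b' : A} (ha : d.tau g * a = a' * d.tau g)
    (hb : d.tau g * b = b' * d.tau g) (h : a * b = b * a) : a' * b' = b' * a' := by
  apply d.tau_cancel g
  rw [mul_assoc, ← hb, ← mul_assoc, ← ha, mul_assoc, h, ← mul_assoc, hb, mul_assoc, ha,
    mul_assoc]

lemma tau_conj_anti (g) {a b a' b' : A} (ha : d.tau g * a = a' * d.tau g)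
    (hb : d.tau g * b = b' * d.tau g) (h : a * b = -(b * a)) : a' * b' = -(b' * a') := by
  apply d.tau_cancel g
  rw [mul_assoc, ← hb, ← mul_assoc, ← ha, mul_assoc, h, mul_neg, ← mul_assoc, hb, mul_assoc, ha,
    neg_mul, mul_assoc]

end WBC

lemma GD.of {R A : Type} [CommRing R] [Ring A] [Algebra R A] {r t : ℕ} (d : WBC R A r t)
    (hr : 0 < r) (ht : 0 < t) (x : Fin r → A) (xb : Fin t → A)
    (tx : ∀ g i, d.tau g * x i = x (g.1 i) * d.tau g)
    (txb : ∀ g j, d.tau g * xb j = xb (g.2 j) * d.tau g)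
    (xx : ∀ h : 1 < r, x ⟨0, hr⟩ * x ⟨1, h⟩ = x ⟨1, h⟩ * x ⟨0, hr⟩)
    (bb : ∀ h : 1 < t, xb ⟨0, ht⟩ * xb ⟨1, h⟩ = xb ⟨1, h⟩ * xb ⟨0, ht⟩)
    (xxb : x ⟨0, hr⟩ * xb ⟨0, ht⟩ = xb ⟨0, ht⟩ * x ⟨0, hr⟩)
    (cx : d.c ⟨0, hr⟩ * x ⟨0, hr⟩ = -(x ⟨0, hr⟩ * d.c ⟨0, hr⟩))
    (cx' : ∀ h : 1 < r, d.c ⟨1, h⟩ * x ⟨0, hr⟩ = x ⟨0, hr⟩ * d.c ⟨1, h⟩)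
    (cbxb : d.cb ⟨0, ht⟩ * xb ⟨0, ht⟩ = -(xb ⟨0, ht⟩ * d.cb ⟨0, ht⟩))
    (cbxb' : ∀ h : 1 < t, d.cb ⟨1, h⟩ * xb ⟨0, ht⟩ = xb ⟨0, ht⟩ * d.cb ⟨1, h⟩)
    (cbx : d.cb ⟨0, ht⟩ * x ⟨0, hr⟩ = x ⟨0, hr⟩ * d.cb ⟨0, ht⟩)
    (cxb : d.c ⟨0, hr⟩ * xb ⟨0, ht⟩ = xb ⟨0, ht⟩ * d.c ⟨0, hr⟩)
    (ex : ∀ h : 1 < r, d.e * x ⟨1, h⟩ = x ⟨1, h⟩ * d.e)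
    (exb : ∀ h : 1 < t, d.e * xb ⟨1, h⟩ = xb ⟨1, h⟩ * d.e)
    (ex0 : d.e * x ⟨0, hr⟩ = -(d.e * xb ⟨0, ht⟩))
    (x0e : xb ⟨0, ht⟩ * d.e = -(x ⟨0, hr⟩ * d.e))
    (exe : ∀ a, d.e * x ⟨0, hr⟩ ^ (a + 1) * d.e = 0)
    (two : ∀ a : A, a + a = 0 → a = 0) : GD d hr ht x xb where
  xx i j := by
    by_cases h : i = j
    · rw [h]
    have h1 := one_lt_of_ne h
    obtain ⟨u, rfl, rfl⟩ := exists_perm_two h1 h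
    exact d.tau_conj_comm (u, 1) (tx _ _) (tx _ _) (xx _)
  bb i j := by
    by_cases h : i = j
    · rw [h]
    have h1 := one_lt_of_ne h
    obtain ⟨u, rfl, rfl⟩ := exists_perm_two h1 h
    exact d.tau_conj_comm (1, u) (txb _ _) (txb _ _) (bb _)
  xxb i j := by
    obtain ⟨u, rfl⟩ := exists_perm_one hr i
    obtain ⟨v, rfl⟩ := exists_perm_one ht j
    exact d.tau_conj_comm (u, v) (tx _ _) (txb _ _) xxb
  tx := tx
  txb := txb
  cx i := by
    obtain ⟨u, rfl⟩ := exists_perm_one hr i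
    exact d.tau_conj_anti (u, 1) (d.tau_c _ _) (tx _ _) cx
  cx' i j h := by
    have h1 := one_lt_of_ne h
    obtain ⟨u, rfl, rfl⟩ := exists_perm_two h1 (Ne.symm h)
    exact d.tau_conj_comm (u, 1) (d.tau_c _ _) (tx _ _) (cx' _)
  cbxb i := by
    obtain ⟨u, rfl⟩ := exists_perm_one ht i
    exact d.tau_conj_anti (1, u) (d.tau_cb _ _) (txb _ _) cbxb
  cbxb' i j h := by
    have h1 := one_lt_of_ne h
    obtain ⟨u, rfl, rfl⟩ := exists_perm_two h1 (Ne.symm h)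
    exact d.tau_conj_comm (1, u) (d.tau_cb _ _) (txb _ _) (cbxb' _)
  cbx j i := by
    obtain ⟨u, rfl⟩ := exists_perm_one hr i
    obtain ⟨v, rfl⟩ := exists_perm_one ht j
    exact d.tau_conj_comm (u, v) (d.tau_cb _ _) (tx _ _) cbx
  cxb i j := by
    obtain ⟨u, rfl⟩ := exists_perm_one hr i
    obtain ⟨v, rfl⟩ := exists_perm_one ht j
    exact d.tau_conj_comm (u, v) (d.tau_c _ _) (txb _ _) cxb
  ex i h := by
    have h1 := one_lt_of_ne h
    obtain ⟨u, h0, rfl⟩ := exists_perm_two h1 (Ne.symm h)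
    exact d.tau_conj_comm (u, 1) (d.tau_fix_e _ hr ht h0 rfl) (tx _ _) (ex _)
  exb i h := by
    have h1 := one_lt_of_ne h
    obtain ⟨u, h0, rfl⟩ := exists_perm_two h1 (Ne.symm h)
    exact d.tau_conj_comm (1, u) (d.tau_fix_e _ hr ht rfl h0) (txb _ _) (exb _)
  ex0 := ex0
  x0e := x0e
  exe := exe
  two := two

/-- Conjugates of an element commuting with a point stabiliser. -/
def conjX {A G : Type} [Ring A] [Group G] {n : ℕ} (τ : G →* A) (x1 : A) (u : Fin n → G)
    (i : Fin n) : A := τ (u i) * x1 * τ (u i)⁻¹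

lemma conjX_tau {A G : Type} [Ring A] [Group G] {n : ℕ} (act : G →* Equiv.Perm (Fin n))
    (τ : G →* A) (x1 : A) (o : Fin n)
    (hs : ∀ g, act g o = o → τ g * x1 = x1 * τ g) (u : Fin n → G) (hu : ∀ i, act (u i) o = i)
    (g : G) (i : Fin n) : τ g * conjX τ x1 u i = conjX τ x1 u (act g i) * τ g := by
  have hh := hs ((u (act g i))⁻¹ * g * u i) (by
    rw [map_mul, map_mul, Equiv.Perm.mul_apply, Equiv.Perm.mul_apply, hu, map_inv,
      Equiv.Perm.inv_eq_iff_eq, hu])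
  have e1 : g * u i = u (act g i) * ((u (act g i))⁻¹ * g * u i) := by group
  have e2 : ((u (act g i))⁻¹ * g * u i) * (u i)⁻¹ = (u (act g i))⁻¹ * g := by group
  unfold conjX
  rw [← mul_assoc, ← mul_assoc, ← map_mul, e1, map_mul, mul_assoc (τ (u (act g i))), hh,
    ← mul_assoc, mul_assoc _ (τ ((u (act g i))⁻¹ * g * u i)), ← map_mul, e2, map_mul, mul_assoc,
    mul_assoc, mul_assoc]

lemma conjX_zero {A G : Type} [Ring A] [Group G] {n : ℕ} (act : G →* Equiv.Perm (Fin n))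
    (τ : G →* A) (x1 : A) (o : Fin n)
    (hs : ∀ g, act g o = o → τ g * x1 = x1 * τ g) (u : Fin n → G) (hu : ∀ i, act (u i) o = i) :
    conjX τ x1 u o = x1 := by
  unfold conjX
  rw [hs _ (hu o), mul_assoc, ← map_mul]; simp

namespace AWBC
variable {R A : Type} [CommRing R] [Ring A] [Algebra R A] {r t : ℕ} {ω1 : R}
    (d : AWBC R A r t ω1) (hr : 0 < r) (ht : 0 < t)

lemma x1_stab (g : Equiv.Perm (Fin r) × Equiv.Perm (Fin t)) (h : g.1 ⟨0, hr⟩ = ⟨0, hr⟩) :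
    d.tau g * d.x1 = d.x1 * d.tau g := by
  obtain ⟨u, v⟩ := g
  have : d.σ u * d.x1 = d.x1 * d.σ u := by
    refine perm_fix_induction (f := 1) (fun w => d.σ w * d.x1 = d.x1 * d.σ w) (by simp) ?_ ?_ u ?_
    · intro a b ha hb
      rw [map_mul, mul_assoc, hb, ← mul_assoc, ha, mul_assoc]
    · intro i h1 h2
      exact d.s_x1 i h1 h2
    · intro i hi
      have : i = ⟨0, hr⟩ := Fin.ext (by simpa using hi)
      rw [this]; exact h
  rw [WBC.tau_mk, mul_assoc, d.x1_σb, ← mul_assoc, this, mul_assoc]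

lemma xb1_stab (g : Equiv.Perm (Fin r) × Equiv.Perm (Fin t)) (h : g.2 ⟨0, ht⟩ = ⟨0, ht⟩) :
    d.tau g * d.xb1 = d.xb1 * d.tau g := by
  obtain ⟨u, v⟩ := g
  have : d.σb v * d.xb1 = d.xb1 * d.σb v := by
    refine perm_fix_induction (f := 1) (fun w => d.σb w * d.xb1 = d.xb1 * d.σb w)
      (by simp) ?_ ?_ v ?_
    · intro a b ha hb
      rw [map_mul, mul_assoc, hb, ← mul_assoc, ha, mul_assoc]
    · intro i h1 h2
      exact d.sb_xb1 i h1 h2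
    · intro i hi
      have : i = ⟨0, ht⟩ := Fin.ext (by simpa using hi)
      rw [this]; exact h
  rw [WBC.tau_mk, mul_assoc, this, ← mul_assoc, d.xb1_σ, mul_assoc]

/-- The conjugate `X_i`. -/
def X : Fin r → A := conjX d.tau d.x1 (fun i => (Equiv.swap ⟨0, hr⟩ i, 1))

/-- The conjugate `X̄_i`. -/
def Xb : Fin t → A := conjX d.tau d.xb1 (fun i => (1, Equiv.swap ⟨0, ht⟩ i))

lemma X_tau (g i) : d.tau g * d.X hr i = d.X hr (g.1 i) * d.tau g :=
  conjX_tau (MonoidHom.fst (Equiv.Perm (Fin r)) (Equiv.Perm (Fin t))) d.tau d.x1 ⟨0, hr⟩ (fun g h => d.x1_stab hr g h)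
    (fun i => (Equiv.swap ⟨0, hr⟩ i, 1)) (fun i => by simp) g i

lemma Xb_tau (g i) : d.tau g * d.Xb ht i = d.Xb ht (g.2 i) * d.tau g :=
  conjX_tau (MonoidHom.snd (Equiv.Perm (Fin r)) (Equiv.Perm (Fin t))) d.tau d.xb1 ⟨0, ht⟩ (fun g h => d.xb1_stab ht g h)
    (fun i => (1, Equiv.swap ⟨0, ht⟩ i)) (fun i => by simp) g i

lemma X_zero : d.X hr ⟨0, hr⟩ = d.x1 :=
  conjX_zero (MonoidHom.fst (Equiv.Perm (Fin r)) (Equiv.Perm (Fin t))) d.tau d.x1 ⟨0, hr⟩ (fun g h => d.x1_stab hr g h)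
    (fun i => (Equiv.swap ⟨0, hr⟩ i, 1)) (fun i => by simp)

lemma Xb_zero : d.Xb ht ⟨0, ht⟩ = d.xb1 :=
  conjX_zero (MonoidHom.snd (Equiv.Perm (Fin r)) (Equiv.Perm (Fin t))) d.tau d.xb1 ⟨0, ht⟩ (fun g h => d.xb1_stab ht g h)
    (fun i => (1, Equiv.swap ⟨0, ht⟩ i)) (fun i => by simp)

lemma X_conj (u : Equiv.Perm (Fin r)) (i) : d.σ u * d.X hr i * d.σ u⁻¹ = d.X hr (u i) := by
  have := d.X_tau hr (u, 1) i
  rw [d.tau_left] at this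
  rw [this, mul_assoc, ← map_mul]; simp

lemma Xb_conj (u : Equiv.Perm (Fin t)) (i) : d.σb u * d.Xb ht i * d.σb u⁻¹ = d.Xb ht (u i) := by
  have := d.Xb_tau ht (1, u) i
  rw [d.tau_right] at this
  rw [this, mul_assoc, ← map_mul]; simp

lemma sw_inv (n a b : ℕ) : (sw n a b)⁻¹ = sw n a b := by
  unfold sw; split_ifs <;> simp

lemma xp_succ (n : ℕ) : d.xp (n + 2) = d.s (n + 1) * d.xp (n + 1) * d.s (n + 1) := by
  simp only [xp, Nat.add_sub_cancel, show n + 2 - 1 = n + 1 from rfl, List.range_succ,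
    List.reverse_append, List.map_append, List.prod_append, List.reverse_singleton,
    List.map_singleton, List.prod_singleton, mul_assoc]

lemma xbp_succ (n : ℕ) : d.xbp (n + 2) = d.sb (n + 1) * d.xbp (n + 1) * d.sb (n + 1) := by
  simp only [xbp, Nat.add_sub_cancel, show n + 2 - 1 = n + 1 from rfl, List.range_succ,
    List.reverse_append, List.map_append, List.prod_append, List.reverse_singleton,
    List.map_singleton, List.prod_singleton, mul_assoc]

lemma xp_eq (n : ℕ) (h : n < r) : d.xp (n + 1) = d.X hr ⟨n, h⟩ := by
  induction n with
  | zero => rw [X_zero]; simp [xp]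
  | succ n ih =>
    rw [xp_succ, ih (by omega)]
    have := d.X_conj hr (sw r n (n + 1)) ⟨n, by omega⟩
    rw [sw_inv] at this
    have h3 : sw r n (n + 1) ⟨n, by omega⟩ = ⟨n + 1, h⟩ := by
      rw [sw_eq (by omega) h, Equiv.swap_apply_left]
    rw [h3] at this
    exact this

lemma xbp_eq (n : ℕ) (h : n < t) : d.xbp (n + 1) = d.Xb ht ⟨n, h⟩ := by
  induction n with
  | zero => rw [Xb_zero]; simp [xbp]
  | succ n ih =>
    rw [xbp_succ, ih (by omega)]
    have := d.Xb_conj ht (sw t n (n + 1)) ⟨n, by omega⟩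
    rw [sw_inv] at this
    have h3 : sw t n (n + 1) ⟨n, by omega⟩ = ⟨n + 1, h⟩ := by
      rw [sw_eq (by omega) h, Equiv.swap_apply_left]
    rw [h3] at this
    exact this

lemma X_one (h : 1 < r) : d.X hr ⟨1, h⟩ = d.σ (sw r 0 1) * d.x1 * d.σ (sw r 0 1) := by
  rw [← xp_eq, xp_succ, xp_eq d hr 0 hr, X_zero]; rfl

lemma Xb_one (h : 1 < t) : d.Xb ht ⟨1, h⟩ = d.σb (sw t 0 1) * d.xb1 * d.σb (sw t 0 1) := by
  rw [← xbp_eq, xbp_succ, xbp_eq d ht 0 ht, Xb_zero]; rfl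

lemma L_mem (i : ℕ) : d.L i ∈ d.B0 := by
  have h1 : d.LL i ∈ d.B0 := d.B0.sum_mem fun j _ => d.σ_mem _
  have h2 : d.cn i ∈ d.B0 := by
    unfold WBC.cn; split_ifs
    · exact d.c_mem _
    · exact d.B0.zero_mem
  exact d.B0.add_mem h1 (d.B0.mul_mem (d.B0.mul_mem h2 h1) h2)

lemma Lb_mem (i : ℕ) : d.Lb i ∈ d.B0 := by
  have h1 : d.LLb i ∈ d.B0 := d.B0.sum_mem fun j _ => d.σb_mem _
  have h2 : d.cbn i ∈ d.B0 := by
    unfold WBC.cbn; split_ifs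
    · exact d.cb_mem _
    · exact d.B0.zero_mem
  exact d.B0.sub_mem h1 (d.B0.mul_mem (d.B0.mul_mem h2 h1) h2)

/-- The subalgebra generated by the `ω`s. -/
def W : Subalgebra R A := Algebra.adjoin R (Set.range d.om)

lemma om_central (hu : d.IsUniversal36) (k : ℕ) (a : A) : d.om k * a = a * d.om k := by
  have ha : a ∈ Algebra.adjoin R ((d.B0 : Set A) ∪ {d.x1, d.xb1}) := by
    rw [d.gen_top hu]; trivial
  have hle : Algebra.adjoin R ((d.B0 : Set A) ∪ {d.x1, d.xb1}) ≤
      Subalgebra.centralizer R {d.om k} := by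
    obtain ⟨h1, h2, h3, h4, h5, h6, h7, h8, h9⟩ := d.om_comm k
    refine Algebra.adjoin_le (Set.union_subset ?_ ?_)
    · refine Algebra.adjoin_le (S := Subalgebra.centralizer R {d.om k}) ?_
      intro y hy
      change y ∈ Subalgebra.centralizer R {d.om k}
      rw [Subalgebra.mem_centralizer_iff]
      rintro _ rfl
      rcases hy with ⟨w, rfl⟩ | ⟨w, rfl⟩ | ⟨w, rfl⟩ | ⟨w, rfl⟩ | rfl | ⟨w, rfl⟩
      exacts [h1 w, h2 w, h3 w, h4 w, h5, h8 w]
    · intro y hy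
      change y ∈ Subalgebra.centralizer R {d.om k}
      rw [Subalgebra.mem_centralizer_iff]
      rintro _ rfl
      rcases hy with rfl | rfl
      exacts [h6, h7]
  exact (Subalgebra.mem_centralizer_iff R).mp (hle ha) _ rfl

lemma W_central (hu : d.IsUniversal36) (w : A) (hw : w ∈ d.W) (a : A) : w * a = a * w := by
  have : d.W ≤ Subalgebra.center R A := by
    refine Algebra.adjoin_le ?_
    rintro _ ⟨k, rfl⟩
    change _ ∈ Subalgebra.center R A
    rw [Subalgebra.mem_center_iff]
    intro b
    exact (d.om_central hu k b).symm
  exact (Subalgebra.mem_center_iff.mp (this hw) a).symm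

lemma W_le_B0 : d.W ≤ d.B0 := by
  refine Algebra.adjoin_le ?_
  rintro _ ⟨k, rfl⟩
  exact d.om_mem k

lemma W_span (hu : d.IsUniversal36) (w : A) (hw : w ∈ d.W) :
    w ∈ Submodule.span R (Set.range d.ompow) := by
  let z : ℕ → Subalgebra.center R A := fun n => ⟨d.om (2 * n + 3),
    Subalgebra.mem_center_iff.mpr fun b => (d.om_central hu _ b).symm⟩
  let ψ : MvPolynomial ℕ R →ₐ[R] A := (Subalgebra.center R A).val.comp (MvPolynomial.aeval z)
  have hle : d.W ≤ ψ.range := by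
    refine Algebra.adjoin_le ?_
    rintro _ ⟨k, rfl⟩
    change _ ∈ ψ.range
    rcases Nat.even_or_odd' k with ⟨n, rfl | rfl⟩
    · rw [d.om_even]; exact ψ.range.zero_mem
    · cases n with
      | zero => rw [show 2 * 0 + 1 = 1 from rfl, d.om_one]; exact ψ.range.algebraMap_mem _
      | succ n =>
        refine ⟨MvPolynomial.X n, ?_⟩
        change (Subalgebra.center R A).val (MvPolynomial.aeval z (MvPolynomial.X n)) = _
        rw [MvPolynomial.aeval_X]
        rfl
  obtain ⟨p, hp⟩ := hle hw
  have hp' : ψ p = w := hp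
  rw [← hp']
  clear hp hp' hw
  induction p using MvPolynomial.induction_on' with
  | add p q hp hq => rw [map_add]; exact Submodule.add_mem _ hp hq
  | monomial g c =>
    have : ψ (MvPolynomial.monomial g c) = c • d.ompow g := by
      change (Subalgebra.center R A).val (MvPolynomial.aeval z (MvPolynomial.monomial g c)) = _
      rw [MvPolynomial.aeval_monomial, map_mul, AlgHom.commutes, Algebra.smul_def]
      congr 1
      rw [Finsupp.prod, ← Finset.sort_toFinset (r := (· ≤ ·)) g.support,
        List.prod_toFinset _ (Finset.sort_nodup _ _), map_list_prod, List.map_map]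
      rw [ompow]
      rfl
    rw [this]
    exact Submodule.smul_mem _ _ (Submodule.subset_span ⟨g, rfl⟩)

end AWBC

namespace Filt
variable {R A : Type} [CommRing R] [Ring A] [Algebra R A] (T : Filt R A)

/-- The degree zero part as an algebra homomorphism. -/
def zeroHom (B : Subalgebra R A) (hB : ∀ b ∈ B, b ∈ T.F 0) : B →ₐ[R] T.Gr where
  toFun b := T.cl 0 b.1
  map_one' := T.cl_one
  map_mul' a b := (T.cl_mul (hB _ a.2) (hB _ b.2)).symm
  map_zero' := T.cl_zero 0
  map_add' a b := T.cl_add (hB _ a.2) (hB _ b.2)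
  commutes' c := T.cl_alg c

lemma zeroHom_apply (B : Subalgebra R A) (hB : ∀ b ∈ B, b ∈ T.F 0) (b : B) :
    T.zeroHom B hB b = T.cl 0 b.1 := rfl

lemma cl00 {a b : A} (ha : a ∈ T.F 0) (hb : b ∈ T.F 0) : T.cl 0 a * T.cl 0 b = T.cl 0 (a * b) :=
  T.cl_mul ha hb

lemma cl01 {a b : A} (ha : a ∈ T.F 0) (hb : b ∈ T.F 1) : T.cl 0 a * T.cl 1 b = T.cl 1 (a * b) :=
  T.cl_mul ha hb

lemma cl10 {a b : A} (ha : a ∈ T.F 1) (hb : b ∈ T.F 0) : T.cl 1 a * T.cl 0 b = T.cl 1 (a * b) :=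
  T.cl_mul ha hb

lemma cl11 {a b : A} (ha : a ∈ T.F 1) (hb : b ∈ T.F 1) : T.cl 1 a * T.cl 1 b = T.cl 2 (a * b) :=
  T.cl_mul ha hb

lemma m01 {a b : A} (ha : a ∈ T.F 0) (hb : b ∈ T.F 1) : a * b ∈ T.F 1 := T.mul ha hb
lemma m10 {a b : A} (ha : a ∈ T.F 1) (hb : b ∈ T.F 0) : a * b ∈ T.F 1 := T.mul ha hb
lemma m11 {a b : A} (ha : a ∈ T.F 1) (hb : b ∈ T.F 1) : a * b ∈ T.F 2 := T.mul ha hb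

lemma cl_congr {k : ℕ} {a b : A} (h : a - b ∈ T.F k) (hb : b ∈ T.F (k + 1)) :
    T.cl (k + 1) a = T.cl (k + 1) b := by
  have e : a = (a - b) + b := by abel
  rw [e, T.cl_add (T.mono k h) hb, T.cl_lower h, zero_add]

lemma F_zero_le (n : ℕ) {a : A} (h : a ∈ T.F 0) : a ∈ T.F n := by
  induction n with
  | zero => exact h
  | succ n ih => exact T.mono n ih

lemma cl_central {w : A} (hw : w ∈ T.F 0) (h : ∀ a, w * a = a * w) (g : T.Gr) :
    T.cl 0 w * g = g * T.cl 0 w := by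
  have ht : Subalgebra.centralizer R {T.cl 0 w} = ⊤ := by
    apply T.adjoin_cl
    intro n a ha
    rw [Subalgebra.mem_centralizer_iff]
    rintro _ rfl
    rw [T.cl_mul hw ha, T.cl_mul ha hw, h, Nat.add_comm]
  have hg : g ∈ Subalgebra.centralizer R {T.cl 0 w} := by rw [ht]; trivial
  exact (Subalgebra.mem_centralizer_iff R).mp hg _ rfl

end Filt

namespace AWBC
variable {R A : Type} [CommRing R] [Ring A] [Algebra R A] {r t : ℕ} {ω1 : R}
    (d : AWBC R A r t ω1) (hr : 0 < r) (ht : 0 < t)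

/-- The data restricted to the degree zero part. -/
def dB : WBC R d.B0 r t := d.toWBC.restrict d.B0 d.σ_mem d.σb_mem d.c_mem d.cb_mem d.e_mem

variable (T : Filt R A) (hB : ∀ b ∈ d.B0, b ∈ T.F 0) (hx : d.x1 ∈ T.F 1) (hxb : d.xb1 ∈ T.F 1)

/-- The data in the graded algebra. -/
def dG : WBC R T.Gr r t := d.dB.map (T.zeroHom d.B0 hB)

lemma tau_mem (g) : d.tau g ∈ d.B0 := d.B0.mul_mem (d.σ_mem _) (d.σb_mem _)

lemma dG_tau (g) : (d.dG T hB).tau g = T.cl 0 (d.tau g) :=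
  T.cl00 (hB _ (d.σ_mem g.1)) (hB _ (d.σb_mem g.2))

lemma X_mem (hB : ∀ b ∈ d.B0, b ∈ T.F 0) (hx : d.x1 ∈ T.F 1) (i) : d.X hr i ∈ T.F 1 :=
  T.m10 (T.m01 (hB _ (d.tau_mem _)) hx) (hB _ (d.tau_mem _))

lemma Xb_mem (hB : ∀ b ∈ d.B0, b ∈ T.F 0) (hxb : d.xb1 ∈ T.F 1) (i) : d.Xb ht i ∈ T.F 1 :=
  T.m10 (T.m01 (hB _ (d.tau_mem _)) hxb) (hB _ (d.tau_mem _))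

lemma basElt_mem (i : BCIndex r t) : d.toWBC.basElt i ∈ d.B0 ∧
    (d.dG T hB).basElt i = T.cl 0 (d.toWBC.basElt i) := by
  have h1 : d.B0.val (d.dB.basElt i) = d.toWBC.basElt i :=
    map_basElt d.dB d.toWBC d.B0.val ⟨fun _ => rfl, fun _ => rfl, fun _ => rfl, fun _ => rfl, rfl⟩ i
  have h2 : T.zeroHom d.B0 hB (d.dB.basElt i) = (d.dG T hB).basElt i :=
    map_basElt d.dB (d.dG T hB) (T.zeroHom d.B0 hB)
      ⟨fun _ => rfl, fun _ => rfl, fun _ => rfl, fun _ => rfl, rfl⟩ i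
  rw [← h1, ← h2]
  exact ⟨(d.dB.basElt i).2, rfl⟩

lemma cl_xv (hB : ∀ b ∈ d.B0, b ∈ T.F 0) (hx : d.x1 ∈ T.F 1) (i : Fin r) :
    d.xv ((i : ℕ) + 1) ∈ T.F 1 ∧ T.cl 1 (d.X hr i) = T.cl 1 (d.xv ((i : ℕ) + 1)) := by
  have h1 := d.X_mem hr T hB hx i
  have h2 : d.L ((i : ℕ) + 1) ∈ T.F 0 := hB _ (d.L_mem _)
  have h3 : d.xv ((i : ℕ) + 1) = d.X hr i - d.L ((i : ℕ) + 1) := by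
    rw [xv, xp_eq d hr i i.2]
  have h4 : d.xv ((i : ℕ) + 1) ∈ T.F 1 := by
    rw [h3]; exact Submodule.sub_mem _ h1 (T.mono 0 h2)
  refine ⟨h4, T.cl_congr ?_ h4⟩
  rw [h3, sub_sub_cancel]; exact h2

lemma cl_xbv (hB : ∀ b ∈ d.B0, b ∈ T.F 0) (hxb : d.xb1 ∈ T.F 1) (i : Fin t) :
    d.xbv ((i : ℕ) + 1) ∈ T.F 1 ∧ T.cl 1 (d.Xb ht i) = T.cl 1 (d.xbv ((i : ℕ) + 1)) := by
  have h1 := d.Xb_mem ht T hB hxb i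
  have h2 : d.Lb ((i : ℕ) + 1) ∈ T.F 0 := hB _ (d.Lb_mem _)
  have h3 : d.xbv ((i : ℕ) + 1) = d.Xb ht i - d.Lb ((i : ℕ) + 1) := by
    rw [xbv, xbp_eq d ht i i.2]
  have h4 : d.xbv ((i : ℕ) + 1) ∈ T.F 1 := by
    rw [h3]; exact Submodule.sub_mem _ h1 (T.mono 0 h2)
  refine ⟨h4, T.cl_congr ?_ h4⟩
  rw [h3, sub_sub_cancel]; exact h2

lemma GD_dG (h2 : IsUnit (2 : R)) (hx : d.x1 ∈ T.F 1) (hxb : d.xb1 ∈ T.F 1) :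
    GD (d.dG T hB) hr ht (fun i => T.cl 1 (d.X hr i)) (fun i => T.cl 1 (d.Xb ht i)) := by
  have hX := d.X_mem hr T hB hx
  have hXb := d.Xb_mem ht T hB hxb
  have hτ : ∀ g, d.tau g ∈ T.F 0 := fun g => hB _ (d.tau_mem g)
  have hc : ∀ g, d.c g ∈ T.F 0 := fun g => hB _ (d.c_mem g)
  have hcb : ∀ g, d.cb g ∈ T.F 0 := fun g => hB _ (d.cb_mem g)
  have he : d.e ∈ T.F 0 := hB _ d.e_mem
  have ec : ∀ i, (d.dG T hB).c i = T.cl 0 (d.c i) := fun _ => rfl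
  have ecb : ∀ i, (d.dG T hB).cb i = T.cl 0 (d.cb i) := fun _ => rfl
  have eE : (d.dG T hB).e = T.cl 0 d.e := rfl
  apply GD.of
  · intro g i
    rw [dG_tau, T.cl01 (hτ g) (hX i), T.cl10 (hX _) (hτ g), d.X_tau]
  · intro g i
    rw [dG_tau, T.cl01 (hτ g) (hXb i), T.cl10 (hXb _) (hτ g), d.Xb_tau]
  · intro h
    rw [T.cl11 (hX _) (hX _), T.cl11 (hX _) (hX _)]
    refine T.cl_congr (k := 1) ?_ (T.m11 (hX _) (hX _))
    rw [X_zero]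
    have hq : (1 - d.c ⟨0, by omega⟩ * d.c ⟨1, h⟩) * d.σ (sw r 0 1) ∈ T.F 0 :=
      hB _ (d.B0.mul_mem (d.B0.sub_mem d.B0.one_mem (d.B0.mul_mem (d.c_mem _) (d.c_mem _)))
        (d.σ_mem _))
    have h3 := d.x_comm h
    rw [← X_one d hr h] at h3
    generalize hQ : (1 - d.c ⟨0, by omega⟩ * d.c ⟨1, h⟩) * d.σ (sw r 0 1) = Q at h3 hq
    rw [mul_sub, sub_mul] at h3
    have h4 := sub_eq_sub_iff_sub_eq_sub.mp h3
    rw [h4]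
    exact Submodule.sub_mem _ (T.m10 hx hq) (T.m01 hq hx)
  · intro h
    rw [T.cl11 (hXb _) (hXb _), T.cl11 (hXb _) (hXb _)]
    refine T.cl_congr (k := 1) ?_ (T.m11 (hXb _) (hXb _))
    rw [Xb_zero]
    have hq : (1 + d.cb ⟨0, by omega⟩ * d.cb ⟨1, h⟩) * d.σb (sw t 0 1) ∈ T.F 0 :=
      hB _ (d.B0.mul_mem (d.B0.add_mem d.B0.one_mem (d.B0.mul_mem (d.cb_mem _) (d.cb_mem _)))
        (d.σb_mem _))
    have h3 := d.xb_comm h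
    rw [← Xb_one d ht h] at h3
    generalize hQ : (1 + d.cb ⟨0, by omega⟩ * d.cb ⟨1, h⟩) * d.σb (sw t 0 1) = Q at h3 hq
    rw [mul_sub, sub_mul] at h3
    have h4 := sub_eq_sub_iff_sub_eq_sub.mp h3
    rw [h4]
    exact Submodule.sub_mem _ (T.m10 hxb hq) (T.m01 hq hxb)
  · rw [T.cl11 (hX _) (hXb _), T.cl11 (hXb _) (hX _)]
    refine T.cl_congr (k := 1) ?_ (T.m11 (hXb _) (hX _))
    rw [X_zero, Xb_zero]
    have hq : d.e - d.c ⟨0, hr⟩ * d.e * d.c ⟨0, hr⟩ ∈ T.F 0 :=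
      hB _ (d.B0.sub_mem d.e_mem (d.B0.mul_mem (d.B0.mul_mem (d.c_mem _) d.e_mem) (d.c_mem _)))
    have h3 := d.x_mixed hr
    have h4 : d.x1 * d.xb1 - d.xb1 * d.x1 = (d.e - d.c ⟨0, hr⟩ * d.e * d.c ⟨0, hr⟩) * d.x1
        - d.x1 * (d.e - d.c ⟨0, hr⟩ * d.e * d.c ⟨0, hr⟩) := by
      rw [add_sub_right_comm, mul_add, add_mul] at h3
      rw [sub_eq_sub_iff_add_eq_add, add_comm, h3]
    rw [h4]
    exact Submodule.sub_mem _ (T.m01 hq hx) (T.m10 hx hq)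
  · rw [ec, T.cl01 (hc _) (hX _), T.cl10 (hX _) (hc _), X_zero, d.x1_c1,
      ← T.cl_neg, neg_neg]
    exact Submodule.neg_mem _ (T.m01 (hc _) hx)
  · intro h
    rw [ec, T.cl01 (hc _) (hX _), T.cl10 (hX _) (hc _), X_zero, d.x1_c _ (by simp)]
  · rw [ecb, T.cl01 (hcb _) (hXb _), T.cl10 (hXb _) (hcb _), Xb_zero, d.xb1_cb1,
      ← T.cl_neg, neg_neg]
    exact Submodule.neg_mem _ (T.m01 (hcb _) hxb)
  · intro h
    rw [ecb, T.cl01 (hcb _) (hXb _), T.cl10 (hXb _) (hcb _), Xb_zero, d.xb1_cb _ (by simp)]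
  · rw [ecb, T.cl01 (hcb _) (hX _), T.cl10 (hX _) (hcb _), X_zero, d.x1_cb_comm]
  · rw [ec, T.cl01 (hc _) (hXb _), T.cl10 (hXb _) (hc _), Xb_zero, d.xb1_c_comm]
  · intro h
    rw [eE, T.cl01 he (hX _), T.cl10 (hX _) he, X_one, d.e_sxs h]
  · intro h
    rw [eE, T.cl01 he (hXb _), T.cl10 (hXb _) he, Xb_one, d.e_sbxbsb h]
  · rw [eE, T.cl01 he (hX _), T.cl01 he (hXb _), ← T.cl_neg (T.m01 he (hXb _)), X_zero, Xb_zero]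
    have := d.e_xsum
    rw [mul_add] at this
    rw [eq_neg_of_add_eq_zero_left this]
  · rw [eE, T.cl10 (hX _) he, T.cl10 (hXb _) he, ← T.cl_neg (T.m10 (hX _) he), X_zero, Xb_zero]
    have := d.xsum_e
    rw [add_mul] at this
    rw [eq_neg_of_add_eq_zero_right this]
  · intro a
    have hp := T.cl_pow (hX ⟨0, hr⟩) (a + 1)
    rw [eE, hp.1, T.cl_mul he hp.2, T.cl_mul (T.mul he hp.2) he]
    have hd : 0 + 1 * (a + 1) + 0 = a + 1 := by omega
    rw [hd, X_zero]
    apply T.cl_lower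
    apply T.F_zero_le
    rcases Nat.even_or_odd' (a + 1) with ⟨n, h | h⟩
    · rw [h, d.e_xeven n (by omega)]; exact Submodule.zero_mem _
    · rw [h, d.e_xodd]; exact hB _ (d.B0.mul_mem (d.om_mem _) d.e_mem)
  · intro a h
    obtain ⟨u, hu⟩ := h2
    have : (2 : R) • a = 0 := by rw [two_smul, h]
    have h3 : ((↑u⁻¹ : R) * 2) • a = 0 := by rw [mul_smul, this, smul_zero]
    rwa [← hu, Units.inv_mul, one_smul] at h3

/-- The parameters in the graded algebra. -/
def OmG (hB : ∀ b ∈ d.B0, b ∈ T.F 0) : Subalgebra R T.Gr :=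
  (T.zeroHom d.W (fun b hb => hB b (d.W_le_B0 hb))).range

lemma mem_OmG {g : T.Gr} : g ∈ d.OmG T hB ↔ ∃ w ∈ d.W, g = T.cl 0 w := by
  constructor
  · rintro ⟨w, rfl⟩
    exact ⟨w.1, w.2, rfl⟩
  · rintro ⟨w, hw, rfl⟩
    exact ⟨⟨w, hw⟩, rfl⟩

lemma gen_dG (hF : T.F = wF d.B0 d.x1 d.xb1) :
    Algebra.adjoin R (GD.gens (d.dG T hB) (fun i => T.cl 1 (d.X hr i))
      (fun i => T.cl 1 (d.Xb ht i)) (d.OmG T hB)) = ⊤ := by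
  set Γ := GD.gens (d.dG T hB) (fun i => T.cl 1 (d.X hr i))
      (fun i => T.cl 1 (d.Xb ht i)) (d.OmG T hB) with hΓ
  have hg : ∀ y ∈ Γ, y ∈ Algebra.adjoin R Γ := fun y hy => Algebra.subset_adjoin hy
  refine w_adjoin_aux d.B0 d.x1 d.xb1 T hF _ ?_ ?_ ?_
  · intro b hb
    have hb' : b ∈ Algebra.adjoin R d.bg := hb
    clear hb
    induction hb' using Algebra.adjoin_induction with
    | mem b hb =>
      rcases hb with ⟨w, rfl⟩ | ⟨w, rfl⟩ | ⟨w, rfl⟩ | ⟨w, rfl⟩ | rfl | ⟨w, rfl⟩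
      · exact hg _ (Or.inl ⟨(w, 1), by rw [dG_tau, d.tau_left]⟩)
      · exact hg _ (Or.inl ⟨(1, w), by rw [dG_tau, d.tau_right]⟩)
      · exact hg _ (Or.inr (Or.inl ⟨w, rfl⟩))
      · exact hg _ (Or.inr (Or.inr (Or.inl ⟨w, rfl⟩)))
      · exact hg _ (Or.inr (Or.inr (Or.inr (Or.inl rfl))))
      · refine hg _ (Or.inr (Or.inr (Or.inr (Or.inr (Or.inr (Or.inr ?_))))))
        exact (d.mem_OmG T hB).mpr ⟨_, Algebra.subset_adjoin ⟨w, rfl⟩, rfl⟩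
    | algebraMap c => rw [T.cl_alg]; exact Subalgebra.algebraMap_mem _ c
    | add a b ha hb h1 h2 =>
      rw [T.cl_add (hB a ha) (hB b hb)]; exact Subalgebra.add_mem _ h1 h2
    | mul a b ha hb h1 h2 =>
      rw [← T.cl00 (hB a ha) (hB b hb)]; exact Subalgebra.mul_mem _ h1 h2
  · exact hg _ (Or.inr (Or.inr (Or.inr (Or.inr (Or.inl ⟨⟨0, hr⟩, congrArg _ (d.X_zero hr).symm⟩)))))
  · exact hg _ (Or.inr (Or.inr (Or.inr (Or.inr (Or.inr (Or.inl ⟨⟨0, ht⟩, congrArg _ (d.Xb_zero ht).symm⟩))))))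

lemma F_le_span (h2 : IsUnit (2 : R)) (hu : d.IsUniversal36) (hr : 0 < r) (ht : 0 < t)
    (hF : T.F = wF d.B0 d.x1 d.xb1) (hB : ∀ b ∈ d.B0, b ∈ T.F 0)
    (hx : d.x1 ∈ T.F 1) (hxb : d.xb1 ∈ T.F 1) (n : ℕ) :
    T.F n ≤ Submodule.span R {m | ∃ (α : Fin r → ℕ) (i : BCIndex r t) (β : Fin t → ℕ),
      ∃ w ∈ d.W, m = d.xpow α * d.toWBC.basElt i * d.xbpow β * w} := by
  apply T.lift_span
  have G := d.GD_dG hr ht T hB h2 hx hxb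
  have hm := G.main_span (Ω := d.OmG T hB) (by
    intro w hw a
    obtain ⟨w, hw1, rfl⟩ := (d.mem_OmG T hB).mp hw
    exact T.cl_central (hB _ (d.W_le_B0 hw1)) (d.W_central hu w hw1) a) (d.gen_dG hr ht T hB hF)
  rw [eq_top_iff, ← hm]
  apply Submodule.span_mono
  rintro _ ⟨α, i, β, w, hw, rfl⟩
  obtain ⟨w, hw1, rfl⟩ := (d.mem_OmG T hB).mp hw
  refine ⟨_, ⟨α, i, β, w, hw1, rfl⟩, ?_⟩
  refine Filt.Hm.mul (Filt.Hm.mul (Filt.Hm.mul ?_ ?_) ?_) ⟨0, hB _ (d.W_le_B0 hw1), rfl⟩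
  · refine Filt.Hm.listProd _ _ _ fun k _ => Filt.Hm.pow ?_ _
    exact ⟨1, d.cl_xv hr T hB hx k⟩
  · have := d.basElt_mem T hB i
    exact ⟨0, hB _ this.1, this.2⟩
  · refine Filt.Hm.listProd _ _ _ fun k _ => Filt.Hm.pow ?_ _
    exact ⟨1, d.cl_xbv ht T hB hxb k⟩

end AWBC

/-- Proposition 3.12: as an `R`-module, `BC^aff_{r,t}` is spanned by its regular
monomials `x^α d x̄^β ∏_{n≥1} ω_{2n+1}^{a_{2n+1}}`. -/
theorem statement9 (R A : Type) [CommRing R] [IsDomain R] [Ring A] [Algebra R A]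
    (h2 : IsUnit (2 : R)) (r t : ℕ) (hr : 1 ≤ r) (ht : 1 ≤ t) (ω1 : R)
    (d : AWBC R A r t ω1) (hu : d.IsUniversal36) :
    Submodule.span R (Set.range (fun x : ARIndex r t => d.regElt x)) = ⊤ := by
  rw [eq_top_iff]
  rintro a -
  obtain ⟨n, hn⟩ := w_top d.B0 d.x1 d.xb1 (d.gen_top hu) a
  have h1 := d.F_le_span (wFilt d.B0 d.x1 d.xb1) h2 hu hr ht rfl
    (fun b hb => (w_zero _ _ _).mpr hb) (w_gen _ _ _ (by simp)) (w_gen _ _ _ (by simp)) n hn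
  refine Submodule.span_le.mpr ?_ h1
  rintro _ ⟨α, i, β, w, hw, rfl⟩
  have hw' := d.W_span hu w hw
  change _ ∈ Submodule.span R _
  clear hw
  induction hw' using Submodule.span_induction with
  | mem w hw =>
    obtain ⟨g, rfl⟩ := hw
    exact Submodule.subset_span ⟨⟨α, β, i, g⟩, rfl⟩
  | zero => rw [mul_zero]; exact Submodule.zero_mem _
  | add x y _ _ hx hy => rw [mul_add]; exact Submodule.add_mem _ hx hy
  | smul c x _ hx => rw [mul_smul_comm]; exact Submodule.smul_mem _ c hx
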